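/- Polynomiality of pruned simple Hurwitz numbers: for every g ≥ 0 and n ≥ 1 with 2g−2+n > 0, there exists a polynomial P in n variables with rational coefficients of total degree 6g−6+3n such that K̂_{g,n}(μ_1,…,μ_n) = P(μ_1,…,μ_n) for all positive integers μ_1,…,μ_n. -/

import Mathlib

/-- `σ` is a tuple of `m` transpositions in the symmetric group on `d` letters whose
ordered product is `T`, which generates a subgroup acting transitively, and such that
every point is moved by at least two of the transpositions. -/
def IsPrunedFactorisation {d m : ℕ} (T : Equiv.Perm (Fin d))
    (σ : Fin m → Equiv.Perm (Fin d)) : Prop :=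
  (∀ i, (σ i).IsSwap) ∧
  (List.ofFn σ).prod = T ∧
  (∀ x y : Fin d, ∃ g ∈ Subgroup.closure (Set.range σ), g x = y) ∧
  (∀ x : Fin d, 2 ≤ Nat.card {i : Fin m // σ i x ≠ x})

/-- `K g μ` is the normalised pruned simple Hurwitz number `K̂_{g,n}(μ)`. -/
def IsNormalisedPrunedHurwitz (K : ℕ → Multiset ℕ → ℚ) : Prop :=
  ∀ (g : ℕ) (μ : Multiset ℕ), (∀ x ∈ μ, 1 ≤ x) →
    ∀ T : Equiv.Perm (Fin μ.sum), T.cycleType = μ.filter (fun x => 2 ≤ x) →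
      K g μ =
        (Nat.card {σ : Fin (2 * g + Multiset.card μ + μ.sum - 2) → Equiv.Perm (Fin μ.sum) //
            IsPrunedFactorisation T σ} : ℚ) /
          Nat.factorial (2 * g + Multiset.card μ + μ.sum - 2)



namespace PH

open Finset

/-- indicator -/
noncomputable def ind (P : Prop) : ℚ := by classical exact if P then 1 else 0

theorem ind_pos {P : Prop} (h : P) : ind P = 1 := by simp [ind, h]
theorem ind_neg {P : Prop} (h : ¬ P) : ind P = 0 := by simp [ind, h]
theorem ind_congr {P Q : Prop} (h : P ↔ Q) : ind P = ind Q := by rw [propext h]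
theorem ind_and (P Q : Prop) : ind (P ∧ Q) = ind P * ind Q := by
  by_cases hP : P <;> by_cases hQ : Q <;> simp [ind, hP, hQ]
theorem ind_nonneg (P : Prop) : 0 ≤ ind P := by
  by_cases hP : P <;> simp [ind, hP]

/-- sum over all lists of length m -/
noncomputable def S {α : Type} [Fintype α] : ℕ → (List α → ℚ) → ℚ
  | 0, F => F []
  | m+1, F => ∑ a, S m (fun l => F (a :: l))

section S
variable {α β : Type} [Fintype α] [Fintype β]

theorem S_congr (m : ℕ) {F G : List α → ℚ} (h : ∀ l, l.length = m → F l = G l) :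
    S m F = S m G := by
  induction m generalizing F G with
  | zero => exact h [] rfl
  | succ m ih =>
    simp only [S]
    exact Finset.sum_congr rfl fun a _ => ih fun l hl => h _ (by simp [hl])

theorem S_zero' (m : ℕ) : S m (fun _ : List α => 0) = 0 := by
  induction m with
  | zero => rfl
  | succ m ih => simp [S, ih]

theorem S_eq_zero (m : ℕ) {F : List α → ℚ} (h : ∀ l, l.length = m → F l = 0) :
    S m F = 0 := by rw [S_congr m h, S_zero']

theorem S_add (m : ℕ) (F G : List α → ℚ) : S m (fun l => F l + G l) = S m F + S m G := by
  induction m generalizing F G with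
  | zero => rfl
  | succ m ih => simp [S, ih, Finset.sum_add_distrib]

theorem S_mul (m : ℕ) (c : ℚ) (F : List α → ℚ) : S m (fun l => c * F l) = c * S m F := by
  induction m generalizing F with
  | zero => rfl
  | succ m ih => simp [S, ih, Finset.mul_sum]

theorem S_sum {ι : Type} (m : ℕ) (s : Finset ι) (F : ι → List α → ℚ) :
    S m (fun l => ∑ i ∈ s, F i l) = ∑ i ∈ s, S m (F i) := by
  induction m generalizing F with
  | zero => rfl
  | succ m ih => simp [S, ih]; rw [Finset.sum_comm]

theorem S_nonneg (m : ℕ) (F : List α → ℚ) (h : ∀ l, 0 ≤ F l) : 0 ≤ S m F := by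
  induction m generalizing F with
  | zero => exact h []
  | succ m ih => exact Finset.sum_nonneg fun a _ => ih _ fun l => h _

theorem S_map (m : ℕ) (e : α ≃ β) (F : List β → ℚ) : S m (fun l => F (l.map e)) = S m F := by
  induction m generalizing F with
  | zero => rfl
  | succ m ih =>
    simp only [S, List.map_cons]
    rw [← e.sum_comp]
    exact Finset.sum_congr rfl fun a _ => ih (fun l => F (e a :: l))

theorem S_emb (m : ℕ) (φ : α → β) (hφ : Function.Injective φ) (F : List β → ℚ)
    (h : ∀ l, ∀ b ∈ l, b ∉ Set.range φ → F l = 0) :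
    S m F = S m (fun l => F (l.map φ)) := by
  classical
  induction m generalizing F with
  | zero => rfl
  | succ m ih =>
    simp only [S, List.map_cons]
    have : ∀ a, S m (fun l => F (φ a :: l.map φ)) = S m (fun l => F (φ a :: l)) := fun a =>
      (ih (fun l => F (φ a :: l)) fun l b hb hb' => h _ b (by simp [hb]) hb').symm
    simp only [this]
    rw [← Finset.sum_image (s := univ) (g := φ) (f := fun b => S m (fun l => F (b :: l)))
      (fun a _ b _ hab => hφ hab)]
    symm
    apply Finset.sum_subset (Finset.subset_univ _)
    intro b _ hb
    apply S_eq_zero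
    intro l _
    exact h _ b (by simp) (by simpa using hb)

theorem S_snoc (m : ℕ) (F : List α → ℚ) :
    S (m+1) F = ∑ a, S m (fun l => F (l ++ [a])) := by
  induction m generalizing F with
  | zero => simp [S]
  | succ m ih =>
    rw [S, Finset.sum_congr rfl (fun a _ => ih (fun l => F (a :: l))), Finset.sum_comm]
    rfl

theorem S_ofFn (m : ℕ) (F : List α → ℚ) : S m F = ∑ σ : Fin m → α, F (List.ofFn σ) := by
  induction m generalizing F with
  | zero => simp [S]
  | succ m ih =>
    rw [← (Fin.consEquiv (fun _ : Fin (m+1) => α)).sum_comp, Fintype.sum_prod_type]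
    simp only [S, ih]
    simp [Fin.consEquiv, List.ofFn_succ]

def lf : List (α ⊕ β) → List α
  | [] => []
  | Sum.inl a :: l => a :: lf l
  | Sum.inr _ :: l => lf l
def rt : List (α ⊕ β) → List β
  | [] => []
  | Sum.inl _ :: l => rt l
  | Sum.inr b :: l => b :: rt l

theorem S_shuffle (m : ℕ) (F : List α → ℚ) (G : List β → ℚ) :
    S m (fun l : List (α ⊕ β) => F (lf l) * G (rt l)) =
      ∑ ij ∈ antidiagonal m, (m.choose ij.1 : ℚ) * (S ij.1 F * S ij.2 G) := by
  induction m generalizing F G with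
  | zero => simp [S, lf, rt]
  | succ m ih =>
    rw [Finset.sum_antidiagonal_choose_succ_mul (fun i j => S i F * S j G)]
    simp only [S, Fintype.sum_sum_type, lf, rt]
    rw [Finset.sum_congr rfl (fun a _ => ih (fun l => F (a :: l)) G),
      Finset.sum_congr rfl (fun a _ => ih F (fun l => G (a :: l))), add_comm]
    congr 1
    · rw [Finset.sum_comm]
      refine Finset.sum_congr rfl fun ij _ => ?_
      rw [Finset.mul_sum, Finset.mul_sum]
    · rw [Finset.sum_comm]
      refine Finset.sum_congr rfl fun ij hij => ?_
      have : m.choose ij.2 = m.choose ij.1 := by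
        rw [HasAntidiagonal.mem_antidiagonal] at hij
        exact (Nat.choose_symm_of_eq_add hij.symm).symm
      rw [Finset.sum_mul, Finset.mul_sum]
      simp only [this]
end S

end PH


namespace PH

open Finset Equiv
set_option linter.unusedSectionVars false

/-- transpositions -/
abbrev Sw (X : Type) [DecidableEq X] : Type := {τ : Perm X // τ.IsSwap}

section
variable {X : Type} [Fintype X] [DecidableEq X]

noncomputable instance : Fintype (Sw X) := by
  classical exact inferInstanceAs (Fintype {τ : Perm X // τ.IsSwap})

/-- product of a word -/
def pr (l : List (Sw X)) : Perm X := (l.map Subtype.val).prod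

def Inv (A : Finset X) (l : List (Sw X)) : Prop := ∀ τ ∈ l, ∀ x ∈ A, τ.1 x ∈ A

def ConnOn (A : Finset X) (l : List (Sw X)) : Prop :=
  ∀ B ⊆ A, B.Nonempty → Inv B l → B = A

def Conn (l : List (Sw X)) : Prop := Nonempty X ∧ ConnOn univ l

noncomputable def C (m : ℕ) (T : Perm X) : ℚ := S m (fun l => ind (pr l = T ∧ Conn l))

def sw (x y : X) (h : x ≠ y) : Sw X := ⟨swap x y, x, y, h, rfl⟩

theorem sw_invol (τ : Sw X) (x : X) : τ.1 (τ.1 x) = x := by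
  obtain ⟨_, a, b, h, rfl⟩ := τ
  simp

theorem sum_sw (G : Sw X → ℚ) :
    2 * ∑ τ, G τ = ∑ x, ∑ y, if h : x ≠ y then G (sw x y h) else 0 := by
  classical
  have key : ∀ τ : Sw X, ∑ x, ∑ y, (if h : x ≠ y then (if sw x y h = τ then (1:ℚ) else 0) else 0) = 2 := by
    rintro ⟨_, a, b, hab, rfl⟩
    change ∑ x, ∑ y, (if h : x ≠ y then (if sw x y h = sw a b hab then (1:ℚ) else 0) else 0) = 2
    rw [← Finset.sum_product' (f := fun x y => (if h : x ≠ y then (if sw x y h = sw a b hab then (1:ℚ) else 0) else 0)), univ_product_univ]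
    rw [← Finset.sum_subset (Finset.subset_univ ({(a,b),(b,a)} : Finset (X × X)))]
    · rw [Finset.sum_pair (by simp [hab])]
      simp [hab, hab.symm, sw, swap_comm b a]
      norm_num
    · rintro ⟨x, y⟩ _ h
      simp only [mem_insert, mem_singleton, Prod.mk.injEq, not_or, not_and] at h
      split_ifs with h1 h2
      · exfalso
        have h2 : swap x y = swap a b := congrArg Subtype.val h2
        have e1 : swap a b x = y := by rw [← h2]; simp
        rw [swap_apply_def] at e1
        split_ifs at e1 with h3 h4
        · exact h.1 h3 e1.symm
        · exact h.2 h4 e1.symm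
        · exact h1 e1
      · rfl
      · rfl
  have h2 : ∀ x y, (if h : x ≠ y then G (sw x y h) else 0) =
      ∑ τ, G τ * (if h : x ≠ y then (if sw x y h = τ then (1:ℚ) else 0) else 0) := by
    intro x y
    by_cases h : x = y <;> simp [h]
  simp only [h2]
  rw [Finset.mul_sum, Finset.sum_congr rfl (fun x _ => Finset.sum_comm), Finset.sum_comm]
  refine Finset.sum_congr rfl fun τ _ => ?_
  simp only [← Finset.mul_sum]
  rw [key]; ring

theorem Inv.compl {A : Finset X} {l : List (Sw X)} (h : Inv A l) : Inv Aᶜ l := by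
  intro τ hτ x hx
  simp only [mem_compl] at *
  intro h'
  exact hx (by simpa [sw_invol] using h τ hτ _ h')

theorem Inv.inter {A B : Finset X} {l : List (Sw X)} (h : Inv A l) (h' : Inv B l) :
    Inv (A ∩ B) l := by
  intro τ hτ x hx
  rw [mem_inter] at *
  exact ⟨h τ hτ x hx.1, h' τ hτ x hx.2⟩

theorem Inv.union {A B : Finset X} {l : List (Sw X)} (h : Inv A l) (h' : Inv B l) :
    Inv (A ∪ B) l := by
  intro τ hτ x hx
  rw [mem_union] at *
  exact hx.imp (h τ hτ x) (h' τ hτ x)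

theorem inv_cons {B : Finset X} {τ : Sw X} {l : List (Sw X)} :
    Inv B (τ :: l) ↔ (∀ x ∈ B, τ.1 x ∈ B) ∧ Inv B l := by
  simp [Inv]

theorem swap_inv_iff {B : Finset X} {x y : X} (h : x ∈ B ↔ y ∈ B) :
    ∀ z ∈ B, swap x y z ∈ B := by
  intro z hz
  rw [swap_apply_def]
  split_ifs with h1 h2
  · exact h.1 (h1 ▸ hz)
  · exact h.2 (h2 ▸ hz)
  · exact hz

def Spl (A : Finset X) (l : List (Sw X)) : Prop := Inv A l ∧ ConnOn A l ∧ ConnOn Aᶜ l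

theorem conn_of_spl {x y : X} (hxy : x ≠ y) {l : List (Sw X)} {A : Finset X} (hx : x ∈ A)
    (hy : y ∉ A) (h : Spl A l) : Conn (sw x y hxy :: l) := by
  obtain ⟨h1, h2, h3⟩ := h
  refine ⟨⟨x⟩, fun B _ hB hBi => ?_⟩
  rw [inv_cons] at hBi
  obtain ⟨hB1, hB2⟩ := hBi
  have hxyB : x ∈ B ↔ y ∈ B := by
    constructor
    · intro h; simpa [sw] using hB1 x h
    · intro h; simpa [sw] using hB1 y h
  have k1 := h2 (B ∩ A) inter_subset_right
  have k2 := h3 (B ∩ Aᶜ) inter_subset_right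
  by_cases hxB : x ∈ B
  · have e1 := k1 ⟨x, by simp [hxB, hx]⟩ (hB2.inter h1)
    have e2 := k2 ⟨y, by simp [hxyB.1 hxB, hy]⟩ (hB2.inter h1.compl)
    ext z
    simp only [mem_univ, iff_true]
    by_cases hz : z ∈ A
    · rw [← e1] at hz; exact (mem_inter.1 hz).1
    · rw [← mem_compl, ← e2] at hz; exact (mem_inter.1 hz).1
  · exfalso
    have hyB : y ∉ B := fun h => hxB (hxyB.2 h)
    obtain ⟨z, hz⟩ := hB
    by_cases hzA : z ∈ A
    · have e1 := k1 ⟨z, by simp [hz, hzA]⟩ (hB2.inter h1)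
      rw [← e1] at hx; exact hxB (mem_inter.1 hx).1
    · have e2 := k2 ⟨z, by simp [hz, hzA]⟩ (hB2.inter h1.compl)
      rw [← mem_compl, ← e2] at hy; exact hyB (mem_inter.1 hy).1

theorem not_conn_of_spl {x y : X} {l : List (Sw X)} {A : Finset X} (hx : x ∈ A)
    (hy : y ∉ A) (h : Spl A l) : ¬ Conn l := by
  rintro ⟨_, h'⟩
  have := h' A (subset_univ _) ⟨x, hx⟩ h.1
  exact hy (this ▸ mem_univ y)

theorem spl_unique {x : X} {l : List (Sw X)} {A B : Finset X} (hx : x ∈ A) (hx' : x ∈ B)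
    (h : Spl A l) (h' : Spl B l) : A = B := by
  have e1 := h.2.1 (A ∩ B) inter_subset_left ⟨x, by simp [hx, hx']⟩ (h.1.inter h'.1)
  have e2 := h'.2.1 (A ∩ B) inter_subset_right ⟨x, by simp [hx, hx']⟩ (h.1.inter h'.1)
  exact e1.symm.trans e2

theorem exists_spl {x y : X} (hxy : x ≠ y) {l : List (Sw X)} (h : Conn (sw x y hxy :: l))
    (hn : ¬ Conn l) : ∃ A, x ∈ A ∧ y ∉ A ∧ Spl A l := by
  classical
  let A : Finset X := univ.filter fun z => ∀ B, x ∈ B → Inv B l → z ∈ B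
  have hx : x ∈ A := by simp [A]; tauto
  have hAi : Inv A l := by
    intro τ hτ z hz
    simp only [A, mem_filter, mem_univ, true_and] at hz ⊢
    intro B hB hBi
    exact hBi τ hτ z (hz B hB hBi)
  have hmin : ∀ B, x ∈ B → Inv B l → A ⊆ B := by
    intro B hB hBi z hz
    simp only [A, mem_filter, mem_univ, true_and] at hz
    exact hz B hB hBi
  have hCA : ConnOn A l := by
    intro B hBA hB hBi
    by_cases hxB : x ∈ B
    · exact le_antisymm hBA (hmin B hxB hBi)
    · exfalso
      obtain ⟨z, hz⟩ := hB
      have := hmin Bᶜ (by simpa using hxB) hBi.compl (hBA hz)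
      simp at this; exact this hz
  have hy : y ∉ A := by
    intro hy
    have : A = univ := h.2 A (subset_univ _) ⟨x, hx⟩
      (inv_cons.2 ⟨swap_inv_iff (by simp [hx, hy]), hAi⟩)
    exact hn ⟨⟨x⟩, this ▸ hCA⟩
  refine ⟨A, hx, hy, hAi, hCA, ?_⟩
  intro B hBA hB hBi
  have hxB : x ∉ B := fun h => by simpa [hx] using hBA h
  by_cases hyB : y ∈ B
  · have : A ∪ B = univ := h.2 _ (subset_univ _) ⟨x, by simp [hx]⟩
      (inv_cons.2 ⟨swap_inv_iff (by simp [hx, hyB]), hAi.union hBi⟩)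
    apply le_antisymm hBA
    intro z hz
    have hz' : z ∈ A ∪ B := this ▸ mem_univ z
    simp only [mem_compl] at hz
    simpa [hz] using hz'
  · exfalso
    have : B = univ := h.2 _ (subset_univ _) hB
      (inv_cons.2 ⟨swap_inv_iff (by simp [hxB, hyB]), hBi⟩)
    exact hxB (this ▸ mem_univ x)

theorem ind_conn_cons {x y : X} (hxy : x ≠ y) (l : List (Sw X)) :
    ind (Conn (sw x y hxy :: l)) = ind (Conn l) +
      ∑ A ∈ univ.filter (fun A : Finset X => x ∈ A ∧ y ∉ A), ind (Spl A l) := by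
  classical
  by_cases hA : ∃ A, x ∈ A ∧ y ∉ A ∧ Spl A l
  · obtain ⟨A, hx, hy, h⟩ := hA
    rw [ind_pos (conn_of_spl hxy hx hy h), ind_neg (not_conn_of_spl hx hy h),
      Finset.sum_eq_single A, ind_pos h, zero_add]
    · intro B hB hBA
      simp only [mem_filter, mem_univ, true_and] at hB
      exact ind_neg fun h' => hBA (spl_unique hB.1 hx h' h)
    · simp [hx, hy]
  · rw [Finset.sum_eq_zero, add_zero]
    · apply ind_congr
      constructor
      · intro h
        by_contra hn
        exact hA (exists_spl hxy h hn)
      · rintro ⟨h1, h2⟩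
        exact ⟨h1, fun B hB hB' hi => h2 B hB hB' (inv_cons.1 hi).2⟩
    · intro A hA'
      simp only [mem_filter, mem_univ, true_and] at hA'
      exact ind_neg fun h' => hA ⟨A, hA'.1, hA'.2, h'⟩

end
end PH


namespace PH

open Finset Equiv
set_option linter.unusedSectionVars false

section
variable {X : Type} [Fintype X] [DecidableEq X]

def emb (p : X → Prop) [DecidablePred p] (τ : Sw {x // p x}) : Sw X :=
  ⟨Perm.ofSubtype τ.1, by
    obtain ⟨_, a, b, h, rfl⟩ := τ
    exact ⟨a, b, fun h' => h (Subtype.ext h'), Perm.ofSubtype_swap_eq a b⟩⟩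

variable (p : X → Prop) [DecidablePred p]

theorem emb_apply (τ : Sw {x // p x}) (x : {x // p x}) : (emb p τ).1 x.1 = (τ.1 x).1 :=
  Perm.ofSubtype_apply_coe τ.1 x

theorem emb_apply_not (τ : Sw {x // p x}) (x : X) (h : ¬ p x) : (emb p τ).1 x = x :=
  Perm.ofSubtype_apply_of_not_mem τ.1 h

theorem emb_inj : Function.Injective (emb p) := by
  intro a b h
  apply Subtype.ext
  exact Perm.ofSubtype_injective (congrArg Subtype.val h)

inductive Rel : List (Sw X) → List (Sw {x // p x}) → Prop
  | nil : Rel [] []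
  | cons (τ l l') : Rel l l' → Rel (emb p τ :: l) (τ :: l')
  | skip (τ : Sw X) (l l') : (∀ x, p x → τ.1 x = x) → Rel l l' → Rel (τ :: l) l'

variable {p}

theorem Rel.pr_apply {l : List (Sw X)} {l' : List (Sw {x // p x})} (h : Rel p l l')
    (x : {x // p x}) : pr l x.1 = (pr l' x).1 := by
  induction h with
  | nil => simp [pr]
  | cons τ l l' _ ih =>
    simp only [pr, List.map_cons, List.prod_cons, Perm.mul_apply] at *
    rw [ih, emb_apply]
  | skip τ l l' hτ _ ih =>
    simp only [pr, List.map_cons, List.prod_cons, Perm.mul_apply] at *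
    rw [ih, hτ _ (Subtype.property _)]

theorem Rel.inv_iff {l : List (Sw X)} {l' : List (Sw {x // p x})} (h : Rel p l l')
    (B : Finset {x // p x}) : Inv (B.map (Function.Embedding.subtype p)) l ↔ Inv B l' := by
  induction h with
  | nil => simp [Inv]
  | cons τ l l' _ ih =>
    rw [inv_cons, inv_cons, ih]
    apply and_congr_left'
    constructor
    · intro h x hx
      have := h x.1 (by simpa using ⟨x.2, hx⟩)
      rw [emb_apply] at this
      obtain ⟨z, hz, hz'⟩ := mem_map.1 this
      rwa [Subtype.ext hz'] at hz
    · intro h x hx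
      simp only [mem_map, Function.Embedding.subtype_apply] at hx
      obtain ⟨x, hx, rfl⟩ := hx
      rw [emb_apply]
      exact mem_map.2 ⟨_, h x hx, rfl⟩
  | skip τ l l' hτ _ ih =>
    rw [inv_cons, ih]
    constructor
    · exact fun h => h.2
    · refine fun h => ⟨?_, h⟩
      intro x hx
      simp only [mem_map, Function.Embedding.subtype_apply] at hx
      obtain ⟨x, hx, rfl⟩ := hx
      rw [hτ _ x.2]
      exact mem_map.2 ⟨_, hx, rfl⟩

theorem Rel.inv {l : List (Sw X)} {l' : List (Sw {x // p x})} (h : Rel p l l') :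
    Inv (univ.filter p) l := by
  have := (h.inv_iff univ).2 (fun τ _ x _ => mem_univ _)
  convert this
  ext x; simp

theorem Rel.conn_iff {l : List (Sw X)} {l' : List (Sw {x // p x})} (h : Rel p l l') (x0 : X)
    (hx0 : p x0) : ConnOn (univ.filter p) l ↔ Conn l' := by
  constructor
  · intro hc
    refine ⟨⟨⟨x0, hx0⟩⟩, fun B _ hB hBi => ?_⟩
    have := hc (B.map (Function.Embedding.subtype p))
      (by intro x hx; simp at hx ⊢; exact hx.1) (by simpa using hB) ((h.inv_iff B).2 hBi)
    ext x
    simp only [mem_univ, iff_true]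
    have hx : x.1 ∈ univ.filter p := by simp [x.2]
    rw [← this] at hx
    obtain ⟨z, hz, hz'⟩ := mem_map.1 hx
    rwa [Subtype.ext hz'] at hz
  · rintro ⟨_, hc⟩ B hBA hB hBi
    have e : (B.subtype p).map (Function.Embedding.subtype p) = B := by
      rw [subtype_map]
      apply filter_true_of_mem
      intro x hx
      simpa using hBA hx
    have := hc (B.subtype p) (subset_univ _)
      (by obtain ⟨z, hz⟩ := hB
          exact ⟨⟨z, by simpa using hBA hz⟩, by simpa using hz⟩)
      ((h.inv_iff _).1 (by rwa [e]))
    rw [← e, this]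
    ext x; simp

theorem rel_map (l : List (Sw {x // p x})) : Rel p (l.map (emb p)) l := by
  induction l with
  | nil => exact Rel.nil
  | cons τ l ih => exact Rel.cons _ _ _ ih

variable (p)

def phi : Sw {x // p x} ⊕ Sw {x // ¬ p x} → Sw X := Sum.elim (emb p) (emb fun x => ¬ p x)

theorem rel_lf (l : List (Sw {x // p x} ⊕ Sw {x // ¬ p x})) : Rel p (l.map (phi p)) (lf l) := by
  induction l with
  | nil => exact Rel.nil
  | cons τ l ih =>
    cases τ with
    | inl τ => exact Rel.cons _ _ _ ih
    | inr τ =>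
      exact Rel.skip _ _ _ (fun x hx => emb_apply_not (fun x => ¬ p x) τ x (by simpa using hx)) ih

theorem rel_rt (l : List (Sw {x // p x} ⊕ Sw {x // ¬ p x})) :
    Rel (fun x => ¬ p x) (l.map (phi p)) (rt l) := by
  induction l with
  | nil => exact Rel.nil
  | cons τ l ih =>
    cases τ with
    | inr τ => exact Rel.cons _ _ _ ih
    | inl τ =>
      exact Rel.skip _ _ _ (fun x hx => emb_apply_not p τ x hx) ih

theorem sw_emb_of_fix (τ : Sw X) (h : ∀ x, ¬ p x → τ.1 x = x) : τ ∈ Set.range (emb p) := by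
  obtain ⟨_, a, b, hab, rfl⟩ := τ
  have ha : p a := by
    by_contra ha
    have := h a ha
    rw [swap_apply_left] at this
    exact hab this.symm
  have hb : p b := by
    by_contra ha
    have := h b ha
    rw [swap_apply_right] at this
    exact hab this
  exact ⟨⟨swap ⟨a, ha⟩ ⟨b, hb⟩, _, _, fun h => hab (congrArg Subtype.val h), rfl⟩,
    Subtype.ext (Perm.ofSubtype_swap_eq _ _)⟩

theorem phi_inj : Function.Injective (phi p) := by
  apply Function.Injective.sumElim (emb_inj p) (emb_inj _)
  intro a b h
  have h1 : (emb p a).1 = 1 := by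
    ext x
    by_cases hx : p x
    · rw [h]; exact emb_apply_not _ b x (by simpa using hx)
    · exact emb_apply_not _ a x hx
  obtain ⟨x, y, hxy, he⟩ := (emb p a).2
  rw [h1] at he
  have : (1 : Perm X) x = y := by rw [he]; simp
  exact hxy this

theorem mem_range_phi (τ : Sw X) (h : ∀ x, p x → p (τ.1 x)) : τ ∈ Set.range (phi p) := by
  have hτ : (∀ x, ¬ p x → τ.1 x = x) ∨ (∀ x, p x → τ.1 x = x) := by
    by_contra hcon
    push Not at hcon
    obtain ⟨⟨x, hx, hx'⟩, y, hy, hy'⟩ := hcon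
    obtain ⟨_, a, b, hab, rfl⟩ := τ
    simp only at *
    have ha := h a
    have hb := h b
    rw [swap_apply_left] at ha
    rw [swap_apply_right] at hb
    have e1 : x = a ∨ x = b := by
      by_contra hh; push Not at hh
      exact hx' (swap_apply_of_ne_of_ne hh.1 hh.2)
    have e2 : y = a ∨ y = b := by
      by_contra hh; push Not at hh
      exact hy' (swap_apply_of_ne_of_ne hh.1 hh.2)
    rcases e1 with rfl | rfl <;> rcases e2 with rfl | rfl <;> tauto
  rcases hτ with h1 | h1
  · obtain ⟨t, ht⟩ := sw_emb_of_fix p τ h1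
    exact ⟨Sum.inl t, ht⟩
  · obtain ⟨t, ht⟩ := sw_emb_of_fix (fun x => ¬ p x) τ (by simpa using h1)
    exact ⟨Sum.inr t, ht⟩

theorem inv_pr {A : Finset X} {l : List (Sw X)} (h : Inv A l) : ∀ x ∈ A, pr l x ∈ A := by
  induction l with
  | nil => simp [pr]
  | cons τ l ih =>
    intro x hx
    rw [inv_cons] at h
    simp only [pr, List.map_cons, List.prod_cons, Perm.mul_apply] at *
    exact h.1 _ (ih h.2 x hx)

theorem perm_inv_iff {A : Finset X} {U : Perm X} (h : ∀ x ∈ A, U x ∈ A) (x : X) :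
    U x ∈ A ↔ x ∈ A := by
  refine ⟨fun hx => ?_, h x⟩
  have : A.map U.toEmbedding = A := by
    apply Finset.eq_of_subset_of_card_le
    · intro z hz
      simp only [mem_map_equiv] at hz
      simpa using h _ hz
    · simp
  rw [← this] at hx
  simpa using hx

theorem split_count (m : ℕ) (U : Perm X) (x y : X) (hx : p x) (hy : ¬ p y)
    (hU : ∀ z, p (U z) ↔ p z) :
    S m (fun l => ind (pr l = U ∧ Spl (univ.filter p) l)) =
      ∑ ij ∈ antidiagonal m, (m.choose ij.1 : ℚ) *
        (C ij.1 (U.subtypePerm hU : Perm {z // p z}) *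
         C ij.2 (U.subtypePerm (fun z => not_congr (hU z)) : Perm {z // ¬ p z})) := by
  rw [S_emb m (phi p) (phi_inj _)]
  · unfold C
    rw [← S_shuffle]
    apply S_congr
    intro l _
    rw [← ind_and]
    apply ind_congr
    have r1 := rel_lf p l
    have r2 := rel_rt p l
    have c1 := r1.conn_iff x hx
    have c2 := r2.conn_iff y hy
    have i1 := r1.inv
    have eA' : univ.filter (fun z => ¬ p z) = (univ.filter p)ᶜ := by ext; simp
    rw [eA'] at c2
    unfold Spl
    rw [← c1, ← c2]
    have e : pr (l.map (phi p)) = U ↔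
        pr (lf l) = (U.subtypePerm hU : Perm {z // p z}) ∧
        pr (rt l) = (U.subtypePerm (fun z => not_congr (hU z)) : Perm {z // ¬ p z}) := by
      constructor
      · intro h
        constructor
        · ext z
          rw [← r1.pr_apply, h]; rfl
        · ext z
          rw [← r2.pr_apply, h]; rfl
      · rintro ⟨h1, h2⟩
        ext z
        by_cases hz : p z
        · have := r1.pr_apply ⟨z, hz⟩
          rw [h1] at this
          exact this
        · have := r2.pr_apply ⟨z, hz⟩
          rw [h2] at this
          exact this
    rw [e]
    tauto
  · intro l b hb hb'
    apply ind_neg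
    rintro ⟨_, h, _⟩
    exact hb' (mem_range_phi _ b (by simpa using h b hb))

theorem split_zero (m : ℕ) (A : Finset X) (U : Perm X) (hU : ¬ ∀ z, U z ∈ A ↔ z ∈ A) :
    S m (fun l => ind (pr l = U ∧ Spl A l)) = 0 := by
  apply S_eq_zero
  intro l _
  apply ind_neg
  rintro ⟨rfl, h, _⟩
  exact hU (perm_inv_iff (inv_pr h))

end
end PH


namespace PH

open Finset Equiv
set_option linter.unusedSectionVars false

section
variable {X : Type} [Fintype X] [DecidableEq X]

def orb (T : Perm X) (x : X) : Finset X := univ.filter (fun y => T.SameCycle x y)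
def Orbs (T : Perm X) : Finset (Finset X) := univ.image (orb T)
def Ty (T : Perm X) : Multiset ℕ := (Orbs T).val.map Finset.card

theorem mem_orb {T : Perm X} {x y : X} : y ∈ orb T x ↔ T.SameCycle x y := by simp [orb]
theorem self_mem_orb (T : Perm X) (x : X) : x ∈ orb T x := by simp [orb, Perm.SameCycle.rfl]
theorem orb_mem (T : Perm X) (x : X) : orb T x ∈ Orbs T := by simp [Orbs]
theorem mem_Orbs {T : Perm X} {O : Finset X} : O ∈ Orbs T ↔ ∃ x, orb T x = O := by simp [Orbs]

theorem orb_eq_iff {T : Perm X} {x y : X} : orb T x = orb T y ↔ T.SameCycle x y := by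
  constructor
  · intro h
    rw [← mem_orb, h]; exact self_mem_orb T y
  · intro h
    ext z
    rw [mem_orb, mem_orb]
    exact ⟨fun h' => h.symm.trans h', fun h' => h.trans h'⟩

theorem orb_eq_of_mem {T : Perm X} {x : X} {O : Finset X} (hO : O ∈ Orbs T) (hx : x ∈ O) :
    orb T x = O := by
  obtain ⟨y, rfl⟩ := mem_Orbs.1 hO
  exact (orb_eq_iff.2 (mem_orb.1 hx)).symm

theorem sum_orb (T : Perm X) (F : Finset X → ℚ) :
    ∑ x, F (orb T x) = ∑ O ∈ Orbs T, (O.card : ℚ) * F O := by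
  rw [Finset.sum_comp F (orb T)]
  refine Finset.sum_congr rfl fun O hO => ?_
  rw [nsmul_eq_mul]
  congr 2
  congr 1
  ext x
  simp only [mem_filter, mem_univ, true_and]
  exact ⟨fun h => h ▸ self_mem_orb T x, orb_eq_of_mem hO⟩

theorem orb_cycleOn (T : Perm X) (x : X) : T.IsCycleOn (orb T x : Set X) := by
  constructor
  · refine ⟨?_, T.injective.injOn, ?_⟩
    · intro y hy
      simp only [mem_coe, mem_orb] at *
      simpa using hy
    · intro y hy
      simp only [mem_coe, mem_orb] at *
      exact ⟨T.symm y, by simpa [mem_orb] using hy, by simp⟩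
  · intro a ha b hb
    simp only [mem_coe, mem_orb] at *
    exact ha.symm.trans hb

theorem orb_of_period {U : Perm X} {x : X} {p : ℕ} (hp : 0 < p) (h : (U ^ p) x = x) :
    orb U x = (range p).image (fun k => (U ^ k) x) := by
  ext y
  simp only [mem_orb, mem_image, mem_range]
  constructor
  · intro hy
    obtain ⟨k, rfl⟩ := hy.exists_nat_pow_eq
    refine ⟨k % p, Nat.mod_lt _ hp, ?_⟩
    have h2 : ∀ n, ((U ^ p) ^ n) x = x := by
      intro n; induction n with
      | zero => rfl
      | succ n ih => rw [pow_succ, Perm.mul_apply, h, ih]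
    conv_rhs => rw [← Nat.mod_add_div k p, pow_add, Perm.mul_apply, pow_mul, h2]
  · rintro ⟨k, _, rfl⟩
    simp [Perm.SameCycle.rfl]

theorem walk {T : Perm X} {x y : X} {p : ℕ}
    (hk : ∀ k, 0 < k → k < p → (T ^ k) x ≠ x ∧ (T ^ k) x ≠ y) (k : ℕ) (hkp : k < p) :
    ((swap x y * T) ^ k) x = (T ^ k) x := by
  induction k with
  | zero => rfl
  | succ k ih =>
    rw [pow_succ', Perm.mul_apply, ih (by omega), Perm.mul_apply, ← Perm.mul_apply T, ← pow_succ']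
    exact swap_apply_of_ne_of_ne (hk _ (by omega) hkp).1 (hk _ (by omega) hkp).2

theorem walk' {T : Perm X} {x y : X} {p : ℕ} (hp : 0 < p)
    (hk : ∀ k, 0 < k → k < p → (T ^ k) x ≠ x ∧ (T ^ k) x ≠ y) :
    ((swap x y * T) ^ p) x = swap x y ((T ^ p) x) := by
  obtain ⟨q, rfl⟩ : ∃ q, p = q + 1 := ⟨p - 1, by omega⟩
  rw [pow_succ', Perm.mul_apply, walk hk q (by omega), Perm.mul_apply, ← Perm.mul_apply T,
    ← pow_succ']

theorem pow_inj {T : Perm X} {x : X} {i j : ℕ} (hi : i < (orb T x).card) (hj : j < (orb T x).card)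
    (h : (T ^ i) x = (T ^ j) x) : i = j := by
  rw [(orb_cycleOn T x).pow_apply_eq_pow_apply (self_mem_orb T x)] at h
  rwa [Nat.ModEq, Nat.mod_eq_of_lt hi, Nat.mod_eq_of_lt hj] at h

theorem join_same {T : Perm X} {x y : X} (h : ¬ T.SameCycle x y) :
    (swap x y * T).SameCycle x y := by
  have hL : 0 < (orb T x).card := card_pos.2 ⟨x, self_mem_orb T x⟩
  have := walk' (T := T) (x := x) (y := y) hL (fun k hk hk' => ⟨fun h' => ?_, fun h' => ?_⟩)
  · rw [(orb_cycleOn T x).pow_card_apply (self_mem_orb T x), swap_apply_left] at this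
    exact ⟨((orb T x).card : ℕ), by exact_mod_cast this⟩
  · have := pow_inj (T := T) (x := x) (i := k) (j := 0) hk' (by omega) (by simpa using h')
    omega
  · exact h ⟨k, by exact_mod_cast h'⟩

theorem cut1 {T : Perm X} {x : X} {p : ℕ} (hp : 0 < p) (hp' : p < (orb T x).card) :
    orb (swap x ((T ^ p) x) * T) x = (range p).image (fun k => (T ^ k) x) ∧
    (orb (swap x ((T ^ p) x) * T) x).card = p := by
  have hk : ∀ k, 0 < k → k < p → (T ^ k) x ≠ x ∧ (T ^ k) x ≠ (T ^ p) x := by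
    intro k hk hkp
    refine ⟨fun h => ?_, fun h => ?_⟩
    · have := pow_inj (T := T) (x := x) (i := k) (j := 0) (by omega) (by omega) (by simpa using h)
      omega
    · have := pow_inj (T := T) (x := x) (i := k) (j := p) (by omega) (by omega) h
      omega
  have e : orb (swap x ((T ^ p) x) * T) x = (range p).image (fun k => (T ^ k) x) := by
    rw [orb_of_period hp (by rw [walk' hp hk]; simp)]
    apply Finset.image_congr
    intro k hk'
    exact walk hk k (by simpa using hk')
  refine ⟨e, ?_⟩
  rw [e, card_image_of_injOn, card_range]
  intro i hi j hj h
  simp only [coe_range, Set.mem_Iio] at hi hj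
  exact pow_inj (by omega) (by omega) h

theorem orb_pow_card (T : Perm X) (x : X) (p : ℕ) : orb T ((T ^ p) x) = orb T x :=
  orb_eq_iff.2 (by simp [Perm.SameCycle.rfl])

theorem cut2 {T : Perm X} {x : X} {p : ℕ} (hp : 0 < p) (hp' : p < (orb T x).card) :
    (orb (swap x ((T ^ p) x) * T) ((T ^ p) x)).card = (orb T x).card - p := by
  have h := cut1 (T := T) (x := (T ^ p) x) (p := (orb T x).card - p) (by omega)
    (by rw [orb_pow_card]; omega)
  have e : (T ^ ((orb T x).card - p)) ((T ^ p) x) = x := by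
    rw [← Perm.mul_apply, ← pow_add, Nat.sub_add_cancel hp'.le]
    exact (orb_cycleOn T x).pow_card_apply (self_mem_orb T x)
  rw [e, swap_comm] at h
  exact h.2

theorem cut_exists {T : Perm X} {x y : X} (hxy : x ≠ y) (h : T.SameCycle x y) :
    ∃ p, 0 < p ∧ p < (orb T x).card ∧ (T ^ p) x = y := by
  obtain ⟨p, hp, rfl⟩ := (orb_cycleOn T x).exists_pow_eq (self_mem_orb T x) (mem_orb.2 h)
  refine ⟨p, Nat.pos_of_ne_zero ?_, hp, rfl⟩
  rintro rfl
  exact hxy rfl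

theorem pow_eq_on {T U : Perm X} {z : X} (h : ∀ w ∈ orb T z, U w = T w) : orb U z = orb T z := by
  have hp : ∀ k : ℕ, (U ^ k) z = (T ^ k) z := by
    intro k
    induction k with
    | zero => rfl
    | succ k ih =>
      rw [pow_succ', Perm.mul_apply, ih, h _ (by simp [mem_orb, Perm.SameCycle.rfl]), pow_succ',
        Perm.mul_apply]
  ext w
  rw [mem_orb, mem_orb]
  constructor
  · intro hw
    obtain ⟨k, rfl⟩ := hw.exists_nat_pow_eq
    rw [hp]; simp [Perm.SameCycle.rfl]
  · intro hw
    obtain ⟨k, rfl⟩ := hw.exists_nat_pow_eq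
    rw [← hp]; simp [Perm.SameCycle.rfl]

theorem cut_not_same {T : Perm X} {x y : X} (hxy : x ≠ y) (h : T.SameCycle x y) :
    ¬ (swap x y * T).SameCycle x y := by
  obtain ⟨p, hp, hp', rfl⟩ := cut_exists hxy h
  rw [← mem_orb, (cut1 hp hp').1]
  intro h
  simp only [mem_image, mem_range] at h
  obtain ⟨k, hk, hk'⟩ := h
  have := pow_inj (T := T) (x := x) (i := k) (j := p) (by omega) (by omega) hk'
  omega

theorem cut_other {T : Perm X} {x y : X} (h : T.SameCycle x y) {z : X}
    (hz : ¬ T.SameCycle x z) : orb (swap x y * T) z = orb T z := by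
  apply pow_eq_on
  intro w hw
  rw [mem_orb] at hw
  rw [Perm.mul_apply]
  apply swap_apply_of_ne_of_ne
  · rintro h'
    exact hz (Perm.SameCycle.symm (hw.trans ⟨1, by simpa using h'⟩))
  · rintro h'
    exact hz (h.trans (Perm.SameCycle.symm (hw.trans ⟨1, by simpa using h'⟩)))

theorem cut_disj {T : Perm X} {x y : X} (hxy : x ≠ y) (h : T.SameCycle x y) :
    Disjoint (orb (swap x y * T) x) (orb (swap x y * T) y) := by
  rw [Finset.disjoint_left]
  intro z hz hz'
  rw [mem_orb] at *
  exact cut_not_same hxy h (hz.trans hz'.symm)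

theorem cut_union {T : Perm X} {x y : X} (hxy : x ≠ y) (h : T.SameCycle x y) :
    orb (swap x y * T) x ∪ orb (swap x y * T) y = orb T x := by
  have hsub : ∀ w, T.SameCycle x w → orb (swap x y * T) w ⊆ orb T x := by
    intro w hw z hz
    rw [mem_orb] at *
    by_contra hcon
    have := cut_other h hcon
    have h1 : w ∈ orb (swap x y * T) z := mem_orb.2 hz.symm
    rw [this, mem_orb] at h1
    exact hcon (hw.trans h1.symm)
  apply Finset.eq_of_subset_of_card_le
  · exact union_subset (hsub x Perm.SameCycle.rfl) (hsub y h)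
  · rw [card_union_of_disjoint (cut_disj hxy h)]
    obtain ⟨p, hp, hp', rfl⟩ := cut_exists hxy h
    rw [(cut1 hp hp').2, cut2 hp hp']
    omega

theorem cut_Orbs {T : Perm X} {x y : X} (hxy : x ≠ y) (h : T.SameCycle x y) :
    ((Orbs (swap x y * T)).erase (orb (swap x y * T) x)).erase (orb (swap x y * T) y) =
      (Orbs T).erase (orb T x) := by
  ext O
  simp only [mem_erase, ne_eq, mem_Orbs]
  have hU := cut_union hxy h
  constructor
  · rintro ⟨h1, h2, z, rfl⟩
    have hz : ¬ T.SameCycle x z := by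
      intro hz
      rw [← mem_orb, ← hU, mem_union, mem_orb, mem_orb] at hz
      rcases hz with hz | hz
      · exact h2 (orb_eq_iff.2 hz).symm
      · exact h1 (orb_eq_iff.2 hz).symm
    rw [cut_other h hz]
    exact ⟨fun h' => hz (orb_eq_iff.1 h').symm, z, rfl⟩
  · rintro ⟨h1, z, rfl⟩
    have hz : ¬ T.SameCycle x z := fun h' => h1 (orb_eq_iff.2 h').symm
    have e := cut_other h hz
    refine ⟨fun h' => hz ?_, fun h' => hz ?_, z, e⟩
    · rw [← e, orb_eq_iff] at h'
      rw [← mem_orb, ← hU, mem_union, mem_orb, mem_orb]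
      exact Or.inr h'.symm
    · rw [← e, orb_eq_iff] at h'
      rw [← mem_orb, ← hU, mem_union, mem_orb, mem_orb]
      exact Or.inl h'.symm

theorem Ty_erase (T : Perm X) (x : X) :
    (((Orbs T).erase (orb T x)).val.map Finset.card) = (Ty T).erase (orb T x).card := by
  unfold Ty
  conv_rhs => rw [← Finset.insert_erase (orb_mem T x), Finset.insert_val_of_notMem (by simp)]
  simp

theorem card_mem_Ty (T : Perm X) (x : X) : (orb T x).card ∈ Ty T :=
  Multiset.mem_map_of_mem _ (orb_mem T x)

theorem Ty_erase2 (T : Perm X) (x y : X) (h : ¬ T.SameCycle x y) :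
    ((((Orbs T).erase (orb T x)).erase (orb T y)).val.map Finset.card) =
      ((Ty T).erase (orb T x).card).erase (orb T y).card := by
  rw [← Ty_erase]
  have : orb T y ∈ (Orbs T).erase (orb T x) :=
    mem_erase.2 ⟨fun h' => h (orb_eq_iff.1 h').symm, orb_mem T y⟩
  conv_rhs => rw [← Finset.insert_erase this, Finset.insert_val_of_notMem (by simp)]
  simp

theorem card_mem_erase (T : Perm X) (x y : X) (h : ¬ T.SameCycle x y) :
    (orb T y).card ∈ (Ty T).erase (orb T x).card := by
  rw [← Ty_erase]
  exact Multiset.mem_map_of_mem _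
    (mem_erase.2 ⟨fun h' => h (orb_eq_iff.1 h').symm, orb_mem T y⟩)

theorem cut_Ty {T : Perm X} {x y : X} (hxy : x ≠ y) (h : T.SameCycle x y) :
    Ty (swap x y * T) = (orb (swap x y * T) x).card ::ₘ (orb (swap x y * T) y).card ::ₘ
      (Ty T).erase (orb T x).card := by
  have hn := cut_not_same hxy h
  rw [← Ty_erase, ← cut_Orbs hxy h, Ty_erase2 _ _ _ hn,
    Multiset.cons_erase (card_mem_erase _ _ _ hn), Multiset.cons_erase (card_mem_Ty _ _)]

theorem join_Ty {T : Perm X} {x y : X} (hxy : x ≠ y) (h : ¬ T.SameCycle x y) :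
    Ty (swap x y * T) = ((orb T x).card + (orb T y).card) ::ₘ
      ((Ty T).erase (orb T x).card).erase (orb T y).card := by
  have hs := join_same h
  have h1 := cut_Ty hxy hs
  have h2 := cut_union hxy hs
  have h3 := cut_disj hxy hs
  have e : swap x y * (swap x y * T) = T := by rw [← mul_assoc, swap_mul_self, one_mul]
  rw [e] at h1 h2 h3
  rw [← card_union_of_disjoint h3, h2, h1]
  simp only [Multiset.erase_cons_head]
  exact (Multiset.cons_erase (card_mem_Ty _ _)).symm

end
end PH


namespace PH

open Finset Equiv
set_option linter.unusedSectionVars false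

section
variable {X : Type} [Fintype X] [DecidableEq X]
variable {Y : Type} [Fintype Y] [DecidableEq Y]

theorem Ty_sub (p : X → Prop) [DecidablePred p] (U : Perm X) (hU : ∀ z, p (U z) ↔ p z) :
    Ty (U.subtypePerm hU : Perm {z // p z}) =
      ((Orbs U).filter (fun O => ∀ z ∈ O, p z)).val.map Finset.card := by
  have hinv : ∀ x z, p x → U.SameCycle x z → p z := by
    intro x z hx hz
    obtain ⟨k, rfl⟩ := hz.exists_nat_pow_eq
    induction k with
    | zero => exact hx
    | succ k ih =>
      rw [pow_succ', Perm.mul_apply]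
      exact (hU _).2 (ih (by simp [Perm.SameCycle.rfl]))
  have horb : ∀ x : {z // p z}, (orb (U.subtypePerm hU : Perm {z // p z}) x).map
      (Function.Embedding.subtype p) = orb U x.1 := by
    intro x
    ext z
    simp only [mem_map, mem_orb, Function.Embedding.subtype_apply]
    constructor
    · rintro ⟨w, hw, rfl⟩
      exact Perm.sameCycle_subtypePerm.1 hw
    · intro hz
      exact ⟨⟨z, hinv _ _ x.2 hz⟩, Perm.sameCycle_subtypePerm.2 hz, rfl⟩
  have key : (Orbs (U.subtypePerm hU : Perm {z // p z})).map
      (Finset.mapEmbedding (Function.Embedding.subtype p)).toEmbedding =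
      (Orbs U).filter (fun O => ∀ z ∈ O, p z) := by
    ext O
    simp only [mem_map, mem_Orbs, mem_filter, RelEmbedding.coe_toEmbedding, mapEmbedding_apply]
    constructor
    · rintro ⟨_, ⟨x, rfl⟩, rfl⟩
      rw [horb]
      exact ⟨⟨_, rfl⟩, fun z hz => hinv _ _ x.2 (mem_orb.1 hz)⟩
    · rintro ⟨⟨x, rfl⟩, h⟩
      exact ⟨_, ⟨⟨x, h x (self_mem_orb U x)⟩, rfl⟩, horb _⟩
  rw [← key, Finset.map_val, Multiset.map_map]
  unfold Ty
  apply Multiset.map_congr rfl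
  intro O _
  simp [mapEmbedding_apply]

theorem Ty_pos (T : Perm X) : ∀ x ∈ Ty T, 1 ≤ x := by
  intro x hx
  obtain ⟨O, hO, rfl⟩ := Multiset.mem_map.1 hx
  obtain ⟨y, rfl⟩ := mem_Orbs.1 hO
  exact card_pos.2 ⟨y, self_mem_orb T y⟩

theorem Ty_sum (T : Perm X) : (Ty T).sum = Fintype.card X := by
  have := sum_orb T (fun _ => 1)
  simp only [sum_const, card_univ, nsmul_eq_mul, mul_one] at this
  have h2 : (Ty T).sum = ∑ O ∈ Orbs T, O.card := rfl
  rw [h2]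
  exact_mod_cast this.symm

theorem cycleType_eq (T : Perm X) : T.cycleType = (Ty T).filter (fun x => 2 ≤ x) := by
  have h1 : ∀ x, T x ≠ x → (T.cycleOf x).support = orb T x := by
    intro x hx
    ext z
    rw [Perm.mem_support_cycleOf_iff' hx, mem_orb]
  have h2 : T.cycleFactorsFinset.image Perm.support = (Orbs T).filter (fun O => 2 ≤ O.card) := by
    ext O
    simp only [mem_image, mem_filter, mem_Orbs]
    constructor
    · rintro ⟨c, hc, rfl⟩
      have hc' := (Perm.mem_cycleFactorsFinset_iff.1 hc)
      obtain ⟨x, hx⟩ := hc'.1.nonempty_support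
      have e := Perm.cycle_is_cycleOf hx hc
      have hx' : T x ≠ x := by
        rw [← hc'.2 x hx]; exact Perm.mem_support.1 hx
      refine ⟨⟨x, ?_⟩, hc'.1.two_le_card_support⟩
      rw [← h1 x hx', ← e]
    · rintro ⟨⟨x, rfl⟩, h⟩
      have hx : T x ≠ x := by
        intro hx
        have : orb T x ⊆ {x} := by
          intro z hz
          rw [mem_orb] at hz
          rw [mem_singleton]
          exact (hz.eq_of_left hx).symm
        have := card_le_card this
        rw [card_singleton] at this
        omega
      exact ⟨T.cycleOf x, Perm.cycleOf_mem_cycleFactorsFinset_iff.2 (Perm.mem_support.2 hx), h1 x hx⟩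
  have hinj : Set.InjOn (Perm.support : Perm X → Finset X) T.cycleFactorsFinset := by
    intro c hc d hd hcd
    obtain ⟨x, hx⟩ := (Perm.mem_cycleFactorsFinset_iff.1 hc).1.nonempty_support
    rw [Perm.cycle_is_cycleOf hx hc]
    have hx' : x ∈ d.support := by
      have : c.support = d.support := hcd
      rwa [← this]
    rw [← Perm.cycle_is_cycleOf hx' hd]
  unfold Ty
  rw [Multiset.filter_map]
  change _ = Multiset.map card ((Orbs T).filter (fun O => 2 ≤ O.card)).val
  rw [← h2, Finset.image_val_of_injOn hinj, Multiset.map_map, Perm.cycleType_def]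

theorem multiset_eq_of {M M' : Multiset ℕ} (h : ∀ x ∈ M, 1 ≤ x) (h' : ∀ x ∈ M', 1 ≤ x)
    (hs : M.sum = M'.sum) (hf : M.filter (fun x => 2 ≤ x) = M'.filter (fun x => 2 ≤ x)) :
    M = M' := by
  have key : ∀ N : Multiset ℕ, (∀ x ∈ N, 1 ≤ x) → N = N.filter (fun x => 2 ≤ x) +
      Multiset.replicate (N.sum - (N.filter (fun x => 2 ≤ x)).sum) 1 := by
    intro N hN
    have e : N.filter (fun x => ¬ 2 ≤ x) =
        Multiset.replicate (N.filter (fun x => ¬ 2 ≤ x)).card 1 := by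
      rw [Multiset.eq_replicate]
      refine ⟨rfl, fun b hb => ?_⟩
      rw [Multiset.mem_filter] at hb
      have := hN b hb.1
      omega
    have e2 := Multiset.filter_add_not (fun x => 2 ≤ x) N
    have e3 := congrArg Multiset.sum e2
    rw [Multiset.sum_add, e, Multiset.sum_replicate, smul_eq_mul, mul_one] at e3
    have e4 : N.sum - (N.filter (fun x => 2 ≤ x)).sum = (N.filter (fun x => ¬ 2 ≤ x)).card := by
      omega
    rw [e4, ← e, e2]
  rw [key M h, key M' h', hs, hf]

theorem exists_Ty (M : Multiset ℕ) (hM : ∀ x ∈ M, 1 ≤ x) : ∃ T : Perm (Fin M.sum), Ty T = M := by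
  obtain ⟨T, hT⟩ := (Equiv.Perm.exists_with_cycleType_iff (Fin M.sum)
    (m := M.filter (fun x => 2 ≤ x))).2 ⟨by
      rw [Fintype.card_fin]
      conv_rhs => rw [← Multiset.filter_add_not (fun x => 2 ≤ x) M]
      rw [Multiset.sum_add]; omega, fun a ha => (Multiset.mem_filter.1 ha).2⟩
  refine ⟨T, multiset_eq_of (Ty_pos T) hM (by rw [Ty_sum, Fintype.card_fin]) ?_⟩
  rw [← cycleType_eq, hT]

/-! transport along an equivalence -/
theorem same_iff (e : X ≃ Y) {T : Perm X} {T' : Perm Y} (h : ∀ x, e (T x) = T' (e x)) (x y : X) :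
    T'.SameCycle (e x) (e y) ↔ T.SameCycle x y := by
  have hp : ∀ k : ℕ, ∀ x, e ((T ^ k) x) = (T' ^ k) (e x) := by
    intro k
    induction k with
    | zero => intro x; rfl
    | succ k ih => intro x; rw [pow_succ, pow_succ, Perm.mul_apply, Perm.mul_apply, ih, h]
  constructor
  · intro h'
    obtain ⟨k, hk⟩ := h'.exists_nat_pow_eq
    rw [← hp] at hk
    rw [← e.injective hk]
    simp [Perm.SameCycle.rfl]
  · intro h'
    obtain ⟨k, rfl⟩ := h'.exists_nat_pow_eq
    rw [hp]
    simp [Perm.SameCycle.rfl]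

theorem Ty_equiv (e : X ≃ Y) {T : Perm X} {T' : Perm Y} (h : ∀ x, e (T x) = T' (e x)) :
    Ty T' = Ty T := by
  have horb : ∀ x, (orb T x).map e.toEmbedding = orb T' (e x) := by
    intro x
    ext z
    obtain ⟨z, rfl⟩ := e.surjective z
    rw [mem_orb, same_iff e h]
    simp [mem_orb]
  have : Orbs T' = (Orbs T).map (Finset.mapEmbedding e.toEmbedding).toEmbedding := by
    ext O
    simp only [mem_map, mem_Orbs, RelEmbedding.coe_toEmbedding, mapEmbedding_apply]
    constructor
    · rintro ⟨x, rfl⟩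
      obtain ⟨x, rfl⟩ := e.surjective x
      exact ⟨_, ⟨x, rfl⟩, horb x⟩
    · rintro ⟨_, ⟨x, rfl⟩, rfl⟩
      exact ⟨e x, (horb x).symm⟩
  unfold Ty
  rw [this, Finset.map_val, Multiset.map_map]
  apply Multiset.map_congr rfl
  intro O _
  simp [mapEmbedding_apply]

theorem exists_equiv {T : Perm X} {T' : Perm Y} (h : Ty T = Ty T') :
    ∃ e : X ≃ Y, ∀ x, e (T x) = T' (e x) := by
  have hc : Fintype.card X = Fintype.card Y := by rw [← Ty_sum T, ← Ty_sum T', h]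
  let e0 : X ≃ Y := Fintype.equivOfCardEq hc
  have h0 : ∀ x, e0.symm (T' x) = (e0.symm.permCongr T') (e0.symm x) := by intro x; simp
  have h1 := Ty_equiv e0.symm h0
  have h2 : IsConj T (e0.symm.permCongr T') := by
    rw [Perm.isConj_iff_cycleType_eq, cycleType_eq, cycleType_eq, h1, h]
  obtain ⟨c, hc⟩ := isConj_iff.1 h2
  refine ⟨c.trans e0, fun x => ?_⟩
  have := congrArg (fun f : Perm X => f (c x)) hc
  simp at this
  simp [this]

def eSw (e : X ≃ Y) : Sw X ≃ Sw Y :=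
  e.permCongr.subtypeEquiv (by
    intro τ
    constructor
    · rintro ⟨a, b, hab, rfl⟩
      exact ⟨e a, e b, by simpa using hab, by ext z; simp [swap_apply_def, e.symm_apply_eq]; split_ifs <;> simp⟩
    · rintro ⟨a, b, hab, h⟩
      refine ⟨e.symm a, e.symm b, by simpa using hab, ?_⟩
      have h2 : τ = e.symm.permCongr (swap a b) := by rw [← h]; ext; simp
      rw [h2]
      ext z; simp [swap_apply_def, ← e.eq_symm_apply]; split_ifs <;> simp)

theorem eSw_apply (e : X ≃ Y) (τ : Sw X) (x : X) : (eSw e τ).1 (e x) = e (τ.1 x) := by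
  simp [eSw]

theorem pr_eSw (e : X ≃ Y) (l : List (Sw X)) (x : X) :
    pr (l.map (eSw e)) (e x) = e (pr l x) := by
  induction l with
  | nil => simp [pr]
  | cons τ l ih =>
    simp only [pr, List.map_cons, List.prod_cons, Perm.mul_apply] at *
    rw [ih, eSw_apply]

theorem inv_eSw (e : X ≃ Y) (l : List (Sw X)) (B : Finset X) :
    Inv (B.map e.toEmbedding) (l.map (eSw e)) ↔ Inv B l := by
  simp only [Inv, List.mem_map, forall_exists_index, and_imp, forall_apply_eq_imp_iff₂, mem_map,
    toEmbedding_apply]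
  refine forall₄_congr fun τ _ x _ => ?_
  rw [eSw_apply]
  simp

theorem conn_eSw (e : X ≃ Y) (l : List (Sw X)) : Conn (l.map (eSw e)) ↔ Conn l := by
  unfold Conn ConnOn
  rw [e.nonempty_congr]
  apply and_congr_right'
  constructor
  · intro h B _ hB hBi
    have := h (B.map e.toEmbedding) (subset_univ _) (by simpa using hB) ((inv_eSw e l B).2 hBi)
    rwa [← map_univ_equiv e, map_inj] at this
  · intro h B _ hB hBi
    have eB : (B.map e.symm.toEmbedding).map e.toEmbedding = B := by
      ext; simp
    rw [← eB, inv_eSw] at hBi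
    have := h (B.map e.symm.toEmbedding) (subset_univ _) (by simpa using hB) hBi
    rw [← eB, this, map_univ_equiv]

theorem C_equiv (m : ℕ) (e : X ≃ Y) {T : Perm X} {T' : Perm Y} (h : ∀ x, e (T x) = T' (e x)) :
    C m T = C m T' := by
  unfold C
  rw [← S_map m (eSw e)]
  apply S_congr
  intro l _
  apply ind_congr
  rw [conn_eSw]
  apply and_congr_left'
  constructor
  · rintro rfl
    ext y
    obtain ⟨x, rfl⟩ := e.surjective y
    rw [pr_eSw, h]
  · rintro rfl
    ext x
    apply e.injective
    rw [h, pr_eSw]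

open Classical in
noncomputable def Hn (m : ℕ) (M : Multiset ℕ) : ℚ :=
  if h : ∃ T : Perm (Fin M.sum), Ty T = M then C m h.choose else 0

theorem C_eq (m : ℕ) (T : Perm X) : C m T = Hn m (Ty T) := by
  have hex := exists_Ty (Ty T) (Ty_pos T)
  rw [Hn, dif_pos hex]
  obtain ⟨e, he⟩ := exists_equiv hex.choose_spec
  exact (C_equiv m e he).symm

theorem Hn_zero_mem (m : ℕ) (M : Multiset ℕ) (h : 0 ∈ M) : Hn m M = 0 := by
  rw [Hn, dif_neg]
  rintro ⟨T, hT⟩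
  have := Ty_pos T 0 (by rwa [hT])
  omega

theorem C_nonneg (m : ℕ) (T : Perm X) : 0 ≤ C m T := S_nonneg _ _ fun _ => ind_nonneg _

theorem Hn_empty (m : ℕ) : Hn m 0 = 0 := by
  rw [Hn]
  split_ifs with h
  · apply S_eq_zero
    intro l _
    apply ind_neg
    rintro ⟨_, ⟨x⟩, _⟩
    exact absurd x.2 (by simp)
  · rfl

end
end PH


namespace PH

open Finset Equiv
set_option linter.unusedSectionVars false

/-- convolution over sub-multisets -/
def conv (F G : Multiset ℕ → ℚ) (M : Multiset ℕ) : ℚ :=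
  (M.antidiagonal.map (fun p => F p.1 * G p.2)).sum

theorem conv_zero (F G : Multiset ℕ → ℚ) : conv F G 0 = F 0 * G 0 := by simp [conv]

theorem conv_cons (F G : Multiset ℕ → ℚ) (a : ℕ) (M : Multiset ℕ) :
    conv F G (a ::ₘ M) = conv F (fun B => G (a ::ₘ B)) M + conv (fun B => F (a ::ₘ B)) G M := by
  simp [conv, Multiset.antidiagonal_cons, Multiset.map_map]

theorem conv_powerset {ι : Type} [DecidableEq ι] (s : Finset ι) (f : ι → ℕ) (F G : Multiset ℕ → ℚ) :
    ∑ B ∈ s.powerset, F (B.val.map f) * G ((s \ B).val.map f) = conv F G (s.val.map f) := by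
  induction s using Finset.induction_on generalizing F G with
  | empty => simp [conv_zero]
  | insert a s ha ih =>
    rw [Finset.sum_powerset_insert ha, Finset.insert_val_of_notMem ha, Multiset.map_cons, conv_cons,
      ← ih, ← ih]
    congr 1
    · refine Finset.sum_congr rfl fun B hB => ?_
      rw [mem_powerset] at hB
      rw [Finset.insert_sdiff_of_notMem _ (fun h => ha (hB h)),
        Finset.insert_val_of_notMem (by simp [ha]), Multiset.map_cons]
    · refine Finset.sum_congr rfl fun B hB => ?_
      rw [mem_powerset] at hB
      rw [Finset.insert_val_of_notMem (fun h => ha (hB h)), Multiset.map_cons]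
      have : insert a s \ insert a B = s \ B := by
        ext z
        simp only [mem_sdiff, mem_insert]
        constructor
        · rintro ⟨h1 | h1, h2⟩
          · exact absurd (Or.inl h1) h2
          · exact ⟨h1, fun h => h2 (Or.inr h)⟩
        · rintro ⟨h1, h2⟩
          exact ⟨Or.inr h1, fun h => h.elim (fun h => ha (h ▸ h1)) h2⟩
      rw [this]

section
variable {X : Type} [Fintype X] [DecidableEq X]

noncomputable def D (m : ℕ) (U : Perm X) (x y : X) : ℚ :=
  ∑ A ∈ univ.filter (fun A : Finset X => x ∈ A ∧ y ∉ A), S m (fun l => ind (pr l = U ∧ Spl A l))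

theorem orb_sub_inv {U : Perm X} {A : Finset X} (hU : ∀ z, U z ∈ A ↔ z ∈ A) {x z : X} (hx : x ∈ A)
    (h : U.SameCycle x z) : z ∈ A := by
  obtain ⟨k, rfl⟩ := h.exists_nat_pow_eq
  clear h
  induction k with
  | zero => exact hx
  | succ k ih => rw [pow_succ', Perm.mul_apply]; exact (hU _).2 ih

theorem D_join (m : ℕ) (U : Perm X) (x y : X) (h : U.SameCycle x y) : D m U x y = 0 := by
  apply Finset.sum_eq_zero
  intro A hA
  simp only [mem_filter, mem_univ, true_and] at hA
  apply split_zero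
  intro hU
  exact hA.2 (orb_sub_inv hU hA.1 h)

theorem split_Hn' (m : ℕ) (p : X → Prop) [DecidablePred p] (U : Perm X) (x y : X) (hx : p x) (hy : ¬ p y)
    (hU : ∀ z, p (U z) ↔ p z) :
    S m (fun l => ind (pr l = U ∧ Spl (univ.filter p) l)) =
      ∑ ij ∈ antidiagonal m, (m.choose ij.1 : ℚ) *
        (Hn ij.1 (((Orbs U).filter (fun O => ∀ z ∈ O, p z)).val.map Finset.card) *
         Hn ij.2 (((Orbs U).filter (fun O => ∀ z ∈ O, ¬ p z)).val.map Finset.card)) := by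
  rw [split_count p m U x y hx hy hU]
  refine Finset.sum_congr rfl fun ij _ => ?_
  rw [C_eq, C_eq, Ty_sub p, Ty_sub (fun z => ¬ p z)]

theorem split_Hn (m : ℕ) (A : Finset X) (U : Perm X) (x y : X) (hx : x ∈ A) (hy : y ∉ A)
    (hU : ∀ z, U z ∈ A ↔ z ∈ A) :
    S m (fun l => ind (pr l = U ∧ Spl A l)) =
      ∑ ij ∈ antidiagonal m, (m.choose ij.1 : ℚ) *
        (Hn ij.1 (((Orbs U).filter (fun O => ∀ z ∈ O, z ∈ A)).val.map Finset.card) *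
         Hn ij.2 (((Orbs U).filter (fun O => ∀ z ∈ O, z ∉ A)).val.map Finset.card)) := by
  have := split_Hn' m (fun z => z ∈ A) U x y hx hy hU
  have eA : univ.filter (fun z => z ∈ A) = A := by ext; simp
  rw [eA] at this
  exact this

theorem D_cut (m : ℕ) (U : Perm X) (x y : X) (h : ¬ U.SameCycle x y) : D m U x y =
    ∑ ij ∈ antidiagonal m, (m.choose ij.1 : ℚ) *
      conv (fun B => Hn ij.1 ((orb U x).card ::ₘ B)) (fun B => Hn ij.2 ((orb U y).card ::ₘ B))
        (((Ty U).erase (orb U x).card).erase (orb U y).card) := by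
  classical
  rw [← Ty_erase2 U x y h]
  set R := ((Orbs U).erase (orb U x)).erase (orb U y) with hR
  have hxy : orb U x ≠ orb U y := fun h' => h (orb_eq_iff.1 h')
  -- reduce to invariant sets
  have hD : D m U x y = ∑ A ∈ univ.filter (fun A : Finset X => x ∈ A ∧ y ∉ A ∧ ∀ z, U z ∈ A ↔ z ∈ A),
      S m (fun l => ind (pr l = U ∧ Spl A l)) := by
    unfold D
    symm
    apply Finset.sum_subset
    · intro A; simp only [mem_filter, mem_univ, true_and]; tauto
    · intro A hA hA'
      simp only [mem_filter, mem_univ, true_and] at hA hA'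
      apply split_zero
      tauto
  rw [hD]
  simp only [← conv_powerset, Finset.mul_sum]
  rw [Finset.sum_comm]
  have hRO : ∀ B ⊆ R, ∀ O ∈ insert (orb U x) B, O ∈ Orbs U := by
    intro B hB O hO
    rcases mem_insert.1 hO with rfl | hO
    · exact orb_mem U x
    · exact mem_of_mem_erase (mem_of_mem_erase (hB hO))
  have hmem : ∀ B ⊆ R, ∀ z, z ∈ (insert (orb U x) B).biUnion id ↔ orb U z ∈ insert (orb U x) B := by
    intro B hB z
    simp only [mem_biUnion, id]
    constructor
    · rintro ⟨O, hO, hz⟩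
      rwa [orb_eq_of_mem (hRO B hB O hO) hz]
    · intro hz
      exact ⟨_, hz, self_mem_orb U z⟩
  symm
  refine Finset.sum_bij' (fun B _ => (insert (orb U x) B).biUnion id)
    (fun A _ => R.filter (fun O => ∀ z ∈ O, z ∈ A)) ?_ ?_ ?_ ?_ ?_
  · intro B hB
    rw [mem_powerset] at hB
    simp only [mem_filter, mem_univ, true_and, hmem B hB]
    refine ⟨mem_insert_self _ _, ?_, ?_⟩
    · intro hy
      rcases mem_insert.1 hy with hy | hy
      · exact hxy hy.symm
      · have := hB hy
        simp [hR] at this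
    · intro z
      have : orb U (U z) = orb U z := orb_eq_iff.2 (by simp [Perm.SameCycle.rfl])
      rw [this]
  · intro A _
    simp
  · intro B hB
    rw [mem_powerset] at hB
    ext O
    simp only [mem_filter]
    constructor
    · rintro ⟨hO, h1⟩
      have hO' : O ∈ Orbs U := mem_of_mem_erase (mem_of_mem_erase hO)
      obtain ⟨z, rfl⟩ := mem_Orbs.1 hO'
      have := (hmem B hB z).1 (h1 z (self_mem_orb U z))
      rcases mem_insert.1 this with h2 | h2
      · simp [hR, h2] at hO
      · exact h2
    · intro hO
      refine ⟨hB hO, fun z hz => (hmem B hB z).2 ?_⟩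
      rw [orb_eq_of_mem (hRO B hB O (mem_insert_of_mem hO)) hz]
      exact mem_insert_of_mem hO
  · intro A hA
    simp only [mem_filter, mem_univ, true_and] at hA
    obtain ⟨h1, h2, h3⟩ := hA
    ext z
    rw [hmem _ (filter_subset _ _)]
    simp only [mem_insert, mem_filter]
    constructor
    · rintro (h4 | ⟨_, h4⟩)
      · exact orb_sub_inv h3 h1 (orb_eq_iff.1 h4).symm
      · exact h4 z (self_mem_orb U z)
    · intro hz
      by_cases h4 : orb U z = orb U x
      · exact Or.inl h4
      · refine Or.inr ⟨?_, fun w hw => orb_sub_inv h3 hz (mem_orb.1 hw)⟩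
        simp only [hR, mem_erase]
        refine ⟨fun h5 => h2 (orb_sub_inv h3 hz (orb_eq_iff.1 h5)), h4, orb_mem U z⟩
  · intro B hB
    rw [mem_powerset] at hB
    have hxA : x ∈ (insert (orb U x) B).biUnion id := (hmem B hB x).2 (mem_insert_self _ _)
    have hyA : y ∉ (insert (orb U x) B).biUnion id := by
      rw [hmem B hB]
      intro hy
      rcases mem_insert.1 hy with hy | hy
      · exact hxy hy.symm
      · have := hB hy
        simp [hR] at this
    have hU : ∀ z, U z ∈ (insert (orb U x) B).biUnion id ↔ z ∈ (insert (orb U x) B).biUnion id := by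
      intro z
      have : orb U (U z) = orb U z := orb_eq_iff.2 (by simp [Perm.SameCycle.rfl])
      rw [hmem B hB, hmem B hB, this]
    rw [split_Hn m _ U x y hxA hyA hU]
    have e1 : (Orbs U).filter (fun O => ∀ z ∈ O, z ∈ (insert (orb U x) B).biUnion id) =
        insert (orb U x) B := by
      ext O
      simp only [mem_filter, hmem B hB]
      constructor
      · rintro ⟨hO, h1⟩
        obtain ⟨z, rfl⟩ := mem_Orbs.1 hO
        exact h1 z (self_mem_orb U z)
      · intro hO
        refine ⟨hRO B hB O hO, fun z hz => ?_⟩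
        rwa [orb_eq_of_mem (hRO B hB O hO) hz]
    have e2 : (Orbs U).filter (fun O => ∀ z ∈ O, z ∉ (insert (orb U x) B).biUnion id) =
        insert (orb U y) (R \ B) := by
      ext O
      simp only [mem_filter, hmem B hB]
      constructor
      · rintro ⟨hO, h1⟩
        obtain ⟨z, rfl⟩ := mem_Orbs.1 hO
        have h2 := h1 z (self_mem_orb U z)
        simp only [mem_insert, not_or] at h2
        simp only [mem_insert, mem_sdiff, hR, mem_erase]
        tauto
      · intro hO
        have hO' : O ∈ Orbs U := by
          rcases mem_insert.1 hO with rfl | hO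
          · exact orb_mem U y
          · exact mem_of_mem_erase (mem_of_mem_erase (mem_sdiff.1 hO).1)
        refine ⟨hO', fun z hz => ?_⟩
        rw [orb_eq_of_mem hO' hz]
        intro hO2
        rcases mem_insert.1 hO with rfl | hO
        · rw [hmem B hB] at hyA
          exact hyA hO2
        · rcases mem_insert.1 hO2 with rfl | hO2
          · simp [hR] at hO
          · exact (mem_sdiff.1 hO).2 hO2
    have n1 : orb U x ∉ B := fun h' => by have := hB h'; simp [hR] at this
    have n2 : orb U y ∉ R \ B := fun h' => by have := (mem_sdiff.1 h').1; simp [hR] at this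
    rw [e1, e2, Finset.insert_val_of_notMem n1, Finset.insert_val_of_notMem n2]
    simp only [Multiset.map_cons]

theorem C_succ (m : ℕ) (T : Perm X) : 2 * C (m+1) T = ∑ x, ∑ y, if x ≠ y then
    C m (swap x y * T) + D m (swap x y * T) x y else 0 := by
  unfold C
  rw [S, sum_sw]
  refine Finset.sum_congr rfl fun x _ => Finset.sum_congr rfl fun y _ => ?_
  by_cases h : x ≠ y
  · rw [dif_pos h, if_pos h]
    unfold D
    rw [← S_sum, ← S_add]
    apply S_congr
    intro l _
    rw [ind_and, ind_conn_cons]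
    simp only [ind_and]
    rw [mul_add, Finset.mul_sum]
    have : pr (sw x y h :: l) = T ↔ pr l = swap x y * T := by
      have e : pr (sw x y h :: l) = swap x y * pr l := by simp [pr, sw]
      rw [e]
      constructor
      · rintro rfl; rw [← mul_assoc, swap_mul_self, one_mul]
      · intro h; rw [h, ← mul_assoc, swap_mul_self, one_mul]
    rw [ind_congr this]
  · rw [dif_neg h, if_neg h]

noncomputable def cutT (m : ℕ) (p q : ℕ) (M : Multiset ℕ) : ℚ :=
  Hn m (p ::ₘ q ::ₘ M) + ∑ ij ∈ antidiagonal m, (m.choose ij.1 : ℚ) *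
      conv (fun B => Hn ij.1 (p ::ₘ B)) (fun B => Hn ij.2 (q ::ₘ B)) M

theorem conv_zero_left (F G : Multiset ℕ → ℚ) (M : Multiset ℕ) (h : ∀ B, F B = 0) :
    conv F G M = 0 := by simp [conv, h]
theorem conv_zero_right (F G : Multiset ℕ → ℚ) (M : Multiset ℕ) (h : ∀ B, G B = 0) :
    conv F G M = 0 := by simp [conv, h]

theorem cutT_zero_left (m q : ℕ) (M : Multiset ℕ) : cutT m 0 q M = 0 := by
  unfold cutT
  rw [Hn_zero_mem _ _ (by simp), Finset.sum_eq_zero, add_zero]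
  intro ij _
  rw [conv_zero_left _ _ _ (fun B => Hn_zero_mem _ _ (by simp)), mul_zero]
theorem cutT_zero_right (m q : ℕ) (M : Multiset ℕ) : cutT m q 0 M = 0 := by
  unfold cutT
  rw [Hn_zero_mem _ _ (by simp), Finset.sum_eq_zero, add_zero]
  intro ij _
  rw [conv_zero_right _ _ _ (fun B => Hn_zero_mem _ _ (by simp)), mul_zero]

theorem Hn_rec_T (m : ℕ) (T : Perm X) : 2 * C (m+1) T =
    ((Ty T).map fun x : ℕ => (x:ℚ) * (∑ pq ∈ antidiagonal x, cutT m pq.1 pq.2 ((Ty T).erase x) +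
      (((Ty T).erase x).map fun y : ℕ => (y:ℚ) * Hn m ((x+y) ::ₘ ((Ty T).erase x).erase y)).sum)).sum := by
  rw [C_succ]
  have hx : ∀ x : X, (∑ y, if x ≠ y then C m (swap x y * T) + D m (swap x y * T) x y else 0) =
      ∑ pq ∈ antidiagonal (orb T x).card, cutT m pq.1 pq.2 ((Ty T).erase (orb T x).card) +
      (((Ty T).erase (orb T x).card).map fun y : ℕ => (y:ℚ) *
        Hn m (((orb T x).card+y) ::ₘ ((Ty T).erase (orb T x).card).erase y)).sum := by
    intro x
    rw [← Finset.sum_filter_add_sum_filter_not univ (fun y => T.SameCycle x y)]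
    congr 1
    · rw [← Finset.sum_filter, Finset.filter_filter]
      rw [Finset.Nat.sum_antidiagonal_eq_sum_range_succ (fun p q => cutT m p q ((Ty T).erase (orb T x).card)),
        Finset.sum_range_succ, Nat.sub_self, cutT_zero_right, add_zero]
      have hL : 0 < (orb T x).card := card_pos.2 ⟨x, self_mem_orb T x⟩
      rw [Finset.sum_range_eq_add_Ico _ hL, cutT_zero_left, zero_add]
      symm
      refine Finset.sum_bij (fun p _ => (T ^ p) x) ?_ ?_ ?_ ?_
      · intro p hp
        rw [mem_Ico] at hp
        simp only [mem_filter, mem_univ, true_and]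
        refine ⟨by simp [Perm.SameCycle.rfl], fun h => ?_⟩
        have := pow_inj (T := T) (x := x) (i := p) (j := 0) (by omega) (by omega) (by simpa using h.symm)
        omega
      · intro p hp q hq h
        rw [mem_Ico] at hp hq
        exact pow_inj hp.2 hq.2 h
      · intro y hy
        simp only [mem_filter, mem_univ, true_and] at hy
        obtain ⟨p, hp, hp', h⟩ := cut_exists hy.2 hy.1
        exact ⟨p, mem_Ico.2 ⟨hp, hp'⟩, h⟩
      · intro p hp
        rw [mem_Ico] at hp
        have hne : x ≠ (T ^ p) x := fun h => by
          have := pow_inj (T := T) (x := x) (i := p) (j := 0) (by omega) (by omega) (by simpa using h.symm)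
          omega
        have hs : T.SameCycle x ((T ^ p) x) := by simp [Perm.SameCycle.rfl]
        rw [D_cut _ _ _ _ (cut_not_same hne hs), C_eq, cut_Ty hne hs]
        simp only [Multiset.erase_cons_head]
        rw [(cut1 hp.1 hp.2).2, cut2 hp.1 hp.2]
        rfl
    · rw [← Ty_erase, Multiset.map_map]
      change _ = ∑ O ∈ (Orbs T).erase (orb T x), _
      have : ∀ y ∈ univ.filter (fun y => ¬ T.SameCycle x y),
          (if x ≠ y then C m (swap x y * T) + D m (swap x y * T) x y else 0) =
          Hn m (((orb T x).card + (orb T y).card) ::ₘ ((Ty T).erase (orb T x).card).erase (orb T y).card) := by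
        intro y hy
        simp only [mem_filter, mem_univ, true_and] at hy
        have hne : x ≠ y := fun h => hy (h ▸ Perm.SameCycle.rfl)
        rw [if_pos hne, D_join _ _ _ _ (join_same hy), C_eq, join_Ty hne hy, add_zero]
      rw [Finset.sum_congr rfl this, Finset.sum_filter]
      have h2 := sum_orb T (fun O => if O = orb T x then 0 else
        Hn m (((orb T x).card + O.card) ::ₘ ((Ty T).erase (orb T x).card).erase O.card))
      have h3 : ∀ y, (if ¬ T.SameCycle x y then Hn m (((orb T x).card + (orb T y).card) ::ₘ
          ((Ty T).erase (orb T x).card).erase (orb T y).card) else 0) =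
          if orb T y = orb T x then 0 else Hn m (((orb T x).card + (orb T y).card) ::ₘ
          ((Ty T).erase (orb T x).card).erase (orb T y).card) := by
        intro y
        by_cases h : T.SameCycle x y
        · rw [if_neg (not_not.2 h), if_pos (orb_eq_iff.2 h.symm)]
        · rw [if_pos h, if_neg (fun h' => h (orb_eq_iff.1 h').symm)]
      rw [Finset.sum_congr rfl fun y _ => h3 y, h2, ← Finset.add_sum_erase _ _ (orb_mem T x)]
      simp only [if_true, mul_zero, zero_add]
      refine Finset.sum_congr rfl fun O hO => ?_
      rw [if_neg (mem_erase.1 hO).1, Function.comp_apply, Ty_erase]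
  rw [Finset.sum_congr rfl fun x _ => hx x, sum_orb T (fun O => ∑ pq ∈ antidiagonal O.card, cutT m pq.1 pq.2 ((Ty T).erase O.card) +
      (((Ty T).erase O.card).map fun y : ℕ => (y:ℚ) *
        Hn m ((O.card+y) ::ₘ ((Ty T).erase O.card).erase y)).sum)]
  conv_rhs => arg 1; arg 2; rw [Ty]
  rw [Multiset.map_map]
  rfl

theorem Hn_rec (m : ℕ) (M : Multiset ℕ) (hM : ∀ x ∈ M, 1 ≤ x) : 2 * Hn (m+1) M =
    (M.map fun x : ℕ => (x:ℚ) * (∑ pq ∈ antidiagonal x, cutT m pq.1 pq.2 (M.erase x) +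
      ((M.erase x).map fun y : ℕ => (y:ℚ) * Hn m ((x+y) ::ₘ (M.erase x).erase y)).sum)).sum := by
  obtain ⟨T, hT⟩ := exists_Ty M hM
  have := Hn_rec_T m T
  rwa [C_eq, hT] at this

end
end PH


namespace PH

open Finset Equiv
set_option linter.unusedSectionVars false

theorem Hn0 (M : Multiset ℕ) (hM : ∀ x ∈ M, 1 ≤ x) : Hn 0 M = if M = {1} then 1 else 0 := by
  obtain ⟨T, hT⟩ := exists_Ty M hM
  rw [← hT, ← C_eq]
  unfold C
  simp only [S]
  have h1 : (pr ([] : List (Sw (Fin M.sum))) = T ∧ Conn ([] : List (Sw (Fin M.sum)))) ↔ M = {1} := by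
    constructor
    · rintro ⟨-, ⟨x0⟩, h2⟩
      have := h2 {x0} (subset_univ _) (singleton_nonempty _) (by intro τ hτ; simp at hτ)
      have hc : ({x0} : Finset (Fin M.sum)).card = (univ : Finset (Fin M.sum)).card := by rw [this]
      rw [card_singleton, card_univ, Fintype.card_fin] at hc
      have hne : M ≠ 0 := by rintro rfl; simp at hc
      obtain ⟨x, hx⟩ := Multiset.exists_mem_of_ne_zero hne
      have eM := Multiset.cons_erase hx
      have es : M.sum = x + (M.erase x).sum := by rw [← eM]; simp
      have := hM x hx
      have h3 : M.erase x = 0 := by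
        by_contra h3
        obtain ⟨y, hy⟩ := Multiset.exists_mem_of_ne_zero h3
        have := hM y (Multiset.mem_of_mem_erase hy)
        have := Multiset.single_le_sum (fun _ _ => Nat.zero_le _) y hy
        omega
      rw [← eM, h3, show x = 1 by omega]; rfl
    · intro h
      have hs : M.sum = 1 := by simp [h]
      have : Subsingleton (Fin M.sum) := by rw [hs]; infer_instance
      refine ⟨Subsingleton.elim _ _, ⟨⟨0, by omega⟩⟩, fun B _ hB _ => ?_⟩
      obtain ⟨b, hb⟩ := hB
      ext z
      simp [Subsingleton.elim z b, hb]
  by_cases h : M = {1}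
  · rw [ind_pos (h1.2 h), hT, if_pos h]
  · rw [ind_neg (fun h' => h (h1.1 h')), hT, if_neg h]

theorem sum_map_ne_zero {α : Type} (M : Multiset α) (f : α → ℚ) (h : (M.map f).sum ≠ 0) :
    ∃ a ∈ M, f a ≠ 0 := by
  by_contra hc
  push Not at hc
  exact h (Multiset.sum_eq_zero (by simpa using hc))

theorem conv_ne_zero {F G : Multiset ℕ → ℚ} {M : Multiset ℕ} (h : conv F G M ≠ 0) :
    ∃ B C, B + C = M ∧ F B ≠ 0 ∧ G C ≠ 0 := by
  obtain ⟨⟨B, C⟩, h1, h2⟩ := sum_map_ne_zero _ _ h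
  exact ⟨B, C, Multiset.mem_antidiagonal.1 h1, left_ne_zero_of_mul h2, right_ne_zero_of_mul h2⟩

theorem Hn_dim (m : ℕ) : ∀ M : Multiset ℕ, Hn m M ≠ 0 → ∃ g, m + 2 = 2 * g + M.sum + M.card := by
  induction m using Nat.strong_induction_on with | _ m ih => ?_
  rcases m with _ | m
  · intro M h
    have hM : ∀ x ∈ M, 1 ≤ x := by
      intro x hx
      by_contra h0
      exact h (Hn_zero_mem _ _ (by rwa [show x = 0 by omega] at hx))
    rw [Hn0 M hM] at h
    have : M = {1} := by by_contra h'; simp [h'] at h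
    exact ⟨0, by simp [this]⟩
  · intro M h
    have hM : ∀ x ∈ M, 1 ≤ x := by
      intro x hx
      by_contra h0
      exact h (Hn_zero_mem _ _ (by rwa [show x = 0 by omega] at hx))
    have h' : 2 * Hn (m+1) M ≠ 0 := mul_ne_zero two_ne_zero h
    rw [Hn_rec m M hM] at h'
    obtain ⟨x, hx, h1⟩ := sum_map_ne_zero _ _ h'
    have h2 := right_ne_zero_of_mul h1
    have eM := Multiset.cons_erase hx
    have es : M.sum = x + (M.erase x).sum := by rw [← eM]; simp
    have ec : M.card = (M.erase x).card + 1 := by rw [← eM]; simp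
    by_cases h3 : ∑ pq ∈ antidiagonal x, cutT m pq.1 pq.2 (M.erase x) = 0
    · rw [h3, zero_add] at h2
      obtain ⟨y, hy, h4⟩ := sum_map_ne_zero _ _ h2
      obtain ⟨g, hg⟩ := ih m (by omega) _ (right_ne_zero_of_mul h4)
      have eM' := Multiset.cons_erase hy
      have es' : (M.erase x).sum = y + ((M.erase x).erase y).sum := by rw [← eM']; simp
      have ec' : (M.erase x).card = ((M.erase x).erase y).card + 1 := by rw [← eM']; simp
      rw [Multiset.sum_cons, Multiset.card_cons] at hg
      exact ⟨g, by omega⟩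
    · obtain ⟨⟨p, q⟩, hpq, h4⟩ := Finset.exists_ne_zero_of_sum_ne_zero h3
      rw [HasAntidiagonal.mem_antidiagonal] at hpq
      simp only [cutT] at h4 hpq
      by_cases h5 : Hn m (p ::ₘ q ::ₘ M.erase x) = 0
      · rw [h5, zero_add] at h4
        obtain ⟨⟨i, j⟩, hij, h6⟩ := Finset.exists_ne_zero_of_sum_ne_zero h4
        rw [HasAntidiagonal.mem_antidiagonal] at hij
        obtain ⟨B, C, hBC, h7, h8⟩ := conv_ne_zero (right_ne_zero_of_mul h6)
        simp only at hij h7 h8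
        obtain ⟨g1, h9⟩ := ih i (by omega) _ h7
        obtain ⟨g2, h10⟩ := ih j (by omega) _ h8
        have e1 := congrArg Multiset.sum hBC
        have e2 := congrArg Multiset.card hBC
        simp only [Multiset.sum_cons, Multiset.card_cons, Multiset.sum_add, Multiset.card_add] at h9 h10 e1 e2
        exact ⟨g1 + g2, by omega⟩
      · obtain ⟨g, hg⟩ := ih m (by omega) _ h5
        simp only [Multiset.sum_cons, Multiset.card_cons] at hg
        exact ⟨g+1, by omega⟩


/-- product of the parts -/
def prM (M : Multiset ℕ) : ℚ := (M.map (fun x : ℕ => (x:ℚ))).prod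

theorem prM_cons (x : ℕ) (M : Multiset ℕ) : prM (x ::ₘ M) = x * prM M := by simp [prM]

theorem prM_ne {M : Multiset ℕ} (hM : ∀ x ∈ M, 1 ≤ x) : prM M ≠ 0 := by
  rw [prM]
  apply Multiset.prod_ne_zero
  intro h
  obtain ⟨x, hx, h0⟩ := Multiset.mem_map.1 h
  have := hM x hx
  have : x = 0 := by exact_mod_cast h0
  omega

noncomputable def hh (g : ℕ) (M : Multiset ℕ) : ℚ :=
  Hn (2*g+M.sum+M.card-2) M / (((2*g+M.sum+M.card-2).factorial : ℚ) * prM M)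

theorem hh_zero_mem (g : ℕ) (M : Multiset ℕ) (h : 0 ∈ M) : hh g M = 0 := by
  rw [hh, Hn_zero_mem _ _ h, zero_div]

theorem hh_empty (g : ℕ) : hh g 0 = 0 := by rw [hh, Hn_empty, zero_div]

theorem Hn_eq_hh {g m : ℕ} {M : Multiset ℕ} (h : m + 2 = 2*g+M.sum+M.card) :
    Hn m M = m.factorial * prM M * hh g M := by
  by_cases hM : ∀ x ∈ M, 1 ≤ x
  · rw [hh, show 2*g+M.sum+M.card-2 = m by omega]
    have := prM_ne hM
    have := Nat.factorial_ne_zero m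
    field_simp
  · push Not at hM
    obtain ⟨x, hx, h1⟩ := hM
    have : 0 ∈ M := by rwa [show x = 0 by omega] at hx
    rw [Hn_zero_mem _ _ this, hh_zero_mem _ _ this, mul_zero]

/-- genus shift -/
def gs (F : ℕ → ℚ) : ℕ → ℚ
  | 0 => 0
  | g+1 => F g

theorem Hn_eq_gs {g m : ℕ} {M : Multiset ℕ} (h : m + 4 = 2*g+M.sum+M.card) :
    Hn m M = m.factorial * prM M * gs (fun g => hh g M) g := by
  rcases g with _ | g
  · rw [gs, mul_zero]
    by_contra h0
    obtain ⟨g, hg⟩ := Hn_dim m M h0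
    omega
  · exact Hn_eq_hh (by omega)

theorem prM_add (B C : Multiset ℕ) : prM (B + C) = prM B * prM C := by simp [prM]

theorem sum_par (m a b g : ℕ) (f : ℕ → ℕ → ℚ) (hm : m = 2 * g + a + b)
    (hf : ∀ i j, i + j = m → f i j ≠ 0 → ∃ g1 g2, i = 2 * g1 + a ∧ j = 2 * g2 + b) :
    ∑ ij ∈ antidiagonal m, f ij.1 ij.2 = ∑ gg ∈ antidiagonal g, f (2 * gg.1 + a) (2 * gg.2 + b) := by
  symm
  rw [← Finset.sum_image (f := fun ij : ℕ × ℕ => f ij.1 ij.2) (g := fun gg : ℕ × ℕ => (2 * gg.1 + a, 2 * gg.2 + b))]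
  · apply Finset.sum_subset
    · intro x hx
      obtain ⟨y, hy, rfl⟩ := mem_image.1 hx
      rw [HasAntidiagonal.mem_antidiagonal] at hy ⊢
      simp only
      omega
    · rintro ⟨i, j⟩ hx hx'
      rw [HasAntidiagonal.mem_antidiagonal] at hx
      by_contra h0
      obtain ⟨g1, g2, h1, h2⟩ := hf i j hx h0
      apply hx'
      simp only at hx
      refine mem_image.2 ⟨(g1, g2), ?_, by simp [h1, h2]⟩
      rw [HasAntidiagonal.mem_antidiagonal]
      simp only
      omega
  · rintro ⟨a1, b1⟩ _ ⟨a2, b2⟩ _ h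
    simp only [Prod.mk.injEq] at h ⊢
    omega

theorem conv_congr {F G F' G' : Multiset ℕ → ℚ} {M : Multiset ℕ}
    (h : ∀ B C, B + C = M → F B * G C = F' B * G' C) : conv F G M = conv F' G' M := by
  unfold conv
  congr 1
  apply Multiset.map_congr rfl
  rintro ⟨B, C⟩ h1
  exact h B C (Multiset.mem_antidiagonal.1 h1)

theorem sum_conv {ι : Type} (s : Finset ι) (F G : ι → Multiset ℕ → ℚ) (M : Multiset ℕ) :
    ∑ i ∈ s, conv (F i) (G i) M = (M.antidiagonal.map (fun p => ∑ i ∈ s, F i p.1 * G i p.2)).sum := by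
  unfold conv
  rw [Multiset.sum_map_sum]

/-- normalised cut term -/
noncomputable def cut (k : ℕ → Multiset ℕ → ℚ) (g p q : ℕ) (M : Multiset ℕ) : ℚ :=
  gs (fun g => k g (p ::ₘ q ::ₘ M)) g +
    ∑ gg ∈ antidiagonal g, conv (fun B => k gg.1 (p ::ₘ B)) (fun B => k gg.2 (q ::ₘ B)) M

theorem cutT_eq {g m p q : ℕ} {M : Multiset ℕ} (hp : 1 ≤ p) (hq : 1 ≤ q)
    (h : m + 2 = 2*g+(p+q+M.sum)+M.card) :
    cutT m p q M = m.factorial * (p * q * prM M) * cut hh g p q M := by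
  unfold cutT cut
  rw [mul_add]
  congr 1
  · rw [Hn_eq_gs (g := g) (by simp; omega), prM_cons, prM_cons]; ring
  · simp only [conv, ← Multiset.sum_map_mul_left]
    rw [← Multiset.sum_map_sum, ← Multiset.sum_map_sum, ← Multiset.sum_map_mul_left]
    congr 1
    apply Multiset.map_congr rfl
    rintro ⟨B, C⟩ hBC
    rw [Multiset.mem_antidiagonal] at hBC
    simp only at hBC ⊢
    have e1 := congrArg Multiset.sum hBC
    have e2 := congrArg Multiset.card hBC
    simp only [Multiset.sum_add, Multiset.card_add] at e1 e2
    rw [sum_par m (p + B.sum + B.card - 1) (q + C.sum + C.card - 1) g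
      (fun i j => (m.choose i : ℚ) * (Hn i (p ::ₘ B) * Hn j (q ::ₘ C))) (by omega)]
    · rw [Finset.mul_sum]
      refine Finset.sum_congr rfl fun gg hgg => ?_
      rw [HasAntidiagonal.mem_antidiagonal] at hgg
      rw [Hn_eq_hh (g := gg.1) (by simp; omega), Hn_eq_hh (g := gg.2) (by simp; omega), ← hBC, prM_add,
        prM_cons, prM_cons]
      have hc := Nat.choose_mul_factorial_mul_factorial (n := m) (k := 2 * gg.1 + (p + B.sum + B.card - 1)) (by omega)
      rw [show m - (2 * gg.1 + (p + B.sum + B.card - 1)) = 2 * gg.2 + (q + C.sum + C.card - 1) by omega] at hc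
      rw [← hc]
      push_cast
      ring
    · intro i j hij h0
      obtain ⟨g1, h1⟩ := Hn_dim _ _ (left_ne_zero_of_mul (right_ne_zero_of_mul h0))
      obtain ⟨g2, h2⟩ := Hn_dim _ _ (right_ne_zero_of_mul (right_ne_zero_of_mul h0))
      simp only [Multiset.sum_cons, Multiset.card_cons] at h1 h2
      exact ⟨g1, g2, by omega, by omega⟩

theorem cut_hh_zero {g p q : ℕ} {M : Multiset ℕ} (h : p = 0 ∨ q = 0 ∨ 0 ∈ M) : cut hh g p q M = 0 := by
  unfold cut
  rw [Finset.sum_eq_zero, add_zero]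
  · rcases g with _ | g
    · rfl
    · rw [gs, hh_zero_mem]
      rcases h with rfl | rfl | h
      · simp
      · simp
      · simp [h]
  · intro gg _
    by_contra h0
    obtain ⟨B, C, hBC, h1, h2⟩ := conv_ne_zero h0
    rcases h with rfl | rfl | h
    · exact h1 (hh_zero_mem _ _ (by simp))
    · exact h2 (hh_zero_mem _ _ (by simp))
    · rw [← hBC, Multiset.mem_add] at h
      rcases h with h | h
      · exact h1 (hh_zero_mem _ _ (by simp [h]))
      · exact h2 (hh_zero_mem _ _ (by simp [h]))

/-- cut-and-join in normalised form -/
theorem cutjoin (g : ℕ) (M : Multiset ℕ) :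
    2 * ((((2 * g + M.sum + M.card : ℕ) : ℚ) - 2) * hh g M) =
    (M.map fun x : ℕ => ∑ pq ∈ antidiagonal x, (pq.1 : ℚ) * pq.2 * cut hh g pq.1 pq.2 (M.erase x)).sum +
    (M.map fun x : ℕ => ((M.erase x).map fun y : ℕ => if 1 ≤ x ∧ 1 ≤ y then ((x + y : ℕ) : ℚ) *
      hh g ((x+y) ::ₘ (M.erase x).erase y) else 0).sum).sum := by
  by_cases hM : ∀ x ∈ M, 1 ≤ x
  · by_cases h3 : 3 ≤ 2 * g + M.sum + M.card
    · obtain ⟨m, hm⟩ := Nat.exists_eq_add_of_le h3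
      have hf : ((m.factorial : ℚ) * prM M) ≠ 0 := mul_ne_zero (by exact_mod_cast Nat.factorial_ne_zero m) (prM_ne hM)
      have e := Hn_rec m M hM
      rw [Hn_eq_hh (g := g) (by omega), Nat.factorial_succ] at e
      have hm' : (((2 * g + M.sum + M.card : ℕ) : ℚ) - 2) = m + 1 := by
        rw [hm]; push_cast; ring
      rw [hm']
      apply mul_left_cancel₀ hf
      rw [← Multiset.sum_map_add, ← Multiset.sum_map_mul_left]
      push_cast at e
      refine Eq.trans (by rw [← mul_assoc]; ring) (e.trans ?_)
      congr 1
      apply Multiset.map_congr rfl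
      intro x hx
      have eM := Multiset.cons_erase hx
      have es : M.sum = x + (M.erase x).sum := by rw [← eM]; simp
      have ec : M.card = (M.erase x).card + 1 := by rw [← eM]; simp
      have ep : prM M = x * prM (M.erase x) := by rw [← prM_cons, eM]
      rw [mul_add, mul_add]
      congr 1
      · rw [Finset.mul_sum, Finset.mul_sum]
        refine Finset.sum_congr rfl fun pq hpq => ?_
        rw [HasAntidiagonal.mem_antidiagonal] at hpq
        by_cases h0 : pq.1 = 0 ∨ pq.2 = 0
        · rcases h0 with h0 | h0
          · rw [h0, cutT_zero_left]; simp
          · rw [h0, cutT_zero_right]; simp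
        · rw [cutT_eq (g := g) (by omega) (by omega) (by omega), ep]; ring
      · rw [← Multiset.sum_map_mul_left, ← Multiset.sum_map_mul_left]
        congr 1
        apply Multiset.map_congr rfl
        intro y hy
        have eM' := Multiset.cons_erase hy
        have es' : (M.erase x).sum = y + ((M.erase x).erase y).sum := by rw [← eM']; simp
        have ec' : (M.erase x).card = ((M.erase x).erase y).card + 1 := by rw [← eM']; simp
        have ep' : prM (M.erase x) = y * prM ((M.erase x).erase y) := by rw [← prM_cons, eM']
        rw [if_pos ⟨hM x hx, hM y (Multiset.mem_of_mem_erase hy)⟩,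
          Hn_eq_hh (g := g) (by simp; omega), ep, ep', prM_cons]
        ring
    · by_cases h0 : M = 0
      · subst h0; simp [hh_empty]
      · obtain ⟨x, hx⟩ := Multiset.exists_mem_of_ne_zero h0
        have eM := Multiset.cons_erase hx
        have es : M.sum = x + (M.erase x).sum := by rw [← eM]; simp
        have ec : M.card = (M.erase x).card + 1 := by rw [← eM]; simp
        have hx1 := hM x hx
        have : M.erase x = 0 := by rw [← Multiset.card_eq_zero]; omega
        have hx' : x = 1 := by omega
        have hg : g = 0 := by omega
        rw [← eM, this, hx', hg]
        simp only [Multiset.sum_cons, Multiset.card_cons, Multiset.map_cons, Multiset.map_zero, Multiset.sum_zero,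
          Multiset.erase_cons_head, Multiset.card_zero]
        rw [Finset.Nat.antidiagonal_succ]
        simp
  · push Not at hM
    obtain ⟨x, hx, h1⟩ := hM
    have h0 : 0 ∈ M := by rwa [show x = 0 by omega] at hx
    rw [hh_zero_mem _ _ h0, mul_zero, mul_zero, Multiset.sum_eq_zero, Multiset.sum_eq_zero, add_zero]
    · intro z hz
      obtain ⟨a, ha, rfl⟩ := Multiset.mem_map.1 hz
      apply Multiset.sum_eq_zero
      intro z hz
      obtain ⟨b, hb, rfl⟩ := Multiset.mem_map.1 hz
      split_ifs with h
      · rw [hh_zero_mem, mul_zero]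
        rw [Multiset.mem_cons]
        right
        rw [Multiset.mem_erase_of_ne (by omega), Multiset.mem_erase_of_ne (by omega)]
        exact h0
      · rfl
    · intro z hz
      obtain ⟨a, ha, rfl⟩ := Multiset.mem_map.1 hz
      apply Finset.sum_eq_zero
      intro pq hpq
      rw [HasAntidiagonal.mem_antidiagonal] at hpq
      rw [cut_hh_zero, mul_zero]
      by_cases h : a = 0
      · left; omega
      · right; right
        rw [Multiset.mem_erase_of_ne (by omega)]
        exact h0

end PH


namespace PH

open Finset Equiv
set_option linter.unusedSectionVars false

section
variable {X : Type} [Fintype X] [DecidableEq X]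

/-- number of transpositions moving x -/
def deg (l : List (Sw X)) (x : X) : ℕ := l.countP (fun τ => decide (τ.1 x ≠ x))

theorem deg_nil (x : X) : deg [] x = 0 := rfl
theorem deg_cons (τ : Sw X) (l : List (Sw X)) (x : X) :
    deg (τ :: l) x = deg l x + if τ.1 x ≠ x then 1 else 0 := by
  simp [deg, List.countP_cons]
theorem deg_append (l l' : List (Sw X)) (x : X) : deg (l ++ l') x = deg l x + deg l' x := by
  simp [deg]

theorem deg_zero {l : List (Sw X)} {x : X} (h : deg l x = 0) : ∀ τ ∈ l, τ.1 x = x := by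
  simpa [deg, List.countP_eq_zero] using h

theorem pr_of_deg_zero {l : List (Sw X)} {x : X} (h : deg l x = 0) : pr l x = x := by
  induction l with
  | nil => simp [pr]
  | cons τ l ih =>
    rw [deg_cons] at h
    have h1 : τ.1 x = x := by by_contra h1; simp [h1] at h
    have h2 := ih (by omega)
    simp only [pr, List.map_cons, List.prod_cons, Perm.mul_apply] at *
    rw [h2, h1]

theorem deg_eSw {Y : Type} [Fintype Y] [DecidableEq Y] (e : X ≃ Y) (l : List (Sw X)) (x : X) :
    deg (l.map (eSw e)) (e x) = deg l x := by
  induction l with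
  | nil => rfl
  | cons τ l ih => rw [List.map_cons, deg_cons, deg_cons, ih, eSw_apply]; simp

def mv (l : List (Sw X)) (p : ℕ) (v : X) : Prop := ∃ τ, l[p]? = some τ ∧ τ.1 v ≠ v

theorem mv_sum (l : List (Sw X)) (v : X) : ∑ p ∈ range l.length, ind (mv l p v) = deg l v := by
  induction l with
  | nil => simp [deg]
  | cons τ l ih =>
    rw [List.length_cons, Finset.sum_range_succ', deg_cons]
    have h1 : ∀ p, mv (τ :: l) (p+1) v ↔ mv l p v := by intro p; simp [mv]
    have h2 : mv (τ :: l) 0 v ↔ τ.1 v ≠ v := by simp [mv]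
    simp only [ind_congr (h1 _), ih, ind_congr h2]
    push_cast
    congr 1
    by_cases h : τ.1 v = v <;> simp [ind, h]

/-- all of `A` are leaves of a factorisation of T -/
def val (T : Perm X) (l : List (Sw X)) (A : Finset X) : Prop :=
  pr l = T ∧ Conn l ∧ ∀ s ∈ A, deg l s = 1

noncomputable def W (m : ℕ) (T : Perm X) (Q : Finset X → Prop) : ℚ :=
  S m (fun l => ∑ A : Finset X, ind (val T l A ∧ Q A))

noncomputable def Wp (p m : ℕ) (T : Perm X) (v : X) (Q : Finset X → Prop) : ℚ :=
  S m (fun l => ∑ A : Finset X, ind (val T l A ∧ Q A ∧ v ∈ A ∧ mv l p v))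

variable {ι : Type} [Fintype ι] [DecidableEq ι]

def ty (f : X → ι) (A : Finset X) (i : ι) : ℕ := (A.filter (fun x => f x = i)).card

theorem ty_map (f : X → ι) (e : Perm X) (A : Finset X) (h : ∀ s ∈ A, f (e s) = f s) :
    ty f (A.map e.toEmbedding) = ty f A := by
  ext i
  unfold ty
  rw [Finset.filter_map, card_map]
  congr 1
  apply Finset.filter_congr
  intro x hx
  simp [h x hx]

theorem W_Wp (m : ℕ) (T : Perm X) (v : X) (Q : Finset X → Prop) :
    W m T (fun A => Q A ∧ v ∈ A) = ∑ p ∈ range m, Wp p m T v Q := by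
  unfold W Wp
  rw [← S_sum]
  apply S_congr
  intro l hl
  rw [Finset.sum_comm]
  refine Finset.sum_congr rfl fun A _ => ?_
  have : ∀ p, ind (val T l A ∧ Q A ∧ v ∈ A ∧ mv l p v) = ind (val T l A ∧ Q A ∧ v ∈ A) * ind (mv l p v) := by
    intro p
    rw [← ind_and]
    exact ind_congr (by tauto)
  simp only [this]
  rw [← Finset.mul_sum, ← hl, mv_sum]
  by_cases h : val T l A ∧ Q A ∧ v ∈ A
  · rw [h.1.2.2 v h.2.2]; simp
  · rw [ind_neg h, zero_mul]

theorem eSw_self (τ : Sw X) : eSw τ.1 τ = τ := by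
  apply Subtype.ext
  ext x
  obtain ⟨y, rfl⟩ := τ.1.surjective x
  rw [eSw_apply]

theorem sw_sq (τ : Sw X) (x : X) : τ.1 (τ.1 x) = x := by
  obtain ⟨_, a, b, h, rfl⟩ := τ
  simp

theorem conn_perm {l l' : List (Sw X)} (h : ∀ τ, τ ∈ l ↔ τ ∈ l') : Conn l ↔ Conn l' := by
  simp [Conn, ConnOn, Inv, h]

theorem all_map (e : Perm X) (A : Finset X) (P : X → Prop) :
    (∀ s ∈ A.map e.toEmbedding, P s) ↔ ∀ s ∈ A, P (e s) := by
  rw [Finset.forall_mem_map]; rfl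

theorem Wp_succ (p m : ℕ) (hp : p < m) (T : Perm X) (v : X) (f : X → ι) (hf : ∀ x, f (T x) = f x)
    (j : ι → ℕ) :
    Wp (p+1) (m+1) T v (fun A => ty f A = j) = Wp p (m+1) T v (fun A => ty f A = j) := by
  unfold Wp
  conv_rhs => rw [S_snoc]
  conv_lhs => rw [S]
  refine Finset.sum_congr rfl fun τ _ => ?_
  rw [← S_map m (eSw τ.1) (fun l => ∑ A : Finset X, ind (val T (l ++ [τ]) A ∧ ty f A = j ∧ v ∈ A ∧ mv (l ++ [τ]) p v))]
  apply S_congr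
  intro l hl
  conv_rhs => rw [← (Equiv.finsetCongr τ.1).sum_comp]
  refine Finset.sum_congr rfl fun A _ => ind_congr ?_
  beta_reduce
  rw [Equiv.finsetCongr_apply]
  have hpr : pr (l.map (eSw τ.1) ++ [τ]) = pr (τ :: l) := by
    ext x
    have := pr_eSw τ.1 l x
    simp only [pr, List.map_append, List.prod_append, List.map_cons, List.map_nil, List.prod_cons,
      List.prod_nil, mul_one, Perm.mul_apply] at *
    exact this
  have hconn : Conn (l.map (eSw τ.1) ++ [τ]) ↔ Conn (τ :: l) := by
    rw [← conn_eSw τ.1 (τ :: l)]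
    apply conn_perm
    intro τ'
    rw [List.map_cons, eSw_self]
    simp only [List.mem_append, List.mem_cons, List.not_mem_nil, or_false]
    tauto
  have hdeg : ∀ s, deg (l.map (eSw τ.1) ++ [τ]) (τ.1 s) = deg (τ :: l) s := by
    intro s
    rw [deg_append, deg_eSw, deg_cons, deg_cons, deg_nil, sw_sq, zero_add]
    congr 2
    simp [eq_comm]
  have hval : val T (l.map (eSw τ.1) ++ [τ]) (A.map τ.1.toEmbedding) ↔ val T (τ :: l) A := by
    unfold val
    rw [hpr, hconn, all_map]
    simp only [hdeg]
  rw [hval]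
  apply and_congr_right
  intro hv
  have hty : ty f (A.map τ.1.toEmbedding) = ty f A := by
    apply ty_map
    intro s hs
    by_cases h : τ.1 s = s
    · rw [h]
    · have h1 := hv.2.2 s hs
      rw [deg_cons, if_pos h] at h1
      have h2 := pr_of_deg_zero (l := l) (x := s) (by omega)
      have h3 : pr (τ :: l) s = T s := by rw [hv.1]
      have h4 : pr (τ :: l) s = τ.1 (pr l s) := by simp [pr]
      rw [← hf s, ← h3, h4, h2]
  rw [hty]
  apply and_congr_right
  intro _
  have hp1 : ∀ u, mv (l.map (eSw τ.1) ++ [τ]) p (τ.1 u) ↔ mv (τ :: l) (p+1) u := by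
    intro u
    unfold mv
    rw [List.getElem?_append_left (by simp; omega), List.getElem?_map, List.getElem?_cons_succ]
    cases l[p]? with
    | none => simp
    | some σ =>
      simp only [Option.map_some, Option.some.injEq, exists_eq_left', eSw_apply]
      simp
  have mvdeg : ∀ (l : List (Sw X)) q u, mv l q u → 1 ≤ deg l u := by
    rintro l q u ⟨σ, h1, h2⟩
    by_contra h
    exact h2 (deg_zero (l := l) (by omega) σ (List.mem_of_getElem? h1))
  have key : ∀ u ∈ A, mv (τ :: l) (p+1) u → τ.1 u = u := by
    intro u hu hm
    have h1 := hv.2.2 u hu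
    rw [deg_cons] at h1
    have h2 : mv l p u := by simpa [mv] using hm
    have := mvdeg _ _ _ h2
    by_contra h3
    rw [if_pos h3] at h1
    omega
  constructor
  · rintro ⟨h1, h2⟩
    have := key v h1 h2
    refine ⟨mem_map.2 ⟨v, h1, this⟩, ?_⟩
    have h3 := (hp1 v).2 h2
    rwa [this] at h3
  · rintro ⟨h1, h2⟩
    obtain ⟨u, hu, rfl⟩ := mem_map.1 h1
    have h3 := (hp1 u).1 h2
    have h4 := key u hu h3
    simp only [toEmbedding_apply, h4]
    exact ⟨hu, h3⟩

theorem W_rot (m : ℕ) (T : Perm X) (v : X) (f : X → ι) (hf : ∀ x, f (T x) = f x) (j : ι → ℕ) :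
    W (m+1) T (fun A => ty f A = j ∧ v ∈ A) = (m+1) * Wp 0 (m+1) T v (fun A => ty f A = j) := by
  rw [W_Wp]
  have : ∀ p, p < m + 1 → Wp p (m+1) T v (fun A => ty f A = j) = Wp 0 (m+1) T v (fun A => ty f A = j) := by
    intro p
    induction p with
    | zero => intro _; rfl
    | succ p ih => intro h; rw [Wp_succ p m (by omega) T v f hf, ih (by omega)]
  rw [Finset.sum_congr rfl fun p hp => this p (mem_range.1 hp)]
  simp

theorem W_conj (m : ℕ) (T : Perm X) (v : X) (f : X → ι) (hf : ∀ x, f (T x) = f x) (j : ι → ℕ) :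
    W m T (fun A => ty f A = j ∧ v ∈ A) = W m T (fun A => ty f A = j ∧ T v ∈ A) := by
  symm
  unfold W
  rw [← S_map m (eSw T)]
  apply S_congr
  intro l hl
  rw [← (Equiv.finsetCongr T).sum_comp]
  refine Finset.sum_congr rfl fun A _ => ind_congr ?_
  beta_reduce
  rw [Equiv.finsetCongr_apply, ty_map f T A (fun s _ => hf s)]
  unfold val
  rw [conn_eSw]
  have : pr (l.map (eSw T)) = T ↔ pr l = T := by
    constructor
    · intro h
      ext x
      have := pr_eSw T l x
      rw [h] at this
      exact (T.injective this).symm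
    · intro h
      ext x
      obtain ⟨y, rfl⟩ := T.surjective x
      rw [pr_eSw, h]
  rw [this, all_map]
  simp only [deg_eSw]
  simp

theorem W_same (m : ℕ) (T : Perm X) (v w : X) (f : X → ι) (hf : ∀ x, f (T x) = f x) (j : ι → ℕ)
    (h : T.SameCycle v w) :
    W m T (fun A => ty f A = j ∧ v ∈ A) = W m T (fun A => ty f A = j ∧ w ∈ A) := by
  obtain ⟨k, rfl⟩ := h.exists_nat_pow_eq
  clear h
  induction k with
  | zero => rfl
  | succ k ih => rw [ih, W_conj m T _ f hf, pow_succ', Perm.mul_apply]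

/-- f labels the cycles of T -/
def Lab (f : X → ι) (T : Perm X) : Prop := ∀ x y, f x = f y ↔ T.SameCycle x y

theorem Lab.inv {f : X → ι} {T : Perm X} (h : Lab f T) (x : X) : f (T x) = f x :=
  (h _ _).2 (by simp [Perm.SameCycle.rfl])

def fib (f : X → ι) (i : ι) : ℕ := (univ.filter (fun x => f x = i)).card

theorem W_avg (m : ℕ) (T : Perm X) (v : X) (f : X → ι) (hf : Lab f T) (j : ι → ℕ) :
    fib f (f v) * W m T (fun A => ty f A = j ∧ v ∈ A) = j (f v) * W m T (fun A => ty f A = j) := by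
  have h1 : ∑ w ∈ univ.filter (fun x => f x = f v), W m T (fun A => ty f A = j ∧ w ∈ A) =
      fib f (f v) * W m T (fun A => ty f A = j ∧ v ∈ A) := by
    rw [Finset.sum_congr rfl (g := fun _ => W m T (fun A => ty f A = j ∧ v ∈ A))]
    · simp [fib]
    · intro w hw
      simp only [mem_filter, mem_univ, true_and] at hw
      exact W_same m T w v f hf.inv j ((hf _ _).1 hw)
  rw [← h1]
  unfold W
  rw [← S_sum, ← S_mul]
  apply S_congr
  intro l _
  rw [Finset.sum_comm, Finset.mul_sum]
  refine Finset.sum_congr rfl fun A _ => ?_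
  have : ∀ w, ind (val T l A ∧ ty f A = j ∧ w ∈ A) = ind (val T l A ∧ ty f A = j) * ind (w ∈ A) := by
    intro w
    rw [← ind_and]
    exact ind_congr (by tauto)
  simp only [this]
  rw [← Finset.mul_sum]
  by_cases h : val T l A ∧ ty f A = j
  · rw [ind_pos h, one_mul, mul_one, ← h.2, ty]
    have hi : ∀ w, ind (w ∈ A) = if w ∈ A then 1 else 0 := by
      intro w; by_cases h : w ∈ A <;> simp [ind, h]
    simp only [hi]
    rw [← Finset.sum_filter, Finset.filter_filter]
    simp only [sum_const, nsmul_eq_mul, mul_one]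
    congr 2
    ext x; simp [and_comm]
  · rw [ind_neg h]; simp

end
end PH


namespace PH

open Finset Equiv
set_option linter.unusedSectionVars false

section
variable {X : Type} [Fintype X] [DecidableEq X]
variable {ι : Type} [Fintype ι] [DecidableEq ι]

theorem sw_of_apply {τ : Sw X} {v w : X} (h : τ.1 v = w) (hne : w ≠ v) : τ.1 = swap v w := by
  obtain ⟨_, a, b, hab, rfl⟩ := τ
  simp only at h ⊢
  by_cases h1 : v = a
  · subst h1; rw [swap_apply_left] at h; rw [h]
  · by_cases h2 : v = b
    · subst h2; rw [swap_apply_right] at h; rw [h, swap_comm]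
    · rw [swap_apply_of_ne_of_ne h1 h2] at h; exact absurd h.symm hne

theorem deg_pos {l : List (Sw X)} (hc : Conn l) (hl : l ≠ []) (x : X) : 1 ≤ deg l x := by
  by_contra h
  have h0 := deg_zero (l := l) (x := x) (by omega)
  have := hc.2 {x} (subset_univ _) (singleton_nonempty _) (by
    intro τ hτ y hy
    rw [mem_singleton] at hy ⊢
    rw [hy, h0 τ hτ])
  obtain ⟨τ, l', rfl⟩ := List.exists_cons_of_ne_nil hl
  obtain ⟨a, b, hab, -⟩ := τ.2
  have ha : a ∈ ({x} : Finset X) := this ▸ mem_univ a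
  have hb : b ∈ ({x} : Finset X) := this ▸ mem_univ b
  rw [mem_singleton] at ha hb
  exact hab (ha.trans hb.symm)

theorem head_leaf {T : Perm X} {τ : Sw X} {l : List (Sw X)} {A : Finset X} (hv : val T (τ :: l) A) {v : X}
    (h1 : v ∈ A) (h2 : mv (τ :: l) 0 v) : τ.1 v = T v ∧ T v ≠ v ∧ deg l v = 0 := by
  have h3 : τ.1 v ≠ v := by simpa [mv] using h2
  have h4 := hv.2.2 v h1
  rw [deg_cons, if_pos h3] at h4
  have h5 := pr_of_deg_zero (l := l) (x := v) (by omega)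
  have h6 : T v = τ.1 v := by
    rw [← hv.1]
    simp only [pr, List.map_cons, List.prod_cons, Perm.mul_apply] at *
    rw [h5]
  exact ⟨h6.symm, h6 ▸ h3, by omega⟩

theorem Wp_zero_fix (m : ℕ) (T : Perm X) (v : X) (Q : Finset X → Prop) (h : T v = v) :
    Wp 0 (m+1) T v Q = 0 := by
  unfold Wp
  rw [S]
  refine Finset.sum_eq_zero fun τ _ => S_eq_zero _ fun l _ => Finset.sum_eq_zero fun A _ => ind_neg ?_
  rintro ⟨h1, -, h2, h3⟩
  exact (head_leaf h1 h2 h3).2.1 h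

theorem del_hU (T : Perm X) (v : X) (z : X) : (swap v (T v) * T) z ≠ v ↔ z ≠ v := by
  rw [Perm.mul_apply, not_iff_not]
  constructor
  · intro h
    have h2 : swap v (T v) (T z) = swap v (T v) (T v) := by rw [h, swap_apply_right]
    exact T.injective ((swap v (T v)).injective h2)
  · rintro rfl; rw [swap_apply_right]

/-- delete v from T -/
def del (T : Perm X) (v : X) : Perm {x // x ≠ v} := (swap v (T v) * T).subtypePerm (del_hU T v)

theorem del_apply (T : Perm X) (v : X) (x : {x // x ≠ v}) :
    ((del T v x : {x // x ≠ v}) : X) = swap v (T v) (T x) := rfl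

theorem del_lab {f : X → ι} {T : Perm X} (hf : Lab f T) (v : X) :
    Lab (fun x : {x // x ≠ v} => f x) (del T v) := by
  have hinv : ∀ x, f (del T v x : {x // x ≠ v}) = f x := by
    intro x
    rw [del_apply]
    by_cases h : T x = v
    · rw [h, swap_apply_left, hf.inv]
      exact (congrArg f h).symm.trans (hf.inv _)
    · rw [swap_apply_of_ne_of_ne h (fun h' => x.2 (T.injective h')), hf.inv]
  have key : ∀ k : ℕ, ∀ x y : {x // x ≠ v}, (T ^ k) x.1 = y.1 → (del T v).SameCycle x y := by
    intro k
    induction k using Nat.strong_induction_on with | _ k ih => ?_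
    intro x y h
    rcases k with _ | k
    · have : x = y := Subtype.ext h
      rw [this]
    · rw [pow_succ, Perm.mul_apply] at h
      rw [← Perm.sameCycle_apply_left]
      by_cases hx : T x.1 = v
      · rcases k with _ | k
        · exact absurd (h.symm.trans hx) y.2
        · rw [pow_succ, Perm.mul_apply] at h
          apply ih k (by omega)
          rw [del_apply, hx, swap_apply_left]
          rwa [hx] at h
      · apply ih k (by omega)
        rw [del_apply, swap_apply_of_ne_of_ne hx (fun h' => x.2 (T.injective h'))]
        exact h
  intro x y
  constructor
  · intro h
    obtain ⟨k, hk⟩ := ((hf _ _).1 h).exists_nat_pow_eq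
    exact key k x y hk
  · intro h
    obtain ⟨k, rfl⟩ := h.exists_nat_pow_eq
    clear h
    induction k with
    | zero => rfl
    | succ k ih => rw [pow_succ', Perm.mul_apply]; exact ih.trans (hinv _).symm

theorem conn_del (v w : X) (hvw : v ≠ w) (l : List (Sw {x // x ≠ v})) :
    Conn (sw v w hvw :: l.map (emb (fun x => x ≠ v))) ↔ Conn l := by
  rw [← (rel_map l).conn_iff w hvw.symm]
  set L := l.map (emb (fun x => x ≠ v)) with hL
  have hfix : ∀ τ ∈ L, τ.1 v = v := by
    intro τ hτ
    obtain ⟨σ, _, rfl⟩ := List.mem_map.1 hτ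
    exact emb_apply_not _ σ v (by simp)
  constructor
  · intro h B hB hBn hBi
    have hvB : v ∉ B := fun h' => by simpa using hB h'
    by_cases hw : w ∈ B
    · have h1 := h.2 (insert v B) (subset_univ _) (insert_nonempty _ _) (by
        intro τ hτ x hx
        rcases List.mem_cons.1 hτ with rfl | hτ
        · change swap v w x ∈ _
          by_cases h1 : x = v
          · rw [h1, swap_apply_left]; exact mem_insert_of_mem hw
          · by_cases h2 : x = w
            · rw [h2, swap_apply_right]; exact mem_insert_self _ _
            · rw [swap_apply_of_ne_of_ne h1 h2]; exact hx
        · rcases mem_insert.1 hx with rfl | hx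
          · rw [hfix τ hτ]; exact mem_insert_self _ _
          · exact mem_insert_of_mem (hBi τ hτ x hx))
      apply Subset.antisymm hB
      intro x hx
      have h2 : x ∈ insert v B := h1 ▸ mem_univ x
      simp only [mem_filter, mem_univ, true_and] at hx
      exact (mem_insert.1 h2).resolve_left hx
    · have h1 := h.2 B (subset_univ _) hBn (by
        intro τ hτ x hx
        rcases List.mem_cons.1 hτ with rfl | hτ
        · change swap v w x ∈ _
          rw [swap_apply_of_ne_of_ne (fun h : x = v => hvB (h ▸ hx)) (fun h : x = w => hw (h ▸ hx))]; exact hx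
        · exact hBi τ hτ x hx)
      exact absurd (h1 ▸ mem_univ v) hvB
  · intro h
    refine ⟨⟨v⟩, fun B _ hBn hBi => ?_⟩
    have hs := hBi (sw v w hvw) (by simp)
    have hne : (B.filter (fun x => x ≠ v)).Nonempty := by
      obtain ⟨b, hb⟩ := hBn
      by_cases hbv : b = v
      · have := hs b hb
        rw [hbv] at this
        change swap v w v ∈ B at this
        rw [swap_apply_left] at this
        exact ⟨w, mem_filter.2 ⟨this, hvw.symm⟩⟩
      · exact ⟨b, mem_filter.2 ⟨hb, hbv⟩⟩
    have h1 := h (B.filter (fun x => x ≠ v)) (filter_subset_filter _ (subset_univ _)) hne (by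
      intro τ hτ x hx
      rw [mem_filter] at hx ⊢
      refine ⟨hBi τ (List.mem_cons_of_mem _ hτ) x hx.1, fun h => hx.2 ?_⟩
      rw [← hfix τ hτ] at h
      exact τ.1.injective h)
    have h2 : ∀ x, x ≠ v → x ∈ B := by
      intro x hx
      have : x ∈ univ.filter (fun x => x ≠ v) := by simp [hx]
      rw [← h1] at this
      exact (mem_filter.1 this).1
    ext x
    simp only [mem_univ, iff_true]
    by_cases hx : x = v
    · have := hs w (h2 w hvw.symm)
      change swap v w w ∈ B at this
      rw [swap_apply_right] at this
      rwa [hx]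
    · exact h2 x hx

theorem deg_emb (v : X) (l : List (Sw {x // x ≠ v})) (s : {x // x ≠ v}) :
    deg (l.map (emb (fun x => x ≠ v))) s.1 = deg l s := by
  induction l with
  | nil => rfl
  | cons τ l ih => rw [List.map_cons, deg_cons, deg_cons, ih, emb_apply]; simp only [ne_eq, Subtype.ext_iff]

theorem pr_del (T : Perm X) (v : X) (hv : v ≠ T v) (l : List (Sw {x // x ≠ v})) :
    pr (sw v (T v) hv :: l.map (emb (fun x => x ≠ v))) = T ↔ pr l = del T v := by
  have e : pr (sw v (T v) hv :: l.map (emb (fun x => x ≠ v))) = swap v (T v) * pr (l.map (emb (fun x => x ≠ v))) := by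
    simp [pr, sw]
  rw [e]
  have hL : pr (l.map (emb (fun x => x ≠ v))) v = v := by
    apply pr_of_deg_zero
    rw [deg, List.countP_eq_zero]
    intro τ hτ
    obtain ⟨σ, _, rfl⟩ := List.mem_map.1 hτ
    simpa using emb_apply_not _ σ v (by simp)
  constructor
  · intro h
    ext x
    rw [del_apply, ← (rel_map l).pr_apply]
    have := congrArg (fun P : Perm X => swap v (T v) (P x.1)) h
    simp only [Perm.mul_apply, swap_apply_self] at this
    exact this
  · intro h
    ext x
    rw [Perm.mul_apply]
    by_cases hx : x = v
    · rw [hx, hL, swap_apply_left]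
    · have := (rel_map l).pr_apply ⟨x, hx⟩
      simp only at this
      rw [this, h, del_apply, swap_apply_self]

theorem ty_ins (f : X → ι) (v : X) (A : Finset {x // x ≠ v}) (i : ι) :
    ty f (insert v (A.map (Function.Embedding.subtype _))) i =
      ty (fun x : {x // x ≠ v} => f x) A i + if f v = i then 1 else 0 := by
  unfold ty
  have hn : v ∉ A.map (Function.Embedding.subtype _) := by simp
  rw [filter_insert]
  have e : (filter (fun x => f x = i) (A.map (Function.Embedding.subtype _))).card =
      (filter (fun x : {x // x ≠ v} => f x = i) A).card := by
    rw [filter_map, card_map]; rfl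
  split_ifs with h
  · rw [card_insert_of_notMem (fun h' => hn (mem_filter.1 h').1), e]
  · rw [e, add_zero]

theorem Wp_del (m : ℕ) (T : Perm X) (v : X) (hv : v ≠ T v) (f : X → ι) (j : ι → ℕ)
    (hm : Fintype.card X ≤ m + 1) :
    Wp 0 (m+1) T v (fun A => ty f A = fun i => j i + if f v = i then 1 else 0) =
    W m (del T v) (fun A => ty (fun x : {x // x ≠ v} => f x) A = j ∧ ¬ (⟨T v, hv.symm⟩ : {x // x ≠ v}) ∈ A) := by
  have hcard : 2 ≤ Fintype.card X := by
    rw [← card_univ, ← card_pair hv]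
    exact card_le_card (subset_univ _)
  unfold Wp
  rw [S, Finset.sum_eq_single (sw v (T v) hv)]
  rotate_left
  · intro τ _ hτ
    refine S_eq_zero _ fun l _ => Finset.sum_eq_zero fun A _ => ind_neg ?_
    rintro ⟨h1, -, h2, h3⟩
    have := head_leaf h1 h2 h3
    exact hτ (Subtype.ext (sw_of_apply this.1 this.2.1))
  · intro h; exact absurd (mem_univ _) h
  rw [S_emb m (emb (fun x => x ≠ v)) (emb_inj _)]
  rotate_left
  · intro l b hb hb'
    refine Finset.sum_eq_zero fun A _ => ind_neg ?_
    rintro ⟨h1, -, h2, h3⟩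
    apply hb'
    apply sw_emb_of_fix
    intro x hx
    rw [not_ne_iff] at hx
    rw [hx]
    exact deg_zero (head_leaf h1 h2 h3).2.2 b hb
  unfold W
  apply S_congr
  intro l hl
  rw [← Finset.sum_filter_of_ne (p := fun A => v ∈ A)]
  rotate_left
  · intro A _ h
    by_contra hA
    exact h (ind_neg fun h' => hA h'.2.2.1)
  refine Finset.sum_nbij' (fun A => A.subtype (fun x => x ≠ v))
    (fun A => insert v (A.map (Function.Embedding.subtype _))) ?_ ?_ ?_ ?_ ?_
  · intro A _; exact mem_univ _
  · intro A _; simp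
  · intro A hA
    simp only [mem_filter, mem_univ, true_and] at hA
    ext x
    by_cases hx : x = v
    · simp [hx, hA]
    · simp [hx]
  · intro A _
    ext x
    simp [x.2]
  · intro A0 hA0
    simp only [mem_filter, mem_univ, true_and] at hA0
    obtain ⟨A, rfl⟩ : ∃ A : Finset {x // x ≠ v}, A0 = insert v (A.map (Function.Embedding.subtype _)) := by
      refine ⟨A0.subtype (fun x => x ≠ v), ?_⟩
      ext x
      by_cases hx : x = v
      · simp [hx, hA0]
      · simp [hx]
    have eA : (insert v (A.map (Function.Embedding.subtype _))).subtype (fun x => x ≠ v) = A := by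
      ext x
      simp [x.2]
    rw [eA]
    apply ind_congr
    have hmv : mv (sw v (T v) hv :: l.map (emb (fun x => x ≠ v))) 0 v := by
      refine ⟨_, rfl, ?_⟩
      change swap v (T v) v ≠ v
      rw [swap_apply_left]; exact hv.symm
    have hty : (ty f (insert v (A.map (Function.Embedding.subtype _))) = fun i => j i + if f v = i then 1 else 0) ↔
        ty (fun x : {x // x ≠ v} => f x) A = j := by
      rw [funext_iff, funext_iff]
      refine forall_congr' fun i => ?_
      rw [ty_ins]
      omega
    beta_reduce
    rw [hty]
    have hd0 : deg (l.map (emb (fun x => x ≠ v))) v = 0 := by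
      rw [deg, List.countP_eq_zero]
      intro τ hτ
      obtain ⟨σ, _, rfl⟩ := List.mem_map.1 hτ
      simpa using emb_apply_not _ σ v (by simp)
    have hdv : deg (sw v (T v) hv :: l.map (emb (fun x => x ≠ v))) v = 1 := by
      rw [deg_cons, hd0, if_pos]
      change swap v (T v) v ≠ v
      rw [swap_apply_left]; exact hv.symm
    have hds : ∀ s : {x // x ≠ v}, deg (sw v (T v) hv :: l.map (emb (fun x => x ≠ v))) s.1 =
        deg l s + if s = ⟨T v, hv.symm⟩ then 1 else 0 := by
      intro s
      rw [deg_cons, deg_emb]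
      congr 1
      by_cases hs : s = ⟨T v, hv.symm⟩
      · rw [if_pos hs, if_pos]
        change swap v (T v) s.1 ≠ s.1
        rw [hs]; simp [hv]
      · rw [if_neg hs, if_neg]
        rw [not_ne_iff]
        change swap v (T v) s.1 = s.1
        exact swap_apply_of_ne_of_ne s.2 (fun h => hs (Subtype.ext h))
    unfold val
    rw [pr_del, conn_del]
    simp only [forall_mem_insert, forall_mem_map, Function.Embedding.subtype_apply, hdv, hds, true_and]
    constructor
    · rintro ⟨⟨h1, h2, h3⟩, h4, -⟩
      have hw : (⟨T v, hv.symm⟩ : {x // x ≠ v}) ∉ A := by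
        intro hw
        have := h3 _ hw
        rw [if_pos rfl] at this
        have h5 := deg_pos h2 (by rintro rfl; simp at hl; omega) ⟨T v, hv.symm⟩
        omega
      refine ⟨⟨h1, h2, fun s hs => ?_⟩, h4, hw⟩
      have := h3 s hs
      rwa [if_neg (fun h : s = ⟨T v, hv.symm⟩ => hw (h ▸ hs)), add_zero] at this
    · rintro ⟨⟨h1, h2, h3⟩, h4, hw⟩
      refine ⟨⟨h1, h2, fun s hs => ?_⟩, h4, mem_insert_self _ _, hmv⟩
      rw [if_neg (fun h : s = ⟨T v, hv.symm⟩ => hw (h ▸ hs)), add_zero, h3 s hs]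

end
end PH


namespace PH

open Finset Equiv
set_option linter.unusedSectionVars false

section
variable {ι : Type} [Fintype ι] [DecidableEq ι]

theorem Ty_lab {X : Type} [Fintype X] [DecidableEq X] {f : X → ι} {T : Perm X} (hf : Lab f T)
    (hs : Function.Surjective f) : Ty T = univ.val.map (fib f) := by
  have ho : ∀ x, orb T x = univ.filter (fun y => f y = f x) := by
    intro x
    ext y
    rw [mem_orb, ← hf]
    simp [eq_comm]
  have hO : Orbs T = univ.image (fun i => univ.filter (fun y => f y = i)) := by
    ext O
    rw [mem_Orbs]
    simp only [mem_image, mem_univ, true_and, ho]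
    constructor
    · rintro ⟨x, rfl⟩; exact ⟨f x, rfl⟩
    · rintro ⟨i, rfl⟩
      obtain ⟨x, rfl⟩ := hs i
      exact ⟨x, rfl⟩
  have : Ty T = (Orbs T).val.map Finset.card := rfl
  rw [this, hO, Finset.image_val_of_injOn, Multiset.map_map]
  · rfl
  · intro i _ i' _ h
    obtain ⟨x, rfl⟩ := hs i
    have : x ∈ univ.filter (fun y => f y = f x) := by simp
    simp only at h
    rw [h] at this
    simpa using this

theorem fib_sum {X : Type} [Fintype X] [DecidableEq X] (f : X → ι) : ∑ i, fib f i = Fintype.card X := by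
  unfold fib
  rw [← card_univ, Finset.card_eq_sum_card_fiberwise (f := f) (t := univ) (by intro x _; simp)]

theorem fib_del {X : Type} [Fintype X] [DecidableEq X] (f : X → ι) (v : X) (i : ι) :
    fib f i = fib (fun x : {x // x ≠ v} => f x) i + if f v = i then 1 else 0 := by
  have := ty_ins f v univ i
  unfold ty at this
  unfold fib
  rw [← this]
  congr 2
  ext x
  by_cases h : x = v <;> simp [h]

theorem W_rec {X : Type} [Fintype X] [DecidableEq X] (m : ℕ) (T : Perm X) (v : X) (hv : v ≠ T v)
    (f : X → ι) (hf : Lab f T) (j : ι → ℕ) (hm : Fintype.card X ≤ m + 1) :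
    ((fib f (f v) : ℚ) - 1) * ((j (f v) + 1) * W (m+1) T (fun A => ty f A = fun i => j i + if f v = i then 1 else 0)) =
    fib f (f v) * ((m+1) * ((fib f (f v) - 1 - j (f v)) * W m (del T v) (fun A => ty (fun x : {x // x ≠ v} => f x) A = j))) := by
  have h1 := W_avg (m+1) T v f hf (fun i => j i + if f v = i then 1 else 0)
  rw [W_rot m T v f hf.inv, Wp_del m T v hv f j hm] at h1
  have h2 := W_avg m (del T v) ⟨T v, hv.symm⟩ _ (del_lab hf v) j
  have h3 : W m (del T v) (fun A => ty (fun x : {x // x ≠ v} => f x) A = j) =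
    W m (del T v) (fun A => ty (fun x : {x // x ≠ v} => f x) A = j ∧ (⟨T v, hv.symm⟩ : {x // x ≠ v}) ∈ A) +
    W m (del T v) (fun A => ty (fun x : {x // x ≠ v} => f x) A = j ∧ ¬ (⟨T v, hv.symm⟩ : {x // x ≠ v}) ∈ A) := by
    unfold W
    rw [← S_add]
    apply S_congr
    intro l _
    rw [← Finset.sum_add_distrib]
    refine Finset.sum_congr rfl fun A _ => ?_
    by_cases h : (⟨T v, hv.symm⟩ : {x // x ≠ v}) ∈ A
    · rw [ind_neg (fun h' : val (del T v) l A ∧ (ty (fun x : {x // x ≠ v} => f x) A = j ∧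
        ¬ (⟨T v, hv.symm⟩ : {x // x ≠ v}) ∈ A) => h'.2.2 h), add_zero]
      exact ind_congr (by tauto)
    · rw [ind_neg (fun h' : val (del T v) l A ∧ (ty (fun x : {x // x ≠ v} => f x) A = j ∧
        (⟨T v, hv.symm⟩ : {x // x ≠ v}) ∈ A) => h h'.2.2), zero_add]
      exact ind_congr (by tauto)
  simp only [hf.inv] at h2
  have h4 : (fib f (f v) : ℚ) = fib (fun x : {x // x ≠ v} => f x) (f v) + 1 := by
    rw [fib_del f v (f v), if_pos rfl]; push_cast; rfl
  rw [if_pos rfl] at h1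
  push_cast at h1
  rw [← h1, h4]
  rw [h4] at h1
  set F : ℚ := (fib (fun x : {x // x ≠ v} => f x) (f v) : ℚ)
  set a := W m (del T v) (fun A => ty (fun x : {x // x ≠ v} => f x) A = j)
  set b := W m (del T v) (fun A => ty (fun x : {x // x ≠ v} => f x) A = j ∧ (⟨T v, hv.symm⟩ : {x // x ≠ v}) ∈ A)
  set c := W m (del T v) (fun A => ty (fun x : {x // x ≠ v} => f x) A = j ∧ ¬ (⟨T v, hv.symm⟩ : {x // x ≠ v}) ∈ A)
  have : c = a - b := by rw [h3]; ring
  rw [this]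
  linear_combination (-(F+1) * (m+1)) * h2

theorem W_formula (k : ℕ) : ∀ (X : Type) [Fintype X] [DecidableEq X] (T : Perm X) (f : X → ι)
    (_ : Lab f T) (_ : Function.Surjective f) (j : ι → ℕ) (_ : ∑ i, j i = k) (m g : ℕ)
    (_ : m + 2 = 2 * g + Fintype.card X + Fintype.card ι) (_ : 2 ≤ 2 * g + Fintype.card ι),
    W m T (fun A => ty f A = j) = m.factorial * (∏ i, (fib f i : ℚ)) *
      (∏ i, ((fib f i - j i : ℕ) : ℚ) ^ (j i) / (j i).factorial) * hh g (univ.val.map fun i => fib f i - j i) := by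
  induction k with
  | zero =>
    intro X _ _ T f hf hs j hj m g hm hg
    have hj0 : j = 0 := by
      ext i
      exact (Finset.sum_eq_zero_iff.1 hj) i (mem_univ i)
    subst hj0
    have h1 : W m T (fun A => ty f A = 0) = C m T := by
      unfold W C
      apply S_congr
      intro l _
      rw [Finset.sum_eq_single ∅]
      · apply ind_congr
        have : ty f ∅ = 0 := by ext; simp [ty]
        simp [val, this]
      · intro A _ hA
        apply ind_neg
        rintro ⟨-, h⟩
        obtain ⟨a, ha⟩ := nonempty_iff_ne_empty.2 hA
        have := congrFun h (f a)
        simp only [ty, Pi.zero_apply, card_eq_zero, filter_eq_empty_iff] at this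
        exact this ha rfl
      · intro h; exact absurd (mem_univ _) h
    rw [h1, C_eq, Ty_lab hf hs]
    have hsum : (univ.val.map (fib f)).sum = Fintype.card X := by
      rw [← fib_sum f]; rfl
    rw [Hn_eq_hh (g := g) (by rw [hsum]; simpa using hm)]
    simp [prM]
  | succ k ih =>
    intro X _ _ T f hf hs j hj m g hm hg
    obtain ⟨i, hi⟩ : ∃ i, j i ≠ 0 := by
      by_contra h
      push Not at h
      rw [Finset.sum_eq_zero (fun i _ => h i)] at hj
      omega
    obtain ⟨v, rfl⟩ := hs i
    obtain ⟨m, rfl⟩ : ∃ m', m = m' + 1 := ⟨m - 1, by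
      have : 0 < Fintype.card X := Fintype.card_pos_iff.2 ⟨v⟩
      omega⟩
    have hfv : 1 ≤ fib f (f v) := card_pos.2 ⟨v, by simp⟩
    by_cases hv : v = T v
    · have h1 : fib f (f v) = 1 := by
        rw [fib, card_eq_one]
        refine ⟨v, ?_⟩
        ext y
        simp only [mem_filter, mem_univ, true_and, mem_singleton]
        rw [eq_comm, hf]
        constructor
        · intro h
          obtain ⟨n, rfl⟩ := h.exists_nat_pow_eq
          clear h
          induction n with
          | zero => rfl
          | succ n ih => rw [pow_succ', Perm.mul_apply, ih, ← hv]
        · rintro rfl; rfl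
      have h2 := W_avg (m+1) T v f hf j
      rw [W_rot m T v f hf.inv, Wp_zero_fix _ _ _ _ hv.symm] at h2
      simp only [mul_zero, zero_eq_mul, Nat.cast_eq_zero] at h2
      rw [h2.resolve_left hi, Finset.prod_eq_zero (mem_univ (f v)) (f := fun i => ((fib f i - j i : ℕ) : ℚ) ^ (j i) / (j i).factorial)]
      · ring
      · rw [h1, show 1 - j (f v) = 0 by omega, Nat.cast_zero, zero_pow hi, zero_div]
    · set j' : ι → ℕ := fun i => j i - if f v = i then 1 else 0 with hj'
      have ej : j = fun i => j' i + if f v = i then 1 else 0 := by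
        ext i
        simp only [hj']
        split_ifs with h
        · subst h; omega
        · omega
      have hcard : Fintype.card {x // x ≠ v} + 1 = Fintype.card X := by
        have := Fintype.card_subtype_compl (fun x => x = v)
        simp only [Fintype.card_subtype_eq] at this
        have h0 : 0 < Fintype.card X := Fintype.card_pos_iff.2 ⟨v⟩
        rw [show Fintype.card {x // x ≠ v} = Fintype.card X - 1 from this]
        omega
      have hjs : ∑ i, j' i = k := by
        rw [ej, Finset.sum_add_distrib, Finset.sum_ite_eq] at hj
        simpa using hj
      have hs' : Function.Surjective (fun x : {x // x ≠ v} => f x) := by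
        intro i
        obtain ⟨x, rfl⟩ := hs i
        by_cases hx : x = v
        · exact ⟨⟨T v, fun h => hv h.symm⟩, by simp [hx, hf.inv]⟩
        · exact ⟨⟨x, hx⟩, rfl⟩
      have key := W_rec m T v hv f hf j' (by omega)
      rw [← ej, ih _ (del T v) _ (del_lab hf v) hs' j' hjs m g (by omega) hg] at key
      have hsub : ∀ i, fib (fun x : {x // x ≠ v} => f x) i - j' i = fib f i - j i := by
        intro i
        have h1 := fib_del f v i
        have h2 := congrFun ej i
        beta_reduce at h2
        omega
      simp only [hsub] at key
      have h2 : 2 ≤ fib f (f v) := by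
        rw [fib_del f v (f v), if_pos rfl]
        have : 1 ≤ fib (fun x : {x // x ≠ v} => f x) (f v) := by
          obtain ⟨x, hx⟩ := hs' (f v)
          exact card_pos.2 ⟨x, by simpa using hx⟩
        omega
      have h2' : (fib f (f v) : ℚ) - 1 ≠ 0 := by
        have : (2:ℚ) ≤ fib f (f v) := by exact_mod_cast h2
        linarith
      have hjv : ((j' (f v) : ℚ) + 1) = j (f v) := by
        have := congrFun ej (f v)
        simp only [if_true] at this
        rw [this]; push_cast; rfl
      have hjv' : (j (f v) : ℚ) ≠ 0 := by exact_mod_cast hi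
      rw [hjv] at key
      apply mul_left_cancel₀ h2'
      apply mul_left_cancel₀ hjv'
      rw [mul_left_comm, key]
      rw [← Finset.mul_prod_erase univ _ (mem_univ (f v)), ← Finset.mul_prod_erase univ _ (mem_univ (f v)),
        ← Finset.mul_prod_erase univ (fun i => (fib f i : ℚ)) (mem_univ (f v)),
        ← Finset.mul_prod_erase univ (fun i => ((fib f i - j i : ℕ) : ℚ) ^ (j i) / (j i).factorial) (mem_univ (f v))]
      have e1 : ∏ i ∈ univ.erase (f v), (fib (fun x : {x // x ≠ v} => f x) i : ℚ) = ∏ i ∈ univ.erase (f v), (fib f i : ℚ) := by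
        refine Finset.prod_congr rfl fun i hi => ?_
        rw [fib_del f v i, if_neg (fun h => (mem_erase.1 hi).1 h.symm)]; simp
      have e2 : ∏ i ∈ univ.erase (f v), (((fib f i - j i : ℕ) : ℚ) ^ (j' i) / (j' i).factorial) =
          ∏ i ∈ univ.erase (f v), (((fib f i - j i : ℕ) : ℚ) ^ (j i) / (j i).factorial) := by
        refine Finset.prod_congr rfl fun i hi => ?_
        have : j' i = j i := by simp only [hj']; rw [if_neg (fun h => (mem_erase.1 hi).1 h.symm)]; simp
        rw [this]
      rw [e1, e2]
      have e3 : (fib (fun x : {x // x ≠ v} => f x) (f v) : ℚ) = fib f (f v) - 1 := by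
        rw [fib_del f v (f v), if_pos rfl]; push_cast; ring
      obtain ⟨a, ha⟩ : ∃ a, j (f v) = a + 1 := ⟨j (f v) - 1, by omega⟩
      have ha' : j' (f v) = a := by simp only [hj']; rw [ha]; simp
      rw [e3, ha', ha, Nat.factorial_succ, Nat.factorial_succ]
      have hfa : (a.factorial : ℚ) ≠ 0 := by exact_mod_cast Nat.factorial_ne_zero a
      have ha1 : (a : ℚ) + 1 ≠ 0 := by positivity
      by_cases hle : a + 1 ≤ fib f (f v)
      · rw [Nat.cast_sub hle]
        push_cast
        field_simp
        ring
      · rcases Nat.lt_or_ge (fib f (f v)) (a+1) with hlt | hlt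
        · have hz : fib f (f v) - (a+1) = 0 := by omega
          rw [hz]
          rcases Nat.eq_zero_or_pos a with h0 | h0
          · omega
          · simp [h0.ne']
        · omega

end
end PH


namespace PH

open Finset Equiv
set_option linter.unusedSectionVars false

/-- coefficient of z^n in (z e^{-z})^c -/
noncomputable def ell (n c : ℕ) : ℚ := if c ≤ n then (-(c:ℚ))^(n-c) / (n-c).factorial else 0

noncomputable def tr (n : ℕ) (F : Multiset ℕ → ℚ) (A : Multiset ℕ) : ℚ :=
  ∑ c ∈ range (n+1), ell n c * F (c ::ₘ A)

theorem tr_comm (n m : ℕ) (F : Multiset ℕ → ℚ) : tr n (tr m F) = tr m (tr n F) := by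
  ext A
  simp only [tr, Finset.mul_sum]
  rw [Finset.sum_comm]
  refine Finset.sum_congr rfl fun c _ => Finset.sum_congr rfl fun d _ => ?_
  rw [Multiset.cons_swap]; ring

instance tr_lc : LeftCommutative tr := ⟨tr_comm⟩

noncomputable def TR (M : Multiset ℕ) (F : Multiset ℕ → ℚ) : Multiset ℕ → ℚ := M.foldr tr F

theorem TR_zero (F : Multiset ℕ → ℚ) : TR 0 F = F := rfl
theorem TR_cons (n : ℕ) (M : Multiset ℕ) (F : Multiset ℕ → ℚ) : TR (n ::ₘ M) F = tr n (TR M F) :=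
  Multiset.foldr_cons _ _ _ _

noncomputable def wj (n j : ℕ) : ℚ := (-1)^j * (((n - j : ℕ) : ℚ) ^ j / j.factorial)

theorem tr_wj (n D : ℕ) (hD : n < D) (F : Multiset ℕ → ℚ) (A : Multiset ℕ) :
    tr n F A = ∑ j : Fin D, wj n j * F ((n - j : ℕ) ::ₘ A) := by
  rw [Fin.sum_univ_eq_sum_range (fun j => wj n j * F ((n - j : ℕ) ::ₘ A)) D]
  rw [← Finset.sum_subset (Finset.range_subset_range.2 (show n + 1 ≤ D from hD))]
  · rw [tr, ← Finset.sum_range_reflect]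
    refine Finset.sum_congr rfl fun j hj => ?_
    have hj := mem_range.1 hj
    rw [show n + 1 - 1 - j = n - j by omega, ell, if_pos (by omega), wj, show n - (n - j) = j by omega,
      neg_pow]
    ring
  · intro j _ hj
    have hj : ¬ j < n + 1 := fun h => hj (mem_range.2 h)
    rw [wj, show n - j = 0 by omega, Nat.cast_zero, zero_pow (by omega)]
    simp

theorem TR_pi (n : ℕ) (D : ℕ) : ∀ (μ : Fin n → ℕ) (_ : ∀ i, μ i < D) (F : Multiset ℕ → ℚ) (A : Multiset ℕ),
    TR (univ.val.map μ) F A = ∑ j : Fin n → Fin D, (∏ i, wj (μ i) (j i)) * F ((univ.val.map fun i => μ i - j i) + A) := by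
  induction n with
  | zero => intro μ _ F A; simp [TR]
  | succ n ih =>
    intro μ hμ F A
    rw [← (Fin.consEquiv (fun _ => Fin D)).sum_comp, Fintype.sum_prod_type]
    have h1 : ∀ {n : ℕ} (ν : Fin (n+1) → ℕ), (univ.val.map ν : Multiset ℕ) = ν 0 ::ₘ univ.val.map (fun i : Fin n => ν i.succ) := by
      intro n ν
      rw [Fin.univ_val_map, Fin.univ_val_map, List.ofFn_succ, Multiset.cons_coe]
    rw [h1, TR_cons, tr_wj (μ 0) D (hμ 0)]
    refine Finset.sum_congr rfl fun j0 _ => ?_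
    rw [ih _ (fun i => hμ i.succ), Finset.mul_sum]
    refine Finset.sum_congr rfl fun j _ => ?_
    rw [h1, Fin.prod_univ_succ]
    simp only [Fin.consEquiv_apply, Fin.cons_zero, Fin.cons_succ]
    rw [Multiset.add_cons, Multiset.cons_add]
    ring

section
variable {X : Type} [Fintype X] [DecidableEq X]

noncomputable def Kraw (m : ℕ) (T : Perm X) : ℚ := S m (fun l => ind (pr l = T ∧ Conn l ∧ ∀ x, 2 ≤ deg l x))

theorem prune_ie (T : Perm X) (l : List (Sw X)) (hl : l ≠ []) :
    ind (pr l = T ∧ Conn l ∧ ∀ x, 2 ≤ deg l x) = ∑ A : Finset X, (-1)^(A.card) * ind (val T l A) := by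
  classical
  by_cases h : pr l = T ∧ Conn l
  · have h1 : ∀ A : Finset X, (-1:ℚ)^(A.card) * ind (val T l A) =
        if A ∈ (univ.filter (fun x => deg l x = 1)).powerset then (-1:ℚ)^A.card else 0 := by
      intro A
      have : val T l A ↔ A ∈ (univ.filter (fun x => deg l x = 1)).powerset := by
        simp only [val, h.1, h.2, true_and, mem_powerset, subset_iff, mem_filter, mem_univ]
      rw [ind_congr this, ind]
      split_ifs <;> simp
    simp only [h1]
    rw [Finset.sum_ite_mem, univ_inter]
    have h2 := Finset.sum_powerset_neg_one_pow_card (x := univ.filter (fun x => deg l x = 1))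
    have h3 : ∑ A ∈ (univ.filter (fun x => deg l x = 1)).powerset, (-1:ℚ)^A.card =
      ((∑ A ∈ (univ.filter (fun x => deg l x = 1)).powerset, (-1:ℤ)^A.card : ℤ) : ℚ) := by push_cast; rfl
    rw [h3, h2]
    have h4 : (univ.filter (fun x => deg l x = 1)) = ∅ ↔ ∀ x, 2 ≤ deg l x := by
      rw [filter_eq_empty_iff]
      constructor
      · intro h' x
        have := deg_pos h.2 hl x
        have := h' (mem_univ x)
        omega
      · intro h' x _
        have := h' x
        omega
    by_cases h5 : ∀ x, 2 ≤ deg l x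
    · rw [if_pos (h4.2 h5), ind_pos ⟨h.1, h.2, h5⟩]; simp
    · rw [if_neg (fun h' => h5 (h4.1 h')), ind_neg (fun h' => h5 h'.2.2)]; simp
  · rw [ind_neg (fun h' => h ⟨h'.1, h'.2.1⟩), Finset.sum_eq_zero]
    intro A _
    rw [ind_neg (fun h' : val T l A => h ⟨h'.1, h'.2.1⟩), mul_zero]

theorem Kraw_lab {n : ℕ} (T : Perm X) (f : X → Fin n) (hf : Lab f T) (hs : Function.Surjective f)
    (m g : ℕ) (hm : m + 2 = 2 * g + Fintype.card X + n) (hg : 2 ≤ 2 * g + n) (hm0 : m ≠ 0) :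
    Kraw m T = m.factorial * prM (univ.val.map (fib f)) * TR (univ.val.map (fib f)) (hh g) 0 := by
  classical
  set D := Fintype.card X + 1 with hD
  have h1 : Kraw m T = ∑ j : Fin n → Fin D, (-1)^(∑ i, (j i : ℕ)) * W m T (fun A => ty f A = fun i => (j i : ℕ)) := by
    unfold Kraw W
    simp only [← S_mul]
    rw [← S_sum]
    apply S_congr
    intro l hl
    rw [prune_ie T l (by rintro rfl; simp at hl; omega)]
    simp only [Finset.mul_sum]
    rw [Finset.sum_comm]
    refine Finset.sum_congr rfl fun A _ => ?_
    have hlt : ∀ i, ty f A i < D := fun i => Nat.lt_succ_of_le ((card_le_card (filter_subset _ _)).trans (card_le_univ A))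
    rw [Finset.sum_eq_single (fun i => ⟨ty f A i, hlt i⟩)]
    · congr 1
      · congr 1
        simp only [ty]
        rw [Finset.card_eq_sum_card_fiberwise (f := f) (t := univ) (by intro x _; simp)]
      · apply ind_congr; simp
    · intro j _ hj
      rw [ind_neg, mul_zero]
      rintro ⟨-, h⟩
      apply hj
      ext i
      simp [h]
    · intro h; exact absurd (mem_univ _) h
  rw [h1, TR_pi n D (fib f) (fun i => Nat.lt_succ_of_le (card_le_univ _)), Finset.mul_sum]
  refine Finset.sum_congr rfl fun j _ => ?_
  rw [W_formula _ X T f hf hs (fun i => (j i : ℕ)) rfl m g (by simpa using hm) (by simpa using hg)]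
  simp only [wj, Finset.prod_mul_distrib, Finset.prod_pow_eq_pow_sum, add_zero]
  have : prM (univ.val.map (fib f)) = ∏ i, (fib f i : ℚ) := by rw [prM, Multiset.map_map]; rfl
  rw [this]
  ring

theorem exists_lab (T : Perm X) : ∃ (n : ℕ) (f : X → Fin n), Lab f T ∧ Function.Surjective f := by
  classical
  refine ⟨_, fun x => Fintype.equivFin {O // O ∈ Orbs T} ⟨orb T x, orb_mem T x⟩, ?_, ?_⟩
  · intro x y
    simp [orb_eq_iff]
  · intro i
    obtain ⟨⟨O, hO⟩, rfl⟩ := (Fintype.equivFin {O // O ∈ Orbs T}).surjective i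
    obtain ⟨x, rfl⟩ := mem_Orbs.1 hO
    exact ⟨x, rfl⟩

theorem Kraw_eq (T : Perm X) (m g : ℕ) (hm : m + 2 = 2 * g + (Ty T).sum + (Ty T).card)
    (hg : 2 ≤ 2 * g + (Ty T).card) (hm0 : m ≠ 0) :
    Kraw m T = m.factorial * prM (Ty T) * TR (Ty T) (hh g) 0 := by
  obtain ⟨n, f, hf, hs⟩ := exists_lab T
  have e := Ty_lab hf hs
  have hc : (Ty T).card = n := by rw [e]; simp
  have hs' : (Ty T).sum = Fintype.card X := Ty_sum T
  rw [e]
  exact Kraw_lab T f hf hs m g (by rw [← hs', ← hc]; exact hm) (by rw [← hc]; exact hg) hm0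

end
end PH


namespace PH

open Finset Equiv
set_option linter.unusedSectionVars false

open PowerSeries in
noncomputable def Es : PowerSeries ℚ := rescale (-1:ℚ) (exp ℚ)

open PowerSeries in
noncomputable def xs : PowerSeries ℚ := X * Es

open PowerSeries in
theorem coeff_xs_pow (n c : ℕ) : coeff n (xs ^ c) = ell n c := by
  rw [xs, mul_pow, Es, ← map_pow, exp_pow_eq_rescale_exp, coeff_X_pow_mul', ell]
  split_ifs with h
  · rw [coeff_rescale, coeff_rescale, coeff_exp]
    rw [neg_pow (c:ℚ)]
    simp [div_eq_mul_inv]; ring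
  · rfl

theorem ell_conv (n p q : ℕ) : ∑ ab ∈ antidiagonal n, ell ab.1 p * ell ab.2 q = ell n (p+q) := by
  simp only [← coeff_xs_pow, pow_add, PowerSeries.coeff_mul]

theorem ell_gt {n c : ℕ} (h : n < c) : ell n c = 0 := by rw [ell, if_neg (by omega)]

theorem ell_zero_right {n : ℕ} (h : 1 ≤ n) : ell n 0 = 0 := by
  rw [ell, if_pos (by omega)]; simp; omega

theorem ell_step (n c : ℕ) : ((n+1:ℕ):ℚ) * ell (n+1) c = c * ell (n+1) c - c * ell n c := by
  rcases Nat.lt_trichotomy (n+1) c with h | h | h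
  · rw [ell_gt h, ell_gt (by omega : n < c)]; ring
  · subst h; rw [ell_gt (by omega : n < n+1)]; ring
  · obtain ⟨k, hk⟩ := Nat.exists_eq_add_of_lt h
    have : n = c + k := by omega
    subst this
    rw [ell, ell, if_pos (by omega), if_pos (by omega), show c + k + 1 - c = k + 1 by omega, show c + k - c = k by omega,
      Nat.factorial_succ]
    have := Nat.factorial_ne_zero k
    push_cast
    field_simp
    ring

theorem ell_theta (n c : ℕ) : (c:ℚ) * ell n c = ∑ r ∈ range (n+1), (r:ℚ) * ell r c := by
  induction n with
  | zero =>
    rcases Nat.eq_zero_or_pos c with h | h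
    · subst h; simp
    · rw [ell_gt h]; simp
  | succ n ih => rw [Finset.sum_range_succ, ← ih, ell_step]; ring

/-- full transform evaluated at the empty multiset -/
noncomputable def bt (M : Multiset ℕ) (F : Multiset ℕ → ℚ) : ℚ := TR M F 0

theorem TR_cons' (n : ℕ) (M : Multiset ℕ) (F : Multiset ℕ → ℚ) : TR (n ::ₘ M) F = TR M (tr n F) := by
  induction M using Multiset.induction_on generalizing F with
  | empty => rw [TR_cons, TR_zero, TR_zero]
  | cons m M ih => rw [Multiset.cons_swap, TR_cons, ih, TR_cons]

theorem bt_zero (F : Multiset ℕ → ℚ) : bt 0 F = F 0 := rfl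
theorem bt_cons (n : ℕ) (M : Multiset ℕ) (F : Multiset ℕ → ℚ) : bt (n ::ₘ M) F = bt M (tr n F) := by
  rw [bt, TR_cons']; rfl

theorem bt_add (M : Multiset ℕ) (F G : Multiset ℕ → ℚ) : bt M (fun A => F A + G A) = bt M F + bt M G := by
  induction M using Multiset.induction_on generalizing F G with
  | empty => rfl
  | cons m M ih =>
    rw [bt_cons, bt_cons, bt_cons, ← ih]
    congr 1; ext A
    simp [tr, mul_add, Finset.sum_add_distrib]

theorem bt_mul (M : Multiset ℕ) (c : ℚ) (F : Multiset ℕ → ℚ) : bt M (fun A => c * F A) = c * bt M F := by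
  induction M using Multiset.induction_on generalizing F with
  | empty => rfl
  | cons m M ih =>
    rw [bt_cons, bt_cons, ← ih]
    congr 1; ext A
    simp only [tr, Finset.mul_sum]
    exact Finset.sum_congr rfl fun _ _ => by ring

theorem bt_zero' (M : Multiset ℕ) : bt M (fun _ => 0) = 0 := by
  have := bt_mul M 0 (fun _ => 0)
  simpa using this

theorem bt_sum {ι : Type} (s : Finset ι) (M : Multiset ℕ) (F : ι → Multiset ℕ → ℚ) :
    bt M (fun A => ∑ i ∈ s, F i A) = ∑ i ∈ s, bt M (F i) := by
  classical
  induction s using Finset.induction_on with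
  | empty => simp [bt_zero']
  | insert a s ha ih =>
    simp only [Finset.sum_insert ha]
    rw [bt_add, ih]

theorem bt_cons_sum (n : ℕ) (M : Multiset ℕ) (F : Multiset ℕ → ℚ) :
    bt (n ::ₘ M) F = ∑ c ∈ range (n+1), ell n c * bt M (fun A => F (c ::ₘ A)) := by
  rw [bt_cons]
  unfold tr
  rw [bt_sum]
  exact Finset.sum_congr rfl fun c _ => bt_mul _ _ _

theorem bt_card (M : Multiset ℕ) (F : ℕ → Multiset ℕ → ℚ) (k : ℕ) : bt M (fun A => F (k + A.card) A) = bt M (F (k + M.card)) := by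
  induction M using Multiset.induction_on generalizing F k with
  | empty => rfl
  | cons m M ih =>
    rw [bt_cons, bt_cons, Multiset.card_cons, show k + (M.card + 1) = (k + 1) + M.card by ring, ← ih (fun c => tr m (F c))]
    congr 1; ext A
    simp only [tr, Multiset.card_cons]
    rw [show k + (A.card + 1) = (k + 1) + A.card by ring]

theorem bt_conv (M : Multiset ℕ) (F G : Multiset ℕ → ℚ) :
    bt M (conv F G) = conv (fun B => bt B F) (fun B => bt B G) M := by
  induction M using Multiset.induction_on generalizing F G with
  | empty => rw [bt_zero, conv_zero, conv_zero]; rfl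
  | cons m M ih =>
    rw [bt_cons, conv_cons]
    have : tr m (conv F G) = fun B => conv F (tr m G) B + conv (tr m F) G B := by
      ext B
      simp only [tr, conv_cons, mul_add, Finset.sum_add_distrib]
      congr 1
      · have := sum_conv (range (m+1)) (fun _ => F) (fun c A => ell m c * G (c ::ₘ A)) B
        have h2 : conv F (tr m G) B = (B.antidiagonal.map (fun p => ∑ i ∈ range (m+1), F p.1 * (ell m i * G (i ::ₘ p.2)))).sum := by
          unfold conv tr
          simp only [Finset.mul_sum]
        change _ = conv F (tr m G) B
        rw [h2, ← this]
        refine Finset.sum_congr rfl fun c _ => ?_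
        unfold conv
        rw [← Multiset.sum_map_mul_left]
        congr 1; apply Multiset.map_congr rfl; intros; ring
      · have := sum_conv (range (m+1)) (fun c A => ell m c * F (c ::ₘ A)) (fun _ => G) B
        have h2 : conv (tr m F) G B = (B.antidiagonal.map (fun p => ∑ i ∈ range (m+1), (ell m i * F (i ::ₘ p.1)) * G p.2)).sum := by
          unfold conv tr
          simp only [Finset.sum_mul]
        change _ = conv (tr m F) G B
        rw [h2, ← this]
        refine Finset.sum_congr rfl fun c _ => ?_
        unfold conv
        rw [← Multiset.sum_map_mul_left]
        congr 1; apply Multiset.map_congr rfl; intros; ring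
    rw [this, bt_add, ih, ih]
    simp only [bt_cons]

/-- sum over a marked element -/
noncomputable def dM (G : ℕ → Multiset ℕ → ℚ) (M : Multiset ℕ) : ℚ := (M.map fun x : ℕ => G x (M.erase x)).sum

theorem dM_cons (G : ℕ → Multiset ℕ → ℚ) (a : ℕ) (M : Multiset ℕ) :
    dM G (a ::ₘ M) = G a M + dM (fun x A => G x (a ::ₘ A)) M := by
  unfold dM
  rw [Multiset.map_cons, Multiset.sum_cons, Multiset.erase_cons_head]
  congr 2
  apply Multiset.map_congr rfl
  intro x hx
  by_cases h : a = x
  · subst h; beta_reduce; rw [Multiset.erase_cons_head, Multiset.cons_erase hx]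
  · rw [Multiset.erase_cons_tail _ h]

theorem dM_congr {G G' : ℕ → Multiset ℕ → ℚ} {M : Multiset ℕ} (h : ∀ x A, x ::ₘ A = M → G x A = G' x A) : dM G M = dM G' M := by
  unfold dM
  congr 1
  apply Multiset.map_congr rfl
  intro x hx
  exact h x _ (Multiset.cons_erase hx)

theorem dM_add (G G' : ℕ → Multiset ℕ → ℚ) (M : Multiset ℕ) : dM (fun x A => G x A + G' x A) M = dM G M + dM G' M := by
  unfold dM; exact Multiset.sum_map_add
theorem dM_mul (c : ℚ) (G : ℕ → Multiset ℕ → ℚ) (M : Multiset ℕ) : dM (fun x A => c * G x A) M = c * dM G M := by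
  unfold dM; exact Multiset.sum_map_mul_left
theorem dM_zero (G : ℕ → Multiset ℕ → ℚ) : dM G 0 = 0 := rfl
theorem dM_sum {ι : Type} (s : Finset ι) (G : ι → ℕ → Multiset ℕ → ℚ) (M : Multiset ℕ) :
    dM (fun x A => ∑ i ∈ s, G i x A) M = ∑ i ∈ s, dM (G i) M := by
  unfold dM; exact Multiset.sum_map_sum 

theorem bt_dM (M : Multiset ℕ) (G : ℕ → Multiset ℕ → ℚ) :
    bt M (dM G) = dM (fun n A => ∑ c ∈ range (n+1), ell n c * bt A (G c)) M := by
  induction M using Multiset.induction_on generalizing G with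
  | empty => rfl
  | cons m M ih =>
    rw [bt_cons, dM_cons]
    have : tr m (dM G) = fun B => (∑ c ∈ range (m+1), ell m c * G c B) + dM (fun x => tr m (G x)) B := by
      ext B
      have h2 : dM (fun x => tr m (G x)) B = ∑ c ∈ range (m+1), dM (fun x A => ell m c * G x (c ::ₘ A)) B := by
        rw [← dM_sum]; rfl
      rw [h2]
      simp only [tr, dM_cons, mul_add, Finset.sum_add_distrib, dM_mul]
    rw [this, bt_add, bt_sum, ih]
    simp only [bt_mul, bt_cons]

theorem sum_dM (M : Multiset ℕ) (F : Multiset ℕ → ℚ) : ((M.sum : ℕ) : ℚ) * F M = dM (fun x A => (x:ℚ) * F (x ::ₘ A)) M := by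
  have : dM (fun x A => (x:ℚ) * F (x ::ₘ A)) M = dM (fun x _ => F M * (x:ℚ)) M :=
    dM_congr (fun x A h => by rw [h]; ring)
  rw [this, dM_mul, mul_comm]
  congr 1
  unfold dM
  simp [Nat.cast_multiset_sum]

end PH


namespace PH

open Finset Equiv
set_option linter.unusedSectionVars false

noncomputable def kk (g : ℕ) (M : Multiset ℕ) : ℚ := bt M (hh g)

noncomputable def cs (n : ℕ) (f : ℕ → ℕ → ℚ) : ℚ :=
  ∑ ab ∈ antidiagonal n, ∑ r ∈ range (ab.1+1), ∑ s ∈ range (ab.2+1), (r:ℚ) * s * f r s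

noncomputable def JJ (n n' : ℕ) (φ : ℕ → ℚ) : ℚ :=
  ∑ c ∈ range (n+1), ∑ c' ∈ range (n'+1), ell n c * (ell n' c' * (if 1 ≤ c ∧ 1 ≤ c' then ((c+c':ℕ):ℚ) * φ (c+c') else 0))

theorem ell_range {r n : ℕ} (h : r ≤ n) (f : ℕ → ℚ) :
    ∑ p ∈ range (r+1), ell r p * f p = ∑ p ∈ range (n+1), ell r p * f p := by
  apply Finset.sum_subset (Finset.range_subset_range.2 (by omega))
  intro p _ hp
  rw [ell_gt (by simpa using hp), zero_mul]

theorem cs_ell (n : ℕ) (Φ : ℕ → ℕ → ℚ) :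
    ∑ c ∈ range (n+1), ell n c * ∑ pq ∈ antidiagonal c, (pq.1:ℚ) * pq.2 * Φ pq.1 pq.2 =
    cs n (fun r s => ∑ p ∈ range (r+1), ell r p * ∑ q ∈ range (s+1), ell s q * Φ p q) := by
  have h1 : ∑ c ∈ range (n+1), ell n c * ∑ pq ∈ antidiagonal c, (pq.1:ℚ) * pq.2 * Φ pq.1 pq.2 =
      ∑ p ∈ range (n+1), ∑ q ∈ range (n+1), ell n (p+q) * (p * q * Φ p q) := by
    have : ∀ c, ell n c * ∑ pq ∈ antidiagonal c, (pq.1:ℚ) * pq.2 * Φ pq.1 pq.2 =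
       ∑ k ∈ range (c+1), (fun p q => ell n (p+q) * ((p:ℚ) * q * Φ p q)) k (c-k) := by
      intro c
      rw [Finset.Nat.sum_antidiagonal_eq_sum_range_succ_mk, Finset.mul_sum]
      refine Finset.sum_congr rfl fun k hk => ?_
      have := mem_range.1 hk
      beta_reduce
      rw [show k + (c - k) = c by omega]
    simp only [this]
    rw [Finset.sum_range_diag_flip (n+1) (fun p q => ell n (p+q) * ((p:ℚ) * q * Φ p q))]
    refine Finset.sum_congr rfl fun p hp => ?_
    apply Finset.sum_subset (Finset.range_subset_range.2 (by omega))
    intro q _ hq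
    have : ¬ q < n + 1 - p := by simpa using hq
    rw [ell_gt (by omega), zero_mul]
  rw [h1, cs]
  simp only [← ell_conv, Finset.sum_mul]
  rw [Finset.sum_congr rfl (fun p _ => Finset.sum_comm), Finset.sum_comm]
  refine Finset.sum_congr rfl fun ab hab => ?_
  have hab := HasAntidiagonal.mem_antidiagonal.1 hab
  have h2 : ∀ p q : ℕ, ell ab.1 p * ell ab.2 q * (p * q * Φ p q) =
     ∑ r ∈ range (ab.1+1), ∑ s ∈ range (ab.2+1), (r:ℚ) * s * (ell r p * (ell s q * Φ p q)) := by
    intro p q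
    have e1 := ell_theta ab.1 p
    have e2 := ell_theta ab.2 q
    rw [show ell ab.1 p * ell ab.2 q * (p * q * Φ p q) = (p * ell ab.1 p) * (q * ell ab.2 q) * Φ p q by ring, e1, e2,
      Finset.sum_mul_sum, Finset.sum_mul]
    refine Finset.sum_congr rfl fun r _ => ?_
    rw [Finset.sum_mul]
    refine Finset.sum_congr rfl fun s _ => ?_
    ring
  simp only [h2]
  rw [Finset.sum_congr rfl (fun p _ => Finset.sum_comm), Finset.sum_comm]
  refine Finset.sum_congr rfl fun r hr => ?_
  rw [Finset.sum_congr rfl (fun p _ => Finset.sum_comm), Finset.sum_comm]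
  refine Finset.sum_congr rfl fun s hs => ?_
  have := mem_range.1 hr
  have := mem_range.1 hs
  rw [ell_range (show r ≤ n by omega), Finset.mul_sum]
  refine Finset.sum_congr rfl fun p _ => ?_
  rw [ell_range (show s ≤ n by omega), Finset.mul_sum, Finset.mul_sum]

theorem bt_cut (g p q : ℕ) (A : Multiset ℕ) : bt A (cut hh g p q) =
    gs (fun g => bt A (fun B => hh g (p ::ₘ q ::ₘ B))) g +
    ∑ gg ∈ antidiagonal g, conv (fun B => bt B (fun D => hh gg.1 (p ::ₘ D))) (fun B => bt B (fun D => hh gg.2 (q ::ₘ D))) A := by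
  unfold cut
  rw [bt_add, bt_sum]
  congr 1
  · cases g with
    | zero => exact bt_zero' A
    | succ g => rfl
  · exact Finset.sum_congr rfl fun gg _ => bt_conv _ _ _

theorem cut_kk (g r s : ℕ) (A : Multiset ℕ) :
    ∑ p ∈ range (r+1), ell r p * ∑ q ∈ range (s+1), ell s q * bt A (cut hh g p q) = cut kk g r s A := by
  simp only [bt_cut, mul_add, Finset.sum_add_distrib]
  unfold cut
  congr 1
  · cases g with
    | zero => simp [gs]
    | succ g =>
      simp only [gs]
      unfold kk
      rw [bt_cons_sum]
      refine Finset.sum_congr rfl fun p _ => ?_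
      rw [bt_cons_sum]
  · simp only [Finset.mul_sum]
    rw [Finset.sum_congr rfl (fun p _ => Finset.sum_comm), Finset.sum_comm]
    refine Finset.sum_congr rfl fun gg _ => ?_
    unfold conv kk
    simp only [← Multiset.sum_map_mul_left]
    rw [Finset.sum_congr rfl (fun p _ => (Multiset.sum_map_sum).symm), ← Multiset.sum_map_sum]
    congr 1
    apply Multiset.map_congr rfl
    intro B _
    rw [bt_cons_sum, bt_cons_sum, Finset.sum_mul_sum]
    refine Finset.sum_congr rfl fun p _ => Finset.sum_congr rfl fun q _ => ?_
    ring

theorem TRR (g : ℕ) (M : Multiset ℕ) :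
    2 * ((((2 * g + M.card : ℕ) : ℚ) - 2) * kk g M) + 2 * dM (fun n A => ∑ r ∈ range (n+1), (r:ℚ) * kk g (r ::ₘ A)) M =
    dM (fun n A => cs n (fun r s => cut kk g r s A)) M +
    dM (fun n A => dM (fun n' B => JJ n n' (fun c => bt B (fun D => hh g (c ::ₘ D)))) A) M := by
  have h : (fun M => 2 * ((((2 * g + M.sum + M.card : ℕ) : ℚ) - 2) * hh g M)) =
    fun M => dM (fun x A => ∑ pq ∈ antidiagonal x, (pq.1 : ℚ) * pq.2 * cut hh g pq.1 pq.2 A) M +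
    dM (fun x A => dM (fun y B => if 1 ≤ x ∧ 1 ≤ y then ((x + y : ℕ) : ℚ) * hh g ((x+y) ::ₘ B) else 0) A) M := by
    ext M
    exact cutjoin g M
  have h' := congrArg (bt M) h
  rw [bt_add] at h'
  have e1 : bt M (fun M => 2 * ((((2 * g + M.sum + M.card : ℕ) : ℚ) - 2) * hh g M)) =
      2 * ((((2 * g + M.card : ℕ) : ℚ) - 2) * kk g M) + 2 * dM (fun n A => ∑ r ∈ range (n+1), (r:ℚ) * kk g (r ::ₘ A)) M := by
    have : (fun M : Multiset ℕ => 2 * ((((2 * g + M.sum + M.card : ℕ) : ℚ) - 2) * hh g M)) =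
      fun M => (fun c M => 2 * (((c:ℕ):ℚ) - 2) * hh g M) (2*g+M.card) M + 2 * dM (fun x A => (x:ℚ) * hh g (x ::ₘ A)) M := by
      ext M
      rw [← sum_dM, show 2 * g + M.sum + M.card = (2*g + M.card) + M.sum by ring, Nat.cast_add]
      ring
    rw [this, bt_add, bt_mul, bt_card M (fun c M => 2 * (((c:ℕ):ℚ) - 2) * hh g M), bt_mul, bt_dM]
    congr 1
    · rw [mul_assoc]; rfl
    · congr 2
      ext n A
      simp only [bt_mul]
      unfold kk
      have : ∀ r ∈ range (n+1), (r:ℚ) * bt (r ::ₘ A) (hh g) = ∑ c ∈ range (n+1), (r:ℚ) * ell r c * bt A (fun B => hh g (c ::ₘ B)) := by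
        intro r hr
        have := mem_range.1 hr
        rw [bt_cons_sum, ell_range (show r ≤ n by omega), Finset.mul_sum]
        exact Finset.sum_congr rfl fun c _ => by ring
      rw [Finset.sum_congr rfl this, Finset.sum_comm]
      refine Finset.sum_congr rfl fun c _ => ?_
      rw [← Finset.sum_mul, ← ell_theta]
      ring
  rw [← e1, h']
  congr 1
  · rw [bt_dM]
    congr 1
    ext n A
    simp only [← cut_kk]
    rw [← cs_ell]
    refine Finset.sum_congr rfl fun c _ => ?_
    rw [bt_sum]
    simp only [bt_mul]
  · rw [bt_dM]
    congr 1
    ext n A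
    simp only [bt_dM, JJ]
    rw [dM_sum]
    refine Finset.sum_congr rfl fun c _ => ?_
    rw [← dM_mul]
    congr 1
    ext n' B
    rw [Finset.mul_sum]
    refine Finset.sum_congr rfl fun c' _ => ?_
    split_ifs with hc
    · rw [bt_mul]
    · rw [bt_zero']

end PH


namespace PH

open Finset Equiv
set_option linter.unusedSectionVars false

theorem cs_prod (n : ℕ) (f h : ℕ → ℚ) : cs n (fun r s => f r * h s) =
    ∑ ab ∈ antidiagonal n, (∑ r ∈ range (ab.1+1), (r:ℚ) * f r) * ∑ s ∈ range (ab.2+1), (s:ℚ) * h s := by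
  unfold cs
  refine Finset.sum_congr rfl fun ab _ => ?_
  rw [Finset.sum_mul_sum]
  exact Finset.sum_congr rfl fun r _ => Finset.sum_congr rfl fun s _ => by ring

theorem cs_add (n : ℕ) (f h : ℕ → ℕ → ℚ) : cs n (fun r s => f r s + h r s) = cs n f + cs n h := by
  unfold cs
  simp only [mul_add, Finset.sum_add_distrib]

theorem cs_mul (n : ℕ) (c : ℚ) (f : ℕ → ℕ → ℚ) : cs n (fun r s => c * f r s) = c * cs n f := by
  unfold cs
  simp only [Finset.mul_sum]
  exact Finset.sum_congr rfl fun _ _ => Finset.sum_congr rfl fun _ _ => Finset.sum_congr rfl fun _ _ => by ring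

theorem cs_symm (n : ℕ) (f : ℕ → ℕ → ℚ) : cs n (fun r s => f s r) = cs n f := by
  unfold cs
  rw [← Finset.Nat.sum_antidiagonal_swap]
  refine Finset.sum_congr rfl fun ab _ => ?_
  simp only [Prod.fst_swap, Prod.snd_swap]
  rw [Finset.sum_comm]
  exact Finset.sum_congr rfl fun _ _ => Finset.sum_congr rfl fun _ _ => by ring

noncomputable def u01 (a : ℕ) : ℚ := ∑ r ∈ range (a+1), (r:ℚ) * kk 0 {r}

theorem kk01_one : kk 0 {1} = 1 := by
  unfold kk
  rw [show ({1}:Multiset ℕ) = 1 ::ₘ 0 from rfl, bt_cons_sum]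
  simp only [Finset.sum_range_succ, Finset.sum_range_zero, bt_zero]
  rw [ell_zero_right le_rfl]
  have : hh 0 (1 ::ₘ 0) = 1 := by
    rw [hh]
    have e0 : 2 * 0 + (1 ::ₘ (0 : Multiset ℕ)).sum + (1 ::ₘ (0 : Multiset ℕ)).card - 2 = 0 := by simp
    rw [e0, Hn0 _ (by simp)]
    simp [prM]
  rw [this]
  simp [ell, prM]

theorem u01_rec (n : ℕ) : -2 * kk 0 {n} + 2 * u01 n = ∑ ab ∈ antidiagonal n, u01 ab.1 * u01 ab.2 := by
  have h := TRR 0 (n ::ₘ 0)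
  simp only [dM_cons, dM_zero, add_zero] at h
  have h2 : (fun r s => cut kk 0 r s 0) = fun r s => kk 0 {r} * kk 0 {s} := by
    ext r s
    simp [cut, gs, conv_zero]
  rw [h2, cs_prod] at h
  have e : ({n} : Multiset ℕ) = n ::ₘ 0 := rfl
  rw [e]
  unfold u01
  simp only [Multiset.card_cons, Multiset.card_zero] at h
  push_cast at h
  have e' : ∀ n : ℕ, ({n} : Multiset ℕ) = n ::ₘ 0 := fun _ => rfl
  simp only [e'] at h ⊢
  linarith

theorem u01_succ (n : ℕ) : u01 (n+1) = u01 n + ((n+1:ℕ):ℚ) * kk 0 {n+1} := Finset.sum_range_succ _ _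

theorem u01_zero : u01 0 = 0 := by simp [u01]
theorem u01_one : u01 1 = 1 := by rw [u01_succ, u01_zero]; simp [kk01_one]

theorem u01_big (n : ℕ) : u01 (n+2) = 0 := by
  induction n using Nat.strong_induction_on with
  | _ n ih =>
    have h := u01_rec (n+2)
    have hs := u01_succ (n+1)
    have hx : ((n+2:ℕ):ℚ) ≠ 0 := by positivity
    have hsum : ∑ ab ∈ antidiagonal (n+2), u01 ab.1 * u01 ab.2 = if n = 0 then 1 else 0 := by
      split_ifs with h0
      · subst h0
        rw [Finset.Nat.sum_antidiagonal_eq_sum_range_succ_mk]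
        simp [Finset.sum_range_succ, u01_zero, u01_one]
      · apply Finset.sum_eq_zero
        rintro ⟨a, b⟩ hab
        have hab := HasAntidiagonal.mem_antidiagonal.1 hab
        simp only at hab ⊢
        match a, b, hab with
        | 0, b, _ => rw [u01_zero]; ring
        | a, 0, _ => rw [u01_zero]; ring
        | 1, 1, hab => omega
        | a+2, b+1, hab => rw [ih a (by omega)]; ring
        | a+1, b+2, hab => rw [ih b (by omega)]; ring
    rw [hsum] at h
    have hn : u01 (n+1) = if n = 0 then 1 else 0 := by
      split_ifs with h0
      · subst h0; exact u01_one
      · obtain ⟨k, rfl⟩ := Nat.exists_eq_succ_of_ne_zero h0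
        exact ih k (by omega)
    rw [show n + 1 + 1 = n + 2 by ring, hn] at hs
    have hn1 : ((n+1:ℕ):ℚ) ≠ 0 := by positivity
    split_ifs at h hs with h0
    · subst h0
      push_cast at hs
      linarith
    · have : ((n+1:ℕ):ℚ) * u01 (n+2) = 0 := by
        have h4 : u01 (n+2) = kk 0 {n+2} := by linarith
        rw [← h4] at hs
        push_cast at hs ⊢
        linarith
      exact (mul_eq_zero.1 this).resolve_left hn1

theorem u01_conv (n : ℕ) (v : ℕ → ℚ) : ∑ ab ∈ antidiagonal n, u01 ab.1 * v ab.2 = if n = 0 then 0 else v (n-1) := by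
  rcases n with _ | n
  · simp [u01_zero]
  · rw [Finset.sum_eq_single (1, n)]
    · simp [u01_one]
    · rintro ⟨a, b⟩ hab hne
      have hab := HasAntidiagonal.mem_antidiagonal.1 hab
      match a, hab with
      | 0, _ => simp [u01_zero]
      | 1, hab => exact absurd (by ext <;> simp at hab ⊢; omega) hne
      | a+2, _ => simp [u01_big]
    · intro h; exact absurd (HasAntidiagonal.mem_antidiagonal.2 (by ring)) h

/-! convolution in genus and marked set -/
noncomputable def star (F G : ℕ → Multiset ℕ → ℚ) (g : ℕ) (A : Multiset ℕ) : ℚ :=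
  ∑ gg ∈ antidiagonal g, conv (F gg.1) (G gg.2) A

theorem star_add_left (F F' G : ℕ → Multiset ℕ → ℚ) (g : ℕ) (A : Multiset ℕ) :
    star (fun g B => F g B + F' g B) G g A = star F G g A + star F' G g A := by
  unfold star conv
  simp only [add_mul, Multiset.sum_map_add, Finset.sum_add_distrib]

theorem conv_comm (F G : Multiset ℕ → ℚ) (A : Multiset ℕ) : conv F G A = conv G F A := by
  induction A using Multiset.induction_on generalizing F G with
  | empty => rw [conv_zero, conv_zero, mul_comm]
  | cons a A ih => rw [conv_cons, conv_cons, ih, ih _ G, add_comm]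

theorem star_comm (F G : ℕ → Multiset ℕ → ℚ) (g : ℕ) (A : Multiset ℕ) : star F G g A = star G F g A := by
  unfold star
  rw [← Finset.Nat.sum_antidiagonal_swap]
  exact Finset.sum_congr rfl fun gg _ => conv_comm _ _ _

theorem star_add_right (F F' G : ℕ → Multiset ℕ → ℚ) (g : ℕ) (A : Multiset ℕ) :
    star G (fun g B => F g B + F' g B) g A = star G F g A + star G F' g A := by
  rw [star_comm, star_add_left, star_comm, star_comm F']

theorem star_congr {F G F' G' : ℕ → Multiset ℕ → ℚ} {g : ℕ} {A : Multiset ℕ}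
    (h : ∀ g1 g2 B C, g1 + g2 = g → B + C = A → F g1 B * G g2 C = F' g1 B * G' g2 C) : star F G g A = star F' G' g A := by
  unfold star
  refine Finset.sum_congr rfl fun gg hgg => conv_congr fun B C hBC => ?_
  exact h _ _ B C (HasAntidiagonal.mem_antidiagonal.1 hgg) hBC

theorem star_zero {F G : ℕ → Multiset ℕ → ℚ} {g : ℕ} {A : Multiset ℕ}
    (h : ∀ g1 g2 B C, g1 + g2 = g → B + C = A → F g1 B * G g2 C = 0) : star F G g A = 0 := by
  rw [star_congr (F' := fun _ _ => 0) (G' := fun _ _ => 0) (fun g1 g2 B C h1 h2 => by rw [h _ _ _ _ h1 h2]; ring)]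
  unfold star conv
  simp

theorem star_genus0 (a : Multiset ℕ → ℚ) (G : ℕ → Multiset ℕ → ℚ) (g : ℕ) (A : Multiset ℕ) :
    star (fun g B => if g = 0 then a B else 0) G g A = conv a (G g) A := by
  unfold star
  rw [Finset.sum_eq_single (0, g)]
  · simp
  · rintro ⟨x, y⟩ hxy hne
    have hxy := HasAntidiagonal.mem_antidiagonal.1 hxy
    simp only at hxy
    have : x ≠ 0 := by rintro rfl; exact hne (by simpa using hxy)
    simp [this, conv]
  · intro h; exact absurd (HasAntidiagonal.mem_antidiagonal.2 (by ring)) h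

theorem conv_delta (t : ℚ) (G : Multiset ℕ → ℚ) (A : Multiset ℕ) :
    conv (fun B => if B.card = 0 then t else 0) G A = t * G A := by
  induction A using Multiset.induction_on generalizing G with
  | empty => simp [conv_zero]
  | cons a A ih => rw [conv_cons, ih]; simp [conv]

theorem conv_delta1 (φ : Multiset ℕ → ℚ) (G : Multiset ℕ → ℚ) (A : Multiset ℕ) :
    conv (fun B => if B.card = 1 then φ B else 0) G A = dM (fun x B => φ {x} * G B) A := by
  induction A using Multiset.induction_on generalizing G with
  | empty => simp [conv_zero, dM_zero]
  | cons a A ih =>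
    rw [conv_cons, ih, dM_cons, add_comm]
    congr 1
    have : (fun B : Multiset ℕ => if (a ::ₘ B).card = 1 then φ (a ::ₘ B) else 0) = fun B => if B.card = 0 then φ {a} else 0 := by
      ext B
      simp only [Multiset.card_cons, Nat.add_eq_right]
      split_ifs with h
      · rw [Multiset.card_eq_zero.1 h]; rfl
      · rfl
    rw [this, conv_delta]

noncomputable def k1 (g : ℕ) (B : Multiset ℕ) : ℚ := if g = 0 ∧ B.card ≤ 1 then 0 else kk g B
noncomputable def ks (g : ℕ) (B : Multiset ℕ) : ℚ := if g = 0 ∧ B.card ≤ 2 then 0 else kk g B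

theorem kk_eq_k1 (g r : ℕ) (B : Multiset ℕ) : kk g (r ::ₘ B) =
    k1 g (r ::ₘ B) + if g = 0 then (if B.card = 0 then kk 0 {r} else 0) else 0 := by
  unfold k1
  by_cases hg : g = 0
  · subst hg
    by_cases hB : B.card = 0
    · rw [Multiset.card_eq_zero.1 hB]; simp
    · simp [hB]
  · simp [hg]

theorem k1_eq_ks (g r : ℕ) (B : Multiset ℕ) : k1 g (r ::ₘ B) =
    ks g (r ::ₘ B) + if g = 0 then (if B.card = 1 then kk 0 (r ::ₘ B) else 0) else 0 := by
  unfold k1 ks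
  by_cases hg : g = 0
  · subst hg
    simp only [true_and, Multiset.card_cons, if_true]
    by_cases hB : B.card = 1
    · simp [hB]
    · by_cases hB0 : B.card = 0
      · simp [hB0]
      · rw [if_neg (by omega), if_neg (by omega), if_neg hB]; ring
  · simp [hg]

theorem cut_eq (k : ℕ → Multiset ℕ → ℚ) (g r s : ℕ) (A : Multiset ℕ) : cut k g r s A =
  gs (fun g => k g (r ::ₘ s ::ₘ A)) g + star (fun g B => k g (r ::ₘ B)) (fun g B => k g (s ::ₘ B)) g A := rfl

theorem cut_k1 {g : ℕ} {A : Multiset ℕ} (h : ¬ (g = 0 ∧ A.card = 0)) (r s : ℕ) :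
    cut kk g r s A = cut k1 g r s A + (kk 0 {r} * kk g (s ::ₘ A) + kk 0 {s} * kk g (r ::ₘ A)) := by
  rw [cut_eq, cut_eq]
  have h0 : gs (fun g => kk g (r ::ₘ s ::ₘ A)) g = gs (fun g => k1 g (r ::ₘ s ::ₘ A)) g := by
    congr 1; ext g; simp [k1]
  rw [h0, add_assoc]
  congr 1
  simp only [kk_eq_k1 _ r, kk_eq_k1 _ s]
  rw [star_add_left, star_add_right, star_genus0, conv_delta, star_comm _ (fun g B => if g = 0 then (if B.card = 0 then kk 0 {s} else 0) else 0),
    star_genus0, conv_delta]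
  have e : ∀ t, (if g = 0 then (if A.card = 0 then t else 0) else 0) = (0:ℚ) := by
    intro t
    by_cases hg : g = 0
    · simp only [hg, true_and] at h; simp [h]
    · simp [hg]
  simp only [← kk_eq_k1]
  rw [kk_eq_k1 g r, e, ]
  ring

theorem R1 (g : ℕ) (M : Multiset ℕ) (h : ¬ (g = 0 ∧ M.card ≤ 1)) :
    2 * ((((2 * g + M.sum + M.card : ℕ) : ℚ) - 2) * kk g M) =
    dM (fun n A => cs n (fun r s => cut k1 g r s A)) M +
    dM (fun n A => dM (fun n' B => JJ n n' (fun c => bt B (fun D => hh g (c ::ₘ D)))) A) M := by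
  have h1 := TRR g M
  have h2 : dM (fun n A => cs n (fun r s => cut kk g r s A)) M =
     dM (fun n A => cs n (fun r s => cut k1 g r s A)) M + 2 * dM (fun n A => ∑ r ∈ range (n+1), (r:ℚ) * kk g (r ::ₘ A)) M
       - 2 * dM (fun n A => n * kk g (n ::ₘ A)) M := by
    rw [← dM_mul, ← dM_mul, ← dM_add, eq_sub_iff_add_eq, ← dM_add]
    apply dM_congr
    intro n A hA
    have hc : M.card = A.card + 1 := by rw [← hA, Multiset.card_cons]
    have h3 : (fun r s => cut kk g r s A) = fun r s => cut k1 g r s A + (kk 0 {r} * kk g (s ::ₘ A) + kk 0 {s} * kk g (r ::ₘ A)) := by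
      ext r s
      exact cut_k1 (by omega) r s
    rw [h3, cs_add, cs_add, cs_symm n (fun r s => kk 0 {r} * kk g (s ::ₘ A)), cs_prod]
    have h4 := u01_conv n (fun n => ∑ s ∈ range (n+1), (s:ℚ) * kk g (s ::ₘ A))
    unfold u01 at h4
    rw [h4]
    rcases n with _ | n
    · simp
    · rw [if_neg (by omega), Finset.sum_range_succ _ (n+1), Nat.add_sub_cancel]
      ring
  rw [h2, ← sum_dM] at h1
  rw [show 2 * g + M.sum + M.card = (2 * g + M.card) + M.sum by ring, Nat.cast_add]
  linear_combination h1

theorem R02 (n n' : ℕ) : 2 * (((n + n' : ℕ) : ℚ) * kk 0 (n ::ₘ n' ::ₘ 0)) =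
    JJ n n' (fun c => hh 0 (c ::ₘ 0)) + JJ n' n (fun c => hh 0 (c ::ₘ 0)) := by
  have h := R1 0 (n ::ₘ n' ::ₘ 0) (by simp)
  have hz : ∀ x r s, cut k1 0 r s (x ::ₘ 0) = 0 := by
    intro x r s
    rw [cut_eq, gs, zero_add, star]
    rw [show (antidiagonal 0 : Finset (ℕ × ℕ)) = {(0, 0)} from rfl, Finset.sum_singleton]
    rw [conv_cons, conv_zero, conv_zero]
    simp [k1]
  simp only [dM_cons, dM_zero, add_zero, hz, bt_zero] at h
  have e : cs n (fun _ _ => 0) = 0 ∧ cs n' (fun _ _ => 0) = 0 := by simp [cs]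
  rw [e.1, e.2] at h
  simp only [Multiset.sum_cons, Multiset.sum_zero, Multiset.card_cons, Multiset.card_zero] at h
  push_cast at h ⊢
  linarith

end PH


namespace PH

open Finset Equiv
set_option linter.unusedSectionVars false

noncomputable def P02 (a b : ℕ) : ℚ := ∑ r ∈ range (a+1), (r:ℚ) * kk 0 (r ::ₘ b ::ₘ 0)
noncomputable def dk (g : ℕ) (B : Multiset ℕ) (b : ℕ) : ℚ := ∑ s ∈ range (b+1), (s:ℚ) * kk g (s ::ₘ B)

theorem dM_zero' (M : Multiset ℕ) : dM (fun _ _ => 0) M = 0 := by simp [dM]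

theorem dM_cs (n : ℕ) (F : ℕ → Multiset ℕ → ℕ → ℕ → ℚ) (A : Multiset ℕ) :
    cs n (fun r s => dM (fun x B => F x B r s) A) = dM (fun x B => cs n (F x B)) A := by
  unfold cs
  rw [dM_sum]; refine Finset.sum_congr rfl fun _ _ => ?_
  rw [dM_sum]; refine Finset.sum_congr rfl fun _ _ => ?_
  rw [dM_sum]; refine Finset.sum_congr rfl fun _ _ => ?_
  rw [dM_mul]

theorem k1_star_b (g r s : ℕ) (A : Multiset ℕ) :
    star (fun g B => k1 g (r ::ₘ B)) (fun g B => k1 g (s ::ₘ B)) g A =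
    star (fun g B => ks g (r ::ₘ B)) (fun g B => ks g (s ::ₘ B)) g A +
    dM (fun x B => kk 0 (s ::ₘ x ::ₘ 0) * ks g (r ::ₘ B)) A +
    dM (fun x B => kk 0 (r ::ₘ x ::ₘ 0) * k1 g (s ::ₘ B)) A := by
  rw [show (fun g B => k1 g (r ::ₘ B)) = _ from funext fun g => funext fun B => k1_eq_ks g r B, star_add_left, star_genus0,
    conv_delta1 (fun B => kk 0 (r ::ₘ B))]
  congr 1
  rw [show (fun g B => k1 g (s ::ₘ B)) = _ from funext fun g => funext fun B => k1_eq_ks g s B, star_add_right,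
    star_comm (fun g B => ks g (r ::ₘ B)) (fun g B => if g = 0 then (if B.card = 1 then kk 0 (s ::ₘ B) else 0) else 0),
    star_genus0, conv_delta1 (fun B => kk 0 (s ::ₘ B))]
  rfl

theorem cut_k1_st {g : ℕ} {A : Multiset ℕ} (h : ¬ (g = 0 ∧ A.card ≤ 2)) (h' : ¬ (g = 1 ∧ A.card = 0)) (r s : ℕ) :
    cut k1 g r s A = cut ks g r s A + (dM (fun x B => kk 0 (s ::ₘ x ::ₘ 0) * kk g (r ::ₘ B)) A +
      dM (fun x B => kk 0 (r ::ₘ x ::ₘ 0) * kk g (s ::ₘ B)) A) := by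
  rw [cut_eq, cut_eq, k1_star_b]
  have e1 : gs (fun g => k1 g (r ::ₘ s ::ₘ A)) g = gs (fun g => ks g (r ::ₘ s ::ₘ A)) g := by
    rcases g with _ | g
    · rfl
    · simp only [gs, k1, ks, Multiset.card_cons]
      rw [if_neg (by omega), if_neg (by omega)]
  have e2 : dM (fun x B => kk 0 (s ::ₘ x ::ₘ 0) * ks g (r ::ₘ B)) A = dM (fun x B => kk 0 (s ::ₘ x ::ₘ 0) * kk g (r ::ₘ B)) A := by
    apply dM_congr
    intro x B hB
    have : A.card = B.card + 1 := by rw [← hB, Multiset.card_cons]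
    rw [ks, if_neg (by rw [Multiset.card_cons]; omega)]
  have e3 : dM (fun x B => kk 0 (r ::ₘ x ::ₘ 0) * k1 g (s ::ₘ B)) A = dM (fun x B => kk 0 (r ::ₘ x ::ₘ 0) * kk g (s ::ₘ B)) A := by
    apply dM_congr
    intro x B hB
    have : A.card = B.card + 1 := by rw [← hB, Multiset.card_cons]
    rw [k1, if_neg (by rw [Multiset.card_cons]; omega)]
  rw [e1, e2, e3]
  ring

theorem Rst (g : ℕ) (M : Multiset ℕ) (h : ¬ (g = 0 ∧ M.card ≤ 3)) (h' : ¬ (g = 1 ∧ M.card ≤ 1)) :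
    2 * ((((2 * g + M.sum + M.card : ℕ) : ℚ) - 2) * kk g M) =
    dM (fun n A => cs n (fun r s => cut ks g r s A)) M +
    dM (fun n A => dM (fun n' B => 2 * (∑ ab ∈ antidiagonal n, P02 ab.1 n' * dk g B ab.2) + JJ n n' (fun c => bt B (fun D => hh g (c ::ₘ D)))) A) M := by
  rw [R1 g M (by omega)]
  simp only [dM_add]
  rw [← add_assoc]
  congr 1
  rw [← dM_add]
  apply dM_congr
  intro n A hA
  have hc : M.card = A.card + 1 := by rw [← hA, Multiset.card_cons]
  have e : (fun r s => cut k1 g r s A) = fun r s => cut ks g r s A + (dM (fun x B => kk 0 (s ::ₘ x ::ₘ 0) * kk g (r ::ₘ B)) A +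
      dM (fun x B => kk 0 (r ::ₘ x ::ₘ 0) * kk g (s ::ₘ B)) A) := by
    ext r s; exact cut_k1_st (by omega) (by omega) r s
  rw [e, cs_add, cs_add]
  congr 1
  rw [cs_symm n (fun r s => dM (fun x B => kk 0 (r ::ₘ x ::ₘ 0) * kk g (s ::ₘ B)) A), dM_cs, ← dM_add]
  apply dM_congr
  intro x B _
  rw [cs_prod]
  unfold P02 dk
  ring

theorem R11 (n : ℕ) : 2 * (((n + 1 : ℕ) : ℚ) * kk 1 (n ::ₘ 0)) = cs n (fun r s => kk 0 (r ::ₘ s ::ₘ 0)) := by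
  have h := R1 1 (n ::ₘ 0) (by simp)
  have hz : ∀ r s, cut k1 1 r s 0 = kk 0 (r ::ₘ s ::ₘ 0) := by
    intro r s
    rw [cut_eq, gs, star]
    rw [show (antidiagonal 1 : Finset (ℕ × ℕ)) = {(0, 1), (1, 0)} from rfl, Finset.sum_pair (by simp)]
    simp [conv_zero, k1]
  simp only [dM_cons, dM_zero, add_zero, hz] at h
  rw [← h]
  simp only [Multiset.sum_cons, Multiset.sum_zero, Multiset.card_cons, Multiset.card_zero]
  push_cast
  ring

theorem R03cut (n x y : ℕ) : cs n (fun r s => cut k1 0 r s (x ::ₘ y ::ₘ 0)) = 2 * ∑ ab ∈ antidiagonal n, P02 ab.1 x * P02 ab.2 y := by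
  have e : (fun r s => cut k1 0 r s (x ::ₘ y ::ₘ 0)) = fun r s => kk 0 (r ::ₘ x ::ₘ 0) * kk 0 (s ::ₘ y ::ₘ 0) + kk 0 (s ::ₘ x ::ₘ 0) * kk 0 (r ::ₘ y ::ₘ 0) := by
    ext r s
    rw [cut_eq, gs, zero_add, k1_star_b]
    have e1 : star (fun g B => ks g (r ::ₘ B)) (fun g B => ks g (s ::ₘ B)) 0 (x ::ₘ y ::ₘ 0) = 0 := by
      apply star_zero
      intro g1 g2 B C hg hBC
      have hc := congrArg Multiset.card hBC
      simp only [Multiset.card_add, Multiset.card_cons, Multiset.card_zero] at hc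
      have : g1 = 0 := by omega
      subst this
      have : g2 = 0 := by omega
      subst this
      unfold ks
      simp only [Multiset.card_cons, true_and]
      by_cases hB : B.card + 1 ≤ 2
      · rw [if_pos hB]; ring
      · rw [if_pos (by omega : C.card + 1 ≤ 2)]; ring
    rw [e1]
    simp only [dM_cons, dM_zero]
    simp [ks, k1]
    ring
  rw [e, cs_add, cs_symm n (fun r s => kk 0 (r ::ₘ x ::ₘ 0) * kk 0 (s ::ₘ y ::ₘ 0)), cs_prod]
  unfold P02
  ring

noncomputable def φ0 (m : ℕ) (c : ℕ) : ℚ := bt (m ::ₘ 0) (fun D => hh 0 (c ::ₘ D))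

theorem R03 (a b c : ℕ) : 2 * (((a + b + c + 1 : ℕ) : ℚ) * kk 0 (a ::ₘ b ::ₘ c ::ₘ 0)) =
    2 * (∑ ab ∈ antidiagonal a, P02 ab.1 b * P02 ab.2 c) +
    2 * (∑ ab ∈ antidiagonal b, P02 ab.1 a * P02 ab.2 c) +
    2 * (∑ ab ∈ antidiagonal c, P02 ab.1 a * P02 ab.2 b) +
    (JJ a b (φ0 c) + JJ b a (φ0 c) + (JJ a c (φ0 b) + JJ c a (φ0 b)) + (JJ b c (φ0 a) + JJ c b (φ0 a))) := by
  have h := R1 0 (a ::ₘ b ::ₘ c ::ₘ 0) (by simp)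
  simp only [dM_cons, dM_zero, R03cut, add_zero] at h
  have e : ((2 * 0 + (a ::ₘ b ::ₘ c ::ₘ 0).sum + (a ::ₘ b ::ₘ c ::ₘ 0).card : ℕ) : ℚ) - 2 = ((a + b + c + 1 : ℕ) : ℚ) := by
    simp only [Multiset.sum_cons, Multiset.sum_zero, Multiset.card_cons, Multiset.card_zero]
    push_cast; ring
  rw [e] at h
  rw [h]
  unfold φ0
  ring

theorem ell_reindex {n K : ℕ} (h : n ≤ K) (f : ℕ → ℚ) : ∑ c ∈ range (n+1), ell n c * (if 1 ≤ c then f c else 0) =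
    ∑ i ∈ range K, ell n (i+1) * f (i+1) := by
  rw [ell_range h, Finset.sum_range_succ']
  simp

theorem JJ_eq {n n' K : ℕ} (h : n ≤ K) (h' : n' ≤ K) (φ : ℕ → ℚ) : JJ n n' φ =
    ∑ i ∈ range K, ∑ j ∈ range K, ell n (i+1) * ell n' (j+1) * (((i+j+2:ℕ):ℚ) * φ (i+j+2)) := by
  unfold JJ
  have e : ∀ c, ∑ c' ∈ range (n'+1), ell n c * (ell n' c' * (if 1 ≤ c ∧ 1 ≤ c' then ((c+c':ℕ):ℚ) * φ (c+c') else 0)) =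
      ell n c * (if 1 ≤ c then ∑ j ∈ range K, ell n' (j+1) * (((c+(j+1):ℕ):ℚ) * φ (c+(j+1))) else 0) := by
    intro c
    rw [← Finset.mul_sum]
    by_cases hc : 1 ≤ c
    · simp only [hc, true_and, if_true]
      rw [ell_reindex h' (fun c' => ((c+c':ℕ):ℚ) * φ (c+c'))]
    · simp [hc]
  simp only [e]
  rw [ell_reindex h]
  refine Finset.sum_congr rfl fun i _ => ?_
  rw [Finset.mul_sum]
  refine Finset.sum_congr rfl fun j _ => ?_
  rw [show i + 1 + (j + 1) = i + j + 2 by ring]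
  ring

theorem JJ_symm (n n' : ℕ) (φ : ℕ → ℚ) : JJ n n' φ = JJ n' n φ := by
  rw [JJ_eq (le_max_left n n') (le_max_right n n'), JJ_eq (le_max_right n n') (le_max_left n n'), Finset.sum_comm]
  refine Finset.sum_congr rfl fun i _ => Finset.sum_congr rfl fun j _ => ?_
  rw [show j + i + 2 = i + j + 2 by ring]
  ring

noncomputable def Dd (φ : ℕ → ℚ) (n : ℕ) : ℚ := ∑ c ∈ range (n+1), ell n c * ((c:ℚ) * φ c)

theorem Dd_eq {n K : ℕ} (h : n ≤ K) (φ : ℕ → ℚ) : Dd φ n = ∑ i ∈ range K, ell n (i+1) * (((i+1:ℕ):ℚ) * φ (i+1)) := by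
  rw [← ell_reindex h (fun c => (c:ℚ) * φ c)]
  unfold Dd
  refine Finset.sum_congr rfl fun c _ => ?_
  split_ifs with hc
  · rfl
  · rw [show c = 0 by omega]; simp

theorem Dd_theta (φ : ℕ → ℚ) (n : ℕ) : Dd φ n = ∑ r ∈ range (n+1), (r:ℚ) * ∑ c ∈ range (r+1), ell r c * φ c := by
  have : ∀ r ∈ range (n+1), (r:ℚ) * ∑ c ∈ range (r+1), ell r c * φ c = ∑ c ∈ range (n+1), (r:ℚ) * ell r c * φ c := by
    intro r hr
    have := mem_range.1 hr
    rw [ell_range (show r ≤ n by omega), Finset.mul_sum]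
    exact Finset.sum_congr rfl fun c _ => by ring
  rw [Finset.sum_congr rfl this, Finset.sum_comm]
  refine Finset.sum_congr rfl fun c _ => ?_
  rw [← Finset.sum_mul, ← ell_theta]
  ring

theorem Dd_dk (g : ℕ) (B : Multiset ℕ) (n : ℕ) : Dd (fun c => bt B (fun D => hh g (c ::ₘ D))) n = dk g B n := by
  rw [Dd_theta]
  unfold dk kk
  simp only [bt_cons_sum]

theorem JJ_x {n n' K : ℕ} (h : n ≤ K) (h' : n' ≤ K) (φ : ℕ → ℚ) : ∑ ab ∈ antidiagonal n, ell ab.1 1 * JJ ab.2 n' φ =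
    ∑ i ∈ range K, ∑ j ∈ range K, ell n (i+2) * ell n' (j+1) * (((i+j+2:ℕ):ℚ) * φ (i+j+2)) := by
  have e : ∀ ab ∈ antidiagonal n, ell ab.1 1 * JJ ab.2 n' φ = ∑ i ∈ range K, ∑ j ∈ range K, (ell ab.1 1 * ell ab.2 (i+1)) *
      (ell n' (j+1) * (((i+j+2:ℕ):ℚ) * φ (i+j+2))) := by
    intro ab hab
    have hab := HasAntidiagonal.mem_antidiagonal.1 hab
    rw [JJ_eq (K := K) (by omega) h', Finset.mul_sum]
    refine Finset.sum_congr rfl fun i _ => ?_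
    rw [Finset.mul_sum]
    exact Finset.sum_congr rfl fun j _ => by ring
  rw [Finset.sum_congr rfl e, Finset.sum_comm]
  refine Finset.sum_congr rfl fun i _ => ?_
  rw [Finset.sum_comm]
  refine Finset.sum_congr rfl fun j _ => ?_
  rw [← Finset.sum_mul, ell_conv, show 1 + (i + 1) = i + 2 by ring]
  ring

theorem JJ_tele (n n' : ℕ) (φ : ℕ → ℚ) :
    (∑ ab ∈ antidiagonal n, ell ab.1 1 * JJ ab.2 n' φ) - (∑ ab ∈ antidiagonal n', ell ab.1 1 * JJ n ab.2 φ) =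
    ell n' 1 * Dd φ n - ell n 1 * Dd φ n' := by
  simp only [JJ_symm n]
  rw [JJ_x (le_max_left n n') (le_max_right n n'), JJ_x (le_max_right n n') (le_max_left n n'),
    Dd_eq (le_max_left n n'), Dd_eq (le_max_right n n')]
  set K := max n n'
  set w : ℕ → ℕ → ℚ := fun i j => ell n (i+1) * ell n' (j+1) * (((i+j+1:ℕ):ℚ) * φ (i+j+1)) with hw
  have t : ∀ f : ℕ → ℚ, f K = 0 → ∑ i ∈ range K, f (i+1) = ∑ i ∈ range K, f i - f 0 := by
    intro f hf
    have h1 := Finset.sum_range_succ f K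
    have h2 := Finset.sum_range_succ' f K
    linarith
  have e1 : ∑ i ∈ range K, ∑ j ∈ range K, ell n (i+2) * ell n' (j+1) * (((i+j+2:ℕ):ℚ) * φ (i+j+2)) =
     ∑ j ∈ range K, (∑ i ∈ range K, w i j - w 0 j) := by
    rw [Finset.sum_comm]
    refine Finset.sum_congr rfl fun j _ => ?_
    rw [← t (fun i => w i j)]
    · refine Finset.sum_congr rfl fun i _ => ?_
      simp only [hw]
      rw [show i + 1 + j + 1 = i + j + 2 by ring]
    · simp only [hw]
      rw [ell_gt (show n < K + 1 from Nat.lt_succ_of_le (le_max_left _ _))]; ring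
  have e2 : ∑ i ∈ range K, ∑ j ∈ range K, ell n' (i+2) * ell n (j+1) * (((i+j+2:ℕ):ℚ) * φ (i+j+2)) =
     ∑ i ∈ range K, (∑ j ∈ range K, w i j - w i 0) := by
    rw [Finset.sum_comm]
    refine Finset.sum_congr rfl fun j _ => ?_
    rw [← t (fun i => w j i)]
    · refine Finset.sum_congr rfl fun i _ => ?_
      simp only [hw]
      rw [show j + (i + 1) + 1 = i + j + 2 by ring]
      ring
    · simp only [hw]
      rw [ell_gt (show n' < K + 1 from Nat.lt_succ_of_le (le_max_right _ _))]; ring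
  rw [e1, e2, Finset.sum_sub_distrib, Finset.sum_sub_distrib, Finset.sum_comm (γ := ℕ), Finset.mul_sum, Finset.mul_sum]
  have f1 : ∀ i, w i 0 = ell n' 1 * (ell n (i+1) * (((i+1:ℕ):ℚ) * φ (i+1))) := by
    intro i; simp only [hw]; rw [zero_add, add_zero]; ring
  have f2 : ∀ j, w 0 j = ell n 1 * (ell n' (j+1) * (((j+1:ℕ):ℚ) * φ (j+1))) := by
    intro i; simp only [hw]; rw [zero_add, zero_add]; ring
  simp only [f1, f2]
  ring

end PH

namespace PH
open Finset Equiv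
set_option linter.unusedSectionVars false

abbrev Q1 := PowerSeries ℚ
abbrev Q2 := PowerSeries (PowerSeries ℚ)

noncomputable def co (a b : ℕ) (F : Q2) : ℚ := PowerSeries.coeff a (PowerSeries.coeff b F)
noncomputable def mk2 (f : ℕ → ℕ → ℚ) : Q2 := PowerSeries.mk fun b => PowerSeries.mk fun a => f a b
noncomputable def c1 : Q1 →+* Q2 := PowerSeries.C
noncomputable def c2 : Q1 →+* Q2 := PowerSeries.map PowerSeries.C

theorem ext2 {F G : Q2} (h : ∀ a b, co a b F = co a b G) : F = G := by
  ext b a; exact h a b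
@[simp] theorem co_mk2 (f : ℕ → ℕ → ℚ) (a b : ℕ) : co a b (mk2 f) = f a b := by simp [co, mk2]
@[simp] theorem co_add (F G : Q2) (a b : ℕ) : co a b (F + G) = co a b F + co a b G := by simp [co]
@[simp] theorem co_sub (F G : Q2) (a b : ℕ) : co a b (F - G) = co a b F - co a b G := by simp [co]
@[simp] theorem co_neg (F : Q2) (a b : ℕ) : co a b (-F) = - co a b F := by simp [co]
@[simp] theorem co_zero (a b : ℕ) : co a b 0 = 0 := by simp [co]
theorem co_c1 (d : Q1) (a b : ℕ) : co a b (c1 d) = if b = 0 then PowerSeries.coeff a d else 0 := by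
  unfold co c1; rw [PowerSeries.coeff_C]; split_ifs <;> simp
theorem co_c2 (d : Q1) (a b : ℕ) : co a b (c2 d) = if a = 0 then PowerSeries.coeff b d else 0 := by
  unfold co c2; rw [PowerSeries.coeff_map, PowerSeries.coeff_C]
theorem co_c1_mul (d : Q1) (F : Q2) (a b : ℕ) :
    co a b (c1 d * F) = ∑ ab ∈ antidiagonal a, PowerSeries.coeff ab.1 d * co ab.2 b F := by
  unfold co c1; rw [PowerSeries.coeff_C_mul, PowerSeries.coeff_mul]
theorem co_mul (F G : Q2) (a b : ℕ) :
    co a b (F * G) = ∑ q ∈ antidiagonal b, ∑ p ∈ antidiagonal a, co p.1 q.1 F * co p.2 q.2 G := by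
  unfold co; rw [PowerSeries.coeff_mul, map_sum]
  exact Finset.sum_congr rfl fun q _ => PowerSeries.coeff_mul _ _ _
theorem co_c2_mul (d : Q1) (F : Q2) (a b : ℕ) :
    co a b (c2 d * F) = ∑ ab ∈ antidiagonal b, PowerSeries.coeff ab.1 d * co a ab.2 F := by
  unfold co c2; rw [PowerSeries.coeff_mul, map_sum]
  refine Finset.sum_congr rfl fun q _ => ?_
  rw [PowerSeries.coeff_map, PowerSeries.coeff_C_mul]

noncomputable def zz : Q2 := c1 PowerSeries.X
noncomputable def ww : Q2 := c2 PowerSeries.X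
noncomputable def xx : Q2 := c1 xs
noncomputable def yy : Q2 := c2 xs

theorem ww_eq : ww = PowerSeries.X := by unfold ww c2; simp

theorem co_zz_mul (F : Q2) (a b : ℕ) : co a b (zz * F) = if a = 0 then 0 else co (a-1) b F := by
  unfold co zz c1; rw [PowerSeries.coeff_C_mul]
  rcases a with _ | a
  · simp
  · rw [PowerSeries.coeff_succ_X_mul]; simp
theorem co_ww_mul (F : Q2) (a b : ℕ) : co a b (ww * F) = if b = 0 then 0 else co a (b-1) F := by
  rw [ww_eq]; unfold co
  rcases b with _ | a
  · simp
  · rw [PowerSeries.coeff_succ_X_mul]; simp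

noncomputable def th1 (F : Q2) : Q2 := mk2 fun a b => a * co a b F
noncomputable def th2 (F : Q2) : Q2 := mk2 fun a b => b * co a b F

theorem th1_mul (F G : Q2) : th1 (F * G) = th1 F * G + F * th1 G := by
  apply ext2; intro a b
  simp only [th1, co_mk2, co_add, co_mul, Finset.mul_sum, ← Finset.sum_add_distrib]
  refine Finset.sum_congr rfl fun q _ => Finset.sum_congr rfl fun p hp => ?_
  rw [← HasAntidiagonal.mem_antidiagonal.1 hp]; push_cast; ring
theorem th2_mul (F G : Q2) : th2 (F * G) = th2 F * G + F * th2 G := by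
  apply ext2; intro a b
  simp only [th2, co_mk2, co_add, co_mul, Finset.mul_sum, ← Finset.sum_add_distrib]
  refine Finset.sum_congr rfl fun q hq => Finset.sum_congr rfl fun p hp => ?_
  rw [← HasAntidiagonal.mem_antidiagonal.1 hq]; push_cast; ring
theorem th1_add (F G : Q2) : th1 (F + G) = th1 F + th1 G := by
  apply ext2; intro a b; simp only [th1, co_mk2, co_add]; ring
theorem th2_add (F G : Q2) : th2 (F + G) = th2 F + th2 G := by
  apply ext2; intro a b; simp only [th2, co_mk2, co_add]; ring
theorem th1_sub (F G : Q2) : th1 (F - G) = th1 F - th1 G := by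
  apply ext2; intro a b; simp only [th1, co_mk2, co_sub]; ring
theorem th2_sub (F G : Q2) : th2 (F - G) = th2 F - th2 G := by
  apply ext2; intro a b; simp only [th2, co_mk2, co_sub]; ring
theorem th1_neg (F : Q2) : th1 (-F) = - th1 F := by
  apply ext2; intro a b; simp only [th1, co_mk2, co_neg]; ring
theorem th2_neg (F : Q2) : th2 (-F) = - th2 F := by
  apply ext2; intro a b; simp only [th2, co_mk2, co_neg]; ring
theorem th_comm (F : Q2) : th1 (th2 F) = th2 (th1 F) := by
  apply ext2; intro a b; simp only [th1, th2, co_mk2]; ring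
theorem th1_c2 (d : Q1) : th1 (c2 d) = 0 := by
  apply ext2; intro a b; simp only [th1, co_mk2, co_c2, co_zero]; split_ifs with h <;> simp [h]
theorem th2_c1 (d : Q1) : th2 (c1 d) = 0 := by
  apply ext2; intro a b; simp only [th2, co_mk2, co_c1, co_zero]; split_ifs with h <;> simp [h]

theorem xs_coeff (n : ℕ) : PowerSeries.coeff n xs = ell n 1 := by
  have := coeff_xs_pow n 1; rwa [pow_one] at this
theorem ell01 : ell 0 1 = 0 := by simp [ell]
theorem th_x (a : ℕ) : (a:ℚ) * ell a 1 = ell a 1 - (if a = 0 then 0 else ell (a-1) 1) := by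
  rcases a with _ | a
  · simp [ell01]
  · have := ell_step a 1
    rw [this]; simp
theorem th1_xx : th1 xx = (1 - zz) * xx := by
  rw [sub_mul, one_mul]
  apply ext2; intro a b
  simp only [th1, co_mk2, co_sub, co_zz_mul, xx, co_c1, xs_coeff]
  split_ifs with h h' <;> first | (simp_all [ell01]; done) | (rw [th_x]; simp [*, ell01])
theorem th2_yy : th2 yy = (1 - ww) * yy := by
  rw [sub_mul, one_mul]
  apply ext2; intro a b
  simp only [th2, co_mk2, co_sub, co_ww_mul, yy, co_c2, xs_coeff]
  split_ifs with h h' <;> first | (simp_all [ell01]; done) | (rw [th_x]; simp [*, ell01])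
theorem th1_zz : th1 zz = zz := by
  apply ext2; intro a b
  simp only [th1, co_mk2, zz, co_c1, PowerSeries.coeff_X]
  split_ifs <;> simp_all
theorem th2_ww : th2 ww = ww := by
  apply ext2; intro a b
  simp only [th2, co_mk2, ww, co_c2, PowerSeries.coeff_X]
  split_ifs <;> simp_all

noncomputable def Del : Q2 := mk2 fun a b => ell (a+b+1) 1

theorem Del_eq : xx - yy = (zz - ww) * Del := by
  rw [sub_mul]
  apply ext2; intro a b
  simp only [co_sub, co_zz_mul, co_ww_mul, xx, yy, co_c1, co_c2, xs_coeff, Del, co_mk2]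
  rcases a with _ | a <;> rcases b with _ | b <;> simp [ell01]
  rw [show a + (b+1) + 1 = a + 1 + b + 1 by ring]; simp

theorem Del_unit : IsUnit Del := by
  rw [PowerSeries.isUnit_iff_constantCoeff, PowerSeries.isUnit_iff_constantCoeff]
  have : PowerSeries.constantCoeff (PowerSeries.constantCoeff Del) = 1 := by
    have := co_mk2 (fun a b => ell (a+b+1) 1) 0 0
    rw [co, PowerSeries.coeff_zero_eq_constantCoeff_apply, PowerSeries.coeff_zero_eq_constantCoeff_apply] at this
    unfold Del
    rw [this]; simp [ell]
  rw [this]; exact isUnit_one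

theorem zw_ne : zz - ww ≠ 0 := by
  intro h
  have := congrArg (co 1 0) h
  simp [zz, ww, co_c1, co_c2, PowerSeries.coeff_X] at this
theorem xy_ne : xx - yy ≠ 0 := by
  intro h
  have := congrArg (co 1 0) h
  simp [xx, yy, co_c1, co_c2, xs_coeff, ell] at this
theorem z1_ne : (1 - zz) ≠ 0 := by
  intro h
  have := congrArg (co 1 0) h
  rw [show (1:Q2) = c1 1 by rw [map_one]] at this
  rw [co_sub, co_c1, zz, co_c1] at this
  simp [PowerSeries.coeff_X, PowerSeries.coeff_one] at this
theorem w1_ne : (1 - ww) ≠ 0 := by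
  intro h
  have := congrArg (co 0 1) h
  rw [show (1:Q2) = c2 1 by rw [map_one]] at this
  rw [co_sub, co_c2, ww, co_c2] at this
  simp [PowerSeries.coeff_X, PowerSeries.coeff_one] at this

/-- series of the join terms -/
noncomputable def JS (φ : ℕ → ℚ) : Q2 := mk2 fun a b => JJ a b φ
theorem JS_eq (φ : ℕ → ℚ) : (xx - yy) * JS φ = yy * c1 (PowerSeries.mk (Dd φ)) - xx * c2 (PowerSeries.mk (Dd φ)) := by
  rw [sub_mul]
  apply ext2; intro a b
  have := JJ_tele a b φ
  rw [co_sub, co_sub, xx, yy, co_c1_mul, co_c2_mul, co_c1_mul, co_c2_mul]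
  simp only [JS, co_mk2, co_c1, co_c2, xs_coeff, PowerSeries.coeff_mk]
  rw [this]
  congr 1
  · rw [Finset.sum_eq_single (b, 0)]
    · simp
    · rintro ⟨p, q⟩ h h'
      have := HasAntidiagonal.mem_antidiagonal.1 h
      have : q ≠ 0 := by rintro rfl; simp_all
      simp [this]
    · intro h; simp at h
  · rw [Finset.sum_eq_single (a, 0)]
    · simp
    · rintro ⟨p, q⟩ h h'
      have := HasAntidiagonal.mem_antidiagonal.1 h
      have : q ≠ 0 := by rintro rfl; simp_all
      simp [this]
    · intro h; simp at h

theorem Dd_01 : PowerSeries.mk (Dd (fun c => hh 0 (c ::ₘ 0))) = (PowerSeries.X : Q1) := by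
  ext n
  rw [PowerSeries.coeff_mk, PowerSeries.coeff_X]
  have h := Dd_dk 0 0 n
  simp only [bt_zero] at h
  rw [h]
  change u01 n = _
  match n with
  | 0 => simp [u01_zero]
  | 1 => simp [u01_one]
  | n+2 => simp [u01_big]

/-- V and U -/
theorem exists_VU : ∃ V U : Q2, th1 Del = -((V + zz) * Del) ∧ th2 Del = -((U + ww) * Del) := by
  obtain ⟨D, hD⟩ := Del_unit
  refine ⟨-(th1 Del * ↑D⁻¹) - zz, -(th2 Del * ↑D⁻¹) - ww, ?_, ?_⟩ <;>
  · rw [← hD]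
    simp only [sub_add_cancel, neg_mul, neg_neg, mul_assoc, Units.inv_mul, mul_one]

noncomputable def pS : Q2 := mk2 fun a b => a * kk 0 (a ::ₘ b ::ₘ 0)
noncomputable def qS : Q2 := mk2 fun a b => b * kk 0 (a ::ₘ b ::ₘ 0)

theorem pq_spec : th1 Del = -((pS + zz) * Del) ∧ th2 Del = -((qS + ww) * Del) ∧
   (xx - yy) * (zz - ww) * pS = ww * (xx - yy) - yy * (zz - ww) * (1 - zz) ∧
   (xx - yy) * (zz - ww) * qS = -zz * (xx - yy) + xx * (zz - ww) * (1 - ww) := by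
  obtain ⟨V, U, hV, hU⟩ := exists_VU
  have eV : (xx - yy) * (zz - ww) * V = ww * (xx - yy) - yy * (zz - ww) * (1 - zz) := by
    have h := congrArg th1 Del_eq
    rw [th1_sub, th1_xx, yy, th1_c2, th1_mul, th1_sub, th1_zz, ww, th1_c2, hV] at h
    change _ = (zz - 0) * Del + (zz - ww) * _ at h
    have h' := Del_eq
    linear_combination (zz - ww) * h + (zz - zz*(zz-ww) - (zz-ww)*V) * (-1) * h'
  have eU : (xx - yy) * (zz - ww) * U = -zz * (xx - yy) + xx * (zz - ww) * (1 - ww) := by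
    have h := congrArg th2 Del_eq
    rw [th2_sub, th2_yy, xx, th2_c1, th2_mul, th2_sub, th2_ww, zz, th2_c1, hU] at h
    change _ = (0 - ww) * Del + (zz - ww) * _ at h
    have h' := Del_eq
    linear_combination (zz - ww) * h + (ww + ww*(zz-ww) + (zz-ww)*U) * h'
  have hJ : V + U = JS (fun c => hh 0 (c ::ₘ 0)) := by
    have h := JS_eq (fun c => hh 0 (c ::ₘ 0))
    rw [Dd_01] at h
    change _ = yy * zz - xx * ww at h
    apply mul_left_cancel₀ (mul_ne_zero xy_ne zw_ne)
    linear_combination eV + eU - (zz - ww) * h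
  have hsym : th1 U = th2 V := by
    have h := th_comm Del
    rw [hU, hV, th1_neg, th2_neg, th1_mul, th2_mul, hU, hV, th1_add, th2_add, ww, th1_c2, zz, th2_c1] at h
    apply mul_right_cancel₀ Del_unit.ne_zero
    linear_combination -h
  have hVp : V = pS := by
    apply ext2; intro a b
    rw [pS, co_mk2]
    have h1 := congrArg (co a b) hJ
    have h2 := congrArg (co a b) hsym
    simp only [co_add, JS, co_mk2, th1, th2] at h1 h2
    have h3 := R02 a b
    rw [JJ_symm b a] at h3
    by_cases h0 : a + b = 0
    · obtain ⟨rfl, rfl⟩ : a = 0 ∧ b = 0 := by omega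
      have h := congrArg (co 0 0) hV
      rw [add_mul, co_neg, co_add, co_zz_mul, co_mul] at h
      simp [th1, Del, ell] at h
      simp [h]
    · have : ((a + b : ℕ):ℚ) ≠ 0 := by exact_mod_cast h0
      apply mul_left_cancel₀ this
      push_cast at h3 ⊢
      linear_combination (a:ℚ) * h1 - h2 - (a:ℚ)/2 * h3
  have hUq : U = qS := by
    apply ext2; intro a b
    have h1 := congrArg (co a b) hJ
    rw [hVp] at h1
    have h3 := R02 a b
    rw [JJ_symm b a] at h3
    simp only [co_add, JS, co_mk2, pS] at h1
    rw [qS, co_mk2]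
    push_cast at h3
    linear_combination h1 - 1/2 * h3
  subst hVp hUq
  exact ⟨hV, hU, eV, eU⟩

noncomputable def PS : Q2 := mk2 P02
noncomputable def PS' : Q2 := mk2 fun a b => P02 b a
theorem P02_succ (a b : ℕ) : P02 (a+1) b = P02 a b + ((a+1:ℕ):ℚ) * kk 0 ((a+1) ::ₘ b ::ₘ 0) := Finset.sum_range_succ _ _
theorem P02_zero (b : ℕ) : P02 0 b = 0 := by simp [P02]
theorem PS_p : (1 - zz) * PS = pS := by
  rw [sub_mul, one_mul]
  apply ext2; intro a b
  rw [co_sub, co_zz_mul, PS, pS, co_mk2, co_mk2, co_mk2]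
  rcases a with _ | a
  · simp [P02_zero]
  · rw [P02_succ]; simp
theorem PS_q : (1 - ww) * PS' = qS := by
  rw [sub_mul, one_mul]
  apply ext2; intro a b
  rw [co_sub, co_ww_mul, PS', qS, co_mk2, co_mk2, co_mk2]
  rcases b with _ | a
  · simp [P02_zero]
  · rw [P02_succ, Multiset.cons_swap]; simp
theorem PS_eq : (xx - yy) * (zz - ww) * ((1 - zz) * PS) = ww * (xx - yy) - yy * (zz - ww) * (1 - zz) := by
  rw [PS_p]; exact pq_spec.2.2.1
theorem PS'_eq : (xx - yy) * (zz - ww) * ((1 - ww) * PS') = -zz * (xx - yy) + xx * (zz - ww) * (1 - ww) := by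
  rw [PS_q]; exact pq_spec.2.2.2

theorem pair_id (φ : ℕ → ℚ) (n b : ℕ) (hn : 1 ≤ n) (hb : 1 ≤ b) :
    (∑ ab ∈ antidiagonal n, P02 ab.1 b * Dd φ ab.2) + (∑ ab ∈ antidiagonal b, P02 ab.1 n * Dd φ ab.2) + JJ n b φ =
    ∑ m ∈ range (n + b + 1), Dd φ m := by
  set d : Q1 := PowerSeries.mk (Dd φ) with hd
  set e : ℕ → ℚ := fun n => ∑ m ∈ range (n+1), Dd φ m with he
  set E : Q1 := PowerSeries.mk e with hE
  have e0 : e 0 = 0 := by simp [he, Dd]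
  have hEd : (1 - PowerSeries.X) * E = d := by
    rw [sub_mul, one_mul]; ext n
    rcases n with _ | n
    · simp [hE, hd, he]
    · rw [map_sub, PowerSeries.coeff_succ_X_mul, hE, hd, PowerSeries.coeff_mk, PowerSeries.coeff_mk, PowerSeries.coeff_mk, he]
      simp only
      rw [Finset.sum_range_succ _ (n+1)]; ring
  have hE1 : (1 - zz) * c1 E = c1 d := by rw [← hEd, map_mul, map_sub, map_one]; rfl
  have hE2 : (1 - ww) * c2 E = c2 d := by rw [← hEd, map_mul, map_sub, map_one]; rfl
  set Q : Q2 := c1 d * PS + c2 d * PS' + JS φ with hQ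
  have hQe : (zz - ww) * Q = ww * c1 E - zz * c2 E := by
    apply mul_left_cancel₀ (mul_ne_zero (mul_ne_zero xy_ne z1_ne) w1_ne)
    have h1 := PS_eq
    have h2 := PS'_eq
    have h3 := JS_eq φ
    rw [← hd] at h3
    rw [hQ]
    linear_combination (1 - ww) * c1 d * h1 + (1 - zz) * c2 d * h2 + (zz - ww) * (1 - zz) * (1 - ww) * h3
      - (xx - yy) * ww * (1-ww) * hE1 + (xx - yy) * zz * (1-zz) * hE2
  have hG : (zz - ww) * mk2 (fun a b => if 1 ≤ a ∧ 1 ≤ b then e (a+b) else 0) = ww * c1 E - zz * c2 E := by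
    rw [sub_mul]
    apply ext2; intro a b
    rw [co_sub, co_sub, co_zz_mul, co_ww_mul, co_zz_mul, co_ww_mul, co_mk2, co_mk2, co_c1, co_c2, hE, PowerSeries.coeff_mk, PowerSeries.coeff_mk]
    match a, b with
    | 0, 0 => simp
    | 0, 1 => simp [e0]
    | 0, b+2 => simp
    | 1, 0 => simp [e0]
    | a+2, 0 => simp
    | 1, 1 => simp
    | 1, b+2 => simp [add_comm, add_left_comm]
    | a+2, 1 => simp
    | a+2, b+2 => simp [show a + 1 + (b+2) = a + 2 + (b + 1) by ring]
  have hfin := mul_left_cancel₀ zw_ne (hQe.trans hG.symm)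
  have h := congrArg (co n b) hfin
  rw [hQ, co_add, co_add, co_c1_mul, co_c2_mul, co_mk2, if_pos ⟨hn, hb⟩] at h
  simp only [PS, PS', JS, co_mk2, hd, PowerSeries.coeff_mk] at h
  change _ = e (n+b)
  rw [← h, ← Finset.Nat.sum_antidiagonal_swap, ← Finset.Nat.sum_antidiagonal_swap (n := b)]
  simp only [Prod.fst_swap, Prod.snd_swap, mul_comm]

end PH

namespace PH
open Finset Equiv
set_option linter.unusedSectionVars false

theorem dM2_swap (F : ℕ → ℕ → Multiset ℕ → ℚ) (M : Multiset ℕ) :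
    dM (fun n A => dM (fun n' B => F n n' B) A) M = dM (fun n A => dM (fun n' B => F n' n B) A) M := by
  induction M using Multiset.induction_on generalizing F with
  | empty => simp [dM_zero]
  | cons x M ih =>
    simp only [dM_cons, dM_add]
    have := ih (fun n n' B => F n n' (x ::ₘ B))
    rw [this]; ring

/-- the final recursion -/
theorem Rfin (g : ℕ) (M : Multiset ℕ) (hM : ∀ x ∈ M, 1 ≤ x) (h : ¬ (g = 0 ∧ M.card ≤ 3)) (h' : ¬ (g = 1 ∧ M.card ≤ 1)) :
    2 * ((((2 * g + M.sum + M.card : ℕ) : ℚ) - 2) * kk g M) =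
    dM (fun n A => cs n (fun r s => cut ks g r s A)) M +
    dM (fun n A => dM (fun n' B => ∑ m ∈ range (n + n' + 1), dk g B m) A) M := by
  rw [Rst g M h h']
  congr 1
  set F : ℕ → ℕ → Multiset ℕ → ℚ := fun n n' B => ∑ ab ∈ antidiagonal n, P02 ab.1 n' * dk g B ab.2 with hF
  have h1 : dM (fun n A => dM (fun n' B => 2 * (∑ ab ∈ antidiagonal n, P02 ab.1 n' * dk g B ab.2) +
      JJ n n' (fun c => bt B (fun D => hh g (c ::ₘ D)))) A) M =
      dM (fun n A => dM (fun n' B => F n n' B) A) M + dM (fun n A => dM (fun n' B => F n n' B +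
      JJ n n' (fun c => bt B (fun D => hh g (c ::ₘ D)))) A) M := by
    rw [← dM_add]
    refine dM_congr fun x A _ => ?_
    rw [← dM_add]
    refine dM_congr fun y B _ => ?_
    simp only [hF]; ring
  rw [h1, dM2_swap F, ← dM_add]
  refine dM_congr fun x A hA => ?_
  rw [← dM_add]
  refine dM_congr fun y B hB => ?_
  have hx : 1 ≤ x := hM x (by rw [← hA]; simp)
  have hy : 1 ≤ y := hM y (by rw [← hA, ← hB]; simp)
  have := pair_id (fun c => bt B (fun D => hh g (c ::ₘ D))) x y hx hy
  simp only [Dd_dk] at this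
  rw [← this]
  simp only [hF]; ring

/-! ### the case (0,3) -/
abbrev Q3 := PowerSeries (PowerSeries (PowerSeries ℚ))
noncomputable def co3 (a b c : ℕ) (F : Q3) : ℚ := co a b (PowerSeries.coeff c F)
noncomputable def mk3 (f : ℕ → ℕ → ℕ → ℚ) : Q3 := PowerSeries.mk fun c => mk2 fun a b => f a b c
noncomputable def E12 : Q2 →+* Q3 := PowerSeries.C
noncomputable def E13 : Q2 →+* Q3 := PowerSeries.map PowerSeries.C
noncomputable def E23 : Q2 →+* Q3 := PowerSeries.map (PowerSeries.map PowerSeries.C)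

theorem ext3 {F G : Q3} (h : ∀ a b c, co3 a b c F = co3 a b c G) : F = G := by
  ext c b a; exact h a b c
@[simp] theorem co3_mk3 (f : ℕ → ℕ → ℕ → ℚ) (a b c : ℕ) : co3 a b c (mk3 f) = f a b c := by simp [co3, mk3]
@[simp] theorem co3_add (F G : Q3) (a b c : ℕ) : co3 a b c (F + G) = co3 a b c F + co3 a b c G := by simp [co3]
@[simp] theorem co3_sub (F G : Q3) (a b c : ℕ) : co3 a b c (F - G) = co3 a b c F - co3 a b c G := by simp [co3]

theorem co3_E12_E13 (F G : Q2) (a b c : ℕ) : co3 a b c (E12 F * E13 G) = ∑ p ∈ antidiagonal a, co p.1 b F * co p.2 c G := by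
  unfold co3 co E12 E13
  rw [PowerSeries.coeff_C_mul, PowerSeries.coeff_map, PowerSeries.coeff_mul_C, PowerSeries.coeff_mul]
theorem co3_E12_E23 (F G : Q2) (a b c : ℕ) : co3 a b c (E12 F * E23 G) = ∑ p ∈ antidiagonal b, co a p.1 F * co p.2 c G := by
  unfold co3 co E12 E23
  rw [PowerSeries.coeff_C_mul, PowerSeries.coeff_map, PowerSeries.coeff_mul, map_sum]
  refine Finset.sum_congr rfl fun p _ => ?_
  rw [PowerSeries.coeff_map, PowerSeries.coeff_mul_C]
theorem co3_E13_E23 (F G : Q2) (a b c : ℕ) : co3 a b c (E13 F * E23 G) = ∑ p ∈ antidiagonal c, co a p.1 F * co b p.2 G := by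
  unfold co3 co E13 E23
  rw [PowerSeries.coeff_mul, map_sum, map_sum]
  refine Finset.sum_congr rfl fun p _ => ?_
  rw [PowerSeries.coeff_map, PowerSeries.coeff_map, PowerSeries.coeff_C_mul, PowerSeries.coeff_map, PowerSeries.coeff_mul_C]

noncomputable def i1 : Q1 →+* Q3 := E12.comp c1
noncomputable def i2 : Q1 →+* Q3 := E12.comp c2
noncomputable def i3 : Q1 →+* Q3 := E13.comp c2
theorem i1' (d : Q1) : i1 d = E13 (c1 d) := by unfold i1 E12 E13 c1; simp
theorem i2' (d : Q1) : i2 d = E23 (c1 d) := by unfold i2 E12 E23 c1 c2; simp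
theorem i3' (d : Q1) : i3 d = E23 (c2 d) := by
  unfold i3 E13 E23 c2; ext a b c
  simp

theorem co3_i1_mul (d : Q1) (F : Q3) (a b c : ℕ) :
    co3 a b c (i1 d * F) = ∑ p ∈ antidiagonal a, PowerSeries.coeff p.1 d * co3 p.2 b c F := by
  unfold co3 i1 E12
  rw [RingHom.comp_apply, PowerSeries.coeff_C_mul, co_c1_mul]
theorem co3_i2_mul (d : Q1) (F : Q3) (a b c : ℕ) :
    co3 a b c (i2 d * F) = ∑ p ∈ antidiagonal b, PowerSeries.coeff p.1 d * co3 a p.2 c F := by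
  unfold co3 i2 E12
  rw [RingHom.comp_apply, PowerSeries.coeff_C_mul, co_c2_mul]
theorem co3_i3_mul (d : Q1) (F : Q3) (a b c : ℕ) :
    co3 a b c (i3 d * F) = ∑ p ∈ antidiagonal c, PowerSeries.coeff p.1 d * co3 a b p.2 F := by
  unfold co3 i3 E13 co c2
  rw [RingHom.comp_apply, PowerSeries.coeff_mul, map_sum, map_sum]
  refine Finset.sum_congr rfl fun p _ => ?_
  rw [PowerSeries.coeff_map, PowerSeries.coeff_map, PowerSeries.coeff_C_mul, PowerSeries.coeff_C_mul]

theorem co3_E12 (F : Q2) (a b c : ℕ) : co3 a b c (E12 F) = if c = 0 then co a b F else 0 := by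
  unfold co3 E12; rw [PowerSeries.coeff_C]; split_ifs <;> simp
theorem co3_E13 (F : Q2) (a b c : ℕ) : co3 a b c (E13 F) = if b = 0 then co a c F else 0 := by
  unfold co3 co E13; rw [PowerSeries.coeff_map, PowerSeries.coeff_C]; split_ifs <;> simp
theorem co3_E23 (F : Q2) (a b c : ℕ) : co3 a b c (E23 F) = if a = 0 then co b c F else 0 := by
  unfold co3 co E23; rw [PowerSeries.coeff_map, PowerSeries.coeff_map, PowerSeries.coeff_C]

theorem sum_anti_zero (n : ℕ) (v : ℚ) :
    ∑ p ∈ antidiagonal n, ell p.1 1 * (if p.2 = 0 then v else 0) = ell n 1 * v := by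
  rw [Finset.sum_eq_single (n, 0)]
  · simp
  · rintro ⟨p, q⟩ h h'
    have := HasAntidiagonal.mem_antidiagonal.1 h
    have : q ≠ 0 := by rintro rfl; simp_all
    simp [this]
  · intro h; simp at h

theorem Dd_φ0 (m n : ℕ) : Dd (φ0 m) n = P02 n m := Dd_dk 0 (m ::ₘ 0) n

theorem J12_eq : (i1 xs - i2 xs) * mk3 (fun a b c => JJ a b (φ0 c)) = i2 xs * E13 PS - i1 xs * E23 PS := by
  rw [sub_mul]
  apply ext3; intro a b c
  have := JJ_tele a b (φ0 c)
  simp only [co3_sub, co3_i1_mul, co3_i2_mul, co3_mk3, co3_E13, co3_E23, xs_coeff, PS, co_mk2]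
  rw [this, sum_anti_zero, sum_anti_zero, Dd_φ0, Dd_φ0]
theorem J13_eq : (i1 xs - i3 xs) * mk3 (fun a b c => JJ a c (φ0 b)) = i3 xs * E12 PS - i1 xs * E23 PS' := by
  rw [sub_mul]
  apply ext3; intro a b c
  have := JJ_tele a c (φ0 b)
  simp only [co3_sub, co3_i1_mul, co3_i3_mul, co3_mk3, co3_E12, co3_E23, xs_coeff, PS, PS', co_mk2]
  rw [this, sum_anti_zero, sum_anti_zero, Dd_φ0, Dd_φ0]
theorem J23_eq : (i2 xs - i3 xs) * mk3 (fun a b c => JJ b c (φ0 a)) = i3 xs * E12 PS' - i2 xs * E13 PS' := by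
  rw [sub_mul]
  apply ext3; intro a b c
  have := JJ_tele b c (φ0 a)
  simp only [co3_sub, co3_i2_mul, co3_i3_mul, co3_mk3, co3_E12, co3_E13, xs_coeff, PS', co_mk2]
  rw [this, sum_anti_zero, sum_anti_zero, Dd_φ0, Dd_φ0]

theorem field_id {K : Type*} [Field K] (x1 x2 x3 z1 z2 z3 p12 p13 p21 p23 p31 p32 j12 j13 j23 s : K)
   (hx12 : x1 - x2 ≠ 0) (hx13 : x1 - x3 ≠ 0) (hx23 : x2 - x3 ≠ 0)
   (hz12 : z1 - z2 ≠ 0) (hz13 : z1 - z3 ≠ 0) (hz23 : z2 - z3 ≠ 0)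
   (h1 : 1 - z1 ≠ 0) (h2 : 1 - z2 ≠ 0) (h3 : 1 - z3 ≠ 0)
   (e12 : (x1 - x2) * (z1 - z2) * ((1 - z1) * p12) = z2 * (x1 - x2) - x2 * (z1 - z2) * (1 - z1))
   (e13 : (x1 - x3) * (z1 - z3) * ((1 - z1) * p13) = z3 * (x1 - x3) - x3 * (z1 - z3) * (1 - z1))
   (e23 : (x2 - x3) * (z2 - z3) * ((1 - z2) * p23) = z3 * (x2 - x3) - x3 * (z2 - z3) * (1 - z2))
   (e21 : (x1 - x2) * (z1 - z2) * ((1 - z2) * p21) = -z1 * (x1 - x2) + x1 * (z1 - z2) * (1 - z2))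
   (e31 : (x1 - x3) * (z1 - z3) * ((1 - z3) * p31) = -z1 * (x1 - x3) + x1 * (z1 - z3) * (1 - z3))
   (e32 : (x2 - x3) * (z2 - z3) * ((1 - z3) * p32) = -z2 * (x2 - x3) + x2 * (z2 - z3) * (1 - z3))
   (f12 : (x1 - x2) * j12 = x2 * p13 - x1 * p23)
   (f13 : (x1 - x3) * j13 = x3 * p12 - x1 * p32)
   (f23 : (x2 - x3) * j23 = x3 * p21 - x2 * p31)
   (hs : s = z1 / (1 - z1) * (z2 / (1 - z2)) * (z3 / (1 - z3)) * (1 + 1 / (1 - z1) + 1 / (1 - z2) + 1 / (1 - z3))) :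
   p12 * p13 + p21 * p23 + p31 * p32 + (j12 + j13 + j23) = s := by
  obtain ⟨a12, ha12⟩ : ∃ a, a = z2 / ((z1 - z2) * (1 - z1)) := ⟨_, rfl⟩
  obtain ⟨a13, ha13⟩ : ∃ a, a = z3 / ((z1 - z3) * (1 - z1)) := ⟨_, rfl⟩
  obtain ⟨a23, ha23⟩ : ∃ a, a = z3 / ((z2 - z3) * (1 - z2)) := ⟨_, rfl⟩
  obtain ⟨a21, ha21⟩ : ∃ a, a = -z1 / ((z1 - z2) * (1 - z2)) := ⟨_, rfl⟩
  obtain ⟨a31, ha31⟩ : ∃ a, a = -z1 / ((z1 - z3) * (1 - z3)) := ⟨_, rfl⟩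
  obtain ⟨a32, ha32⟩ : ∃ a, a = -z2 / ((z2 - z3) * (1 - z3)) := ⟨_, rfl⟩
  obtain ⟨b12, hb12⟩ : ∃ a, a = x2 / (x1 - x2) := ⟨_, rfl⟩
  obtain ⟨b13, hb13⟩ : ∃ a, a = x3 / (x1 - x3) := ⟨_, rfl⟩
  obtain ⟨b23, hb23⟩ : ∃ a, a = x3 / (x2 - x3) := ⟨_, rfl⟩
  have p12e : p12 = a12 - b12 := by
    apply mul_left_cancel₀ (mul_ne_zero (mul_ne_zero hx12 hz12) h1)
    rw [ha12, hb12]; field_simp; linear_combination e12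
  have p13e : p13 = a13 - b13 := by
    apply mul_left_cancel₀ (mul_ne_zero (mul_ne_zero hx13 hz13) h1)
    rw [ha13, hb13]; field_simp; linear_combination e13
  have p23e : p23 = a23 - b23 := by
    apply mul_left_cancel₀ (mul_ne_zero (mul_ne_zero hx23 hz23) h2)
    rw [ha23, hb23]; field_simp; linear_combination e23
  have p21e : p21 = a21 + 1 + b12 := by
    apply mul_left_cancel₀ (mul_ne_zero (mul_ne_zero hx12 hz12) h2)
    rw [ha21, hb12]; field_simp; linear_combination e21
  have p31e : p31 = a31 + 1 + b13 := by
    apply mul_left_cancel₀ (mul_ne_zero (mul_ne_zero hx13 hz13) h3)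
    rw [ha31, hb13]; field_simp; linear_combination e31
  have p32e : p32 = a32 + 1 + b23 := by
    apply mul_left_cancel₀ (mul_ne_zero (mul_ne_zero hx23 hz23) h3)
    rw [ha32, hb23]; field_simp; linear_combination e32
  have j12e : j12 = b12 * p13 - (1 + b12) * p23 := by
    apply mul_left_cancel₀ hx12; rw [f12, hb12]; field_simp; ring
  have j13e : j13 = b13 * p12 - (1 + b13) * p32 := by
    apply mul_left_cancel₀ hx13; rw [f13, hb13]; field_simp; ring
  have j23e : j23 = b23 * p21 - (1 + b23) * p31 := by
    apply mul_left_cancel₀ hx23; rw [f23, hb23]; field_simp; ring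
  have hb : b12 * b13 - (1 + b12) * b23 + (1 + b13) * (1 + b23) = 1 := by
    rw [hb12, hb13, hb23]; field_simp; ring
  have ha : a12 * a13 + a21 * a23 + a31 * a32 - 1 = s := by
    rw [hs, ha12, ha13, ha23, ha21, ha31, ha32]; field_simp; ring
  rw [← ha, j12e, j13e, j23e, p12e, p13e, p23e, p21e, p31e, p32e]
  linear_combination -hb

theorem inj_ne {R S : Type*} [Ring R] [Ring S] (f : R →+* S) (hf : Function.Injective f) {a : R} (h : a ≠ 0) : f a ≠ 0 := by
  rwa [Ne, map_eq_zero_iff f hf]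
theorem E12_inj : Function.Injective E12 := PowerSeries.C_injective
theorem E13_inj : Function.Injective E13 := PowerSeries.map_injective _ PowerSeries.C_injective
theorem E23_inj : Function.Injective E23 := PowerSeries.map_injective _ (PowerSeries.map_injective _ PowerSeries.C_injective)

noncomputable def ss : Q1 := PowerSeries.mk fun n => if n = 0 then 0 else 1
noncomputable def st : Q1 := PowerSeries.mk fun n => (n:ℚ)
theorem ss_eq : (1 - PowerSeries.X) * ss = PowerSeries.X := by
  ext n; rw [sub_mul, one_mul, map_sub]
  match n with
  | 0 => simp [ss]
  | 1 => rw [PowerSeries.coeff_succ_X_mul]; simp [ss]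
  | n+2 => rw [PowerSeries.coeff_succ_X_mul]; simp [ss, PowerSeries.coeff_X]
theorem st_eq : (1 - PowerSeries.X) * st = ss := by
  ext n; rw [sub_mul, one_mul, map_sub]
  match n with
  | 0 => simp [st, ss]
  | n+1 => rw [PowerSeries.coeff_succ_X_mul]; simp [ss, st]

theorem co3_iii (d e f : Q1) (a b c : ℕ) : co3 a b c (i1 d * i2 e * i3 f) = PowerSeries.coeff a d * PowerSeries.coeff b e * PowerSeries.coeff c f := by
  rw [mul_assoc, i2, RingHom.comp_apply, i3, RingHom.comp_apply, co3_i1_mul]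
  simp only [co3_E12_E13, co_c2]
  rw [Finset.sum_eq_single (a, 0)]
  · simp; ring
  · rintro ⟨p, q⟩ h h'
    have := HasAntidiagonal.mem_antidiagonal.1 h
    have hq : q ≠ 0 := by rintro rfl; simp_all
    rw [Finset.sum_eq_zero, mul_zero]
    rintro ⟨s, t⟩ hst
    have := HasAntidiagonal.mem_antidiagonal.1 hst
    simp only at this ⊢
    by_cases hs : s = 0
    · have : t ≠ 0 := by omega
      simp [this]
    · simp [hs]
  · intro h; simp at h

theorem k03_series : E12 PS * E13 PS + E12 PS' * E23 PS + E13 PS' * E23 PS' +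
    (mk3 (fun a b c => JJ a b (φ0 c)) + mk3 (fun a b c => JJ a c (φ0 b)) + mk3 (fun a b c => JJ b c (φ0 a))) =
    i1 ss * i2 ss * i3 ss + i1 st * i2 ss * i3 ss + i1 ss * i2 st * i3 ss + i1 ss * i2 ss * i3 st := by
  apply IsFractionRing.injective Q3 (FractionRing Q3)
  set φ := algebraMap Q3 (FractionRing Q3)
  have hφ : Function.Injective φ := IsFractionRing.injective Q3 (FractionRing Q3)
  have n12 := inj_ne φ hφ (inj_ne E12 E12_inj xy_ne)
  have n13 := inj_ne φ hφ (inj_ne E13 E13_inj xy_ne)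
  have n23 := inj_ne φ hφ (inj_ne E23 E23_inj xy_ne)
  have m12 := inj_ne φ hφ (inj_ne E12 E12_inj zw_ne)
  have m13 := inj_ne φ hφ (inj_ne E13 E13_inj zw_ne)
  have m23 := inj_ne φ hφ (inj_ne E23 E23_inj zw_ne)
  have m1 := inj_ne φ hφ (inj_ne E12 E12_inj z1_ne)
  have m2 := inj_ne φ hφ (inj_ne E12 E12_inj w1_ne)
  have m3 := inj_ne φ hφ (inj_ne E13 E13_inj w1_ne)
  have e12 := congrArg (fun t => φ (E12 t)) PS_eq
  have e13 := congrArg (fun t => φ (E13 t)) PS_eq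
  have e23 := congrArg (fun t => φ (E23 t)) PS_eq
  have e21 := congrArg (fun t => φ (E12 t)) PS'_eq
  have e31 := congrArg (fun t => φ (E13 t)) PS'_eq
  have e32 := congrArg (fun t => φ (E23 t)) PS'_eq
  have f12 := congrArg φ J12_eq
  have f13 := congrArg φ J13_eq
  have f23 := congrArg φ J23_eq
  simp only [map_sub, map_mul, map_add, map_one, map_neg, xx, yy, zz, ww, ← i1', ← i2', ← i3'] at *
  simp only [show ∀ d, E12 (c1 d) = i1 d from fun _ => rfl, show ∀ d, E12 (c2 d) = i2 d from fun _ => rfl,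
    show ∀ d, E13 (c2 d) = i3 d from fun _ => rfl] at *
  have hss : ∀ i : Q1 →+* Q3, 1 - φ (i PowerSeries.X) ≠ 0 → φ (i ss) = φ (i PowerSeries.X) / (1 - φ (i PowerSeries.X)) := by
    intro i hi
    have := congrArg (fun t => φ (i t)) ss_eq
    simp only [map_mul, map_sub, map_one] at this
    rw [eq_div_iff hi, mul_comm]; exact this
  have hst : ∀ i : Q1 →+* Q3, 1 - φ (i PowerSeries.X) ≠ 0 → φ (i st) = φ (i ss) / (1 - φ (i PowerSeries.X)) := by
    intro i hi
    have := congrArg (fun t => φ (i t)) st_eq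
    simp only [map_mul, map_sub, map_one] at this
    rw [eq_div_iff hi, mul_comm]; exact this
  refine field_id _ _ _ _ _ _ _ _ _ _ _ _ _ _ _ _ n12 n13 n23 m12 m13 m23 m1 m2 m3 e12 e13 e23 e21 e31 e32 f12 f13 f23 ?_
  rw [hst i1 m1, hst i2 m2, hst i3 m3, hss i1 m1, hss i2 m2, hss i3 m3]
  ring

theorem k03 (a b c : ℕ) (ha : 1 ≤ a) (hb : 1 ≤ b) (hc : 1 ≤ c) : kk 0 (a ::ₘ b ::ₘ c ::ₘ 0) = 1 := by
  have h := congrArg (co3 a b c) k03_series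
  have h3 := R03 a b c
  rw [JJ_symm b a, JJ_symm c a, JJ_symm c b] at h3
  simp only [co3_add, co3_iii, co3_E12_E13, co3_E12_E23, co3_E13_E23, co3_mk3] at h
  simp only [PS, PS', co_mk2, ss, st, PowerSeries.coeff_mk, if_neg (show a ≠ 0 by omega), if_neg (show b ≠ 0 by omega),
    if_neg (show c ≠ 0 by omega)] at h
  have : ((a+b+c+1:ℕ):ℚ) ≠ 0 := by positivity
  apply mul_left_cancel₀ this
  push_cast at h3 ⊢
  linear_combination 1/2 * h3 + h

end PH

namespace PH
open Finset Equiv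
set_option linter.unusedSectionVars false

noncomputable def dg (F : Q2) : Q1 := PowerSeries.mk fun n => ∑ p ∈ antidiagonal n, co p.1 p.2 F

theorem dg_mul (F G : Q2) : dg (F * G) = dg F * dg G := by
  ext n
  rw [PowerSeries.coeff_mul]
  simp only [dg, PowerSeries.coeff_mk, co_mul, Finset.sum_mul_sum]
  simp only [← Finset.sum_product']
  rw [Finset.sum_sigma', Finset.sum_sigma']
  refine Finset.sum_nbij' (fun x => ⟨(x.2.2.1 + x.2.1.1, x.2.2.2 + x.2.1.2), ((x.2.2.1, x.2.1.1), (x.2.2.2, x.2.1.2))⟩)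
    (fun x => ⟨(x.2.1.1 + x.2.2.1, x.2.1.2 + x.2.2.2), ((x.2.1.2, x.2.2.2), (x.2.1.1, x.2.2.1))⟩) ?_ ?_ ?_ ?_ ?_
  · rintro ⟨⟨a, b⟩, ⟨c, d⟩, ⟨e, f⟩⟩ h
    simp only [Finset.mem_sigma, Finset.mem_product, HasAntidiagonal.mem_antidiagonal] at h ⊢
    obtain ⟨h1, h2, h3⟩ := h
    refine ⟨?_, ?_, ?_⟩ <;> first | rfl | trivial | omega
  · rintro ⟨⟨a, b⟩, ⟨c, d⟩, ⟨e, f⟩⟩ h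
    simp only [Finset.mem_sigma, Finset.mem_product, HasAntidiagonal.mem_antidiagonal] at h ⊢
    obtain ⟨h1, h2, h3⟩ := h
    refine ⟨?_, ?_, ?_⟩ <;> first | rfl | trivial | omega
  · rintro ⟨⟨a, b⟩, ⟨c, d⟩, ⟨e, f⟩⟩ h
    simp only [Finset.mem_sigma, Finset.mem_product, HasAntidiagonal.mem_antidiagonal] at h ⊢
    obtain ⟨h1, h2, h3⟩ := h
    subst h2 h3; rfl
  · rintro ⟨⟨a, b⟩, ⟨c, d⟩, ⟨e, f⟩⟩ h
    simp only [Finset.mem_sigma, Finset.mem_product, HasAntidiagonal.mem_antidiagonal] at h ⊢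
    obtain ⟨h1, h2, h3⟩ := h
    subst h2 h3; rfl
  · rintro ⟨⟨a, b⟩, ⟨c, d⟩, ⟨e, f⟩⟩ h
    rfl

theorem dg_add (F G : Q2) : dg (F + G) = dg F + dg G := by
  ext n; simp [dg, Finset.sum_add_distrib]
theorem dg_neg (F : Q2) : dg (-F) = - dg F := by
  ext n; simp [dg]

theorem Es_coeff (n : ℕ) : PowerSeries.coeff n Es = ell (n+1) 1 := by
  rw [← xs_coeff, xs, PowerSeries.coeff_succ_X_mul]

theorem ell1_succ (n : ℕ) : ell (n+1) 1 = -(((n+1:ℕ):ℚ) * ell (n+2) 1) := by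
  have := ell_step (n+1) 1
  push_cast at this ⊢
  rw [show n + 1 + 1 = n + 2 by ring] at this
  linarith

theorem dgD : dg Del = (1 - PowerSeries.X) * Es := by
  ext n
  rw [sub_mul, one_mul, map_sub, dg, PowerSeries.coeff_mk]
  have : ∀ p ∈ antidiagonal n, co p.1 p.2 Del = ell (n+1) 1 := by
    intro p hp; rw [Del, co_mk2, HasAntidiagonal.mem_antidiagonal.1 hp]
  rw [Finset.sum_congr rfl this, Finset.sum_const, Finset.Nat.card_antidiagonal, Es_coeff]
  rcases n with _ | n
  · simp
  · rw [PowerSeries.coeff_succ_X_mul, Es_coeff, ell1_succ n]; simp; ring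

theorem sum_anti_fst (n : ℕ) : ∑ p ∈ antidiagonal n, (p.1:ℚ) = n * (n+1) / 2 := by
  rw [Finset.Nat.sum_antidiagonal_eq_sum_range_succ_mk]
  induction n with
  | zero => simp
  | succ n ih => rw [Finset.sum_range_succ, ih]; push_cast; ring
theorem sum_sq (n : ℕ) : ∑ i ∈ range n, (i:ℚ) * i = n * (n-1) * (2*n-1) / 6 := by
  induction n with
  | zero => simp
  | succ n ih => rw [Finset.sum_range_succ, ih]; push_cast; ring
theorem sum_anti_mul (n : ℕ) : ∑ p ∈ antidiagonal n, (p.1:ℚ) * p.2 = (n-1) * n * (n+1) / 6 := by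
  have h : ∀ p ∈ antidiagonal n, (p.1:ℚ) * p.2 = n * p.1 - p.1 * p.1 := by
    intro p hp; rw [← HasAntidiagonal.mem_antidiagonal.1 hp]; push_cast; ring
  rw [Finset.sum_congr rfl h, Finset.sum_sub_distrib, ← Finset.mul_sum, sum_anti_fst]
  rw [Finset.Nat.sum_antidiagonal_eq_sum_range_succ_mk, sum_sq]
  push_cast; ring

theorem coeff_n2 (F : Q1) (n : ℕ) : PowerSeries.coeff (n+2) (PowerSeries.X ^ 2 * F) = PowerSeries.coeff n F := by
  rw [PowerSeries.coeff_X_pow_mul]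
theorem coeff_n3 (F : Q1) (n : ℕ) : PowerSeries.coeff (n+3) (PowerSeries.X ^ 3 * F) = PowerSeries.coeff n F := by
  rw [PowerSeries.coeff_X_pow_mul]

theorem dg1 : PowerSeries.C (2:ℚ) * dg (th1 Del) = PowerSeries.X ^ 2 * Es - PowerSeries.C 2 * (PowerSeries.X * Es) := by
  ext n
  rw [map_sub, PowerSeries.coeff_C_mul, PowerSeries.coeff_C_mul, dg, PowerSeries.coeff_mk]
  have : ∀ p ∈ antidiagonal n, co p.1 p.2 (th1 Del) = p.1 * ell (n+1) 1 := by
    intro p hp; rw [th1, co_mk2, Del, co_mk2, HasAntidiagonal.mem_antidiagonal.1 hp]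
  rw [Finset.sum_congr rfl this, ← Finset.sum_mul, sum_anti_fst]
  match n with
  | 0 => simp
  | 1 => rw [PowerSeries.coeff_succ_X_mul, PowerSeries.coeff_X_pow_mul', if_neg (by norm_num), Es_coeff, ell1_succ 0]; norm_num
  | n+2 =>
    rw [PowerSeries.coeff_succ_X_mul, coeff_n2, Es_coeff, Es_coeff, ell1_succ n, ell1_succ (n+1)]; push_cast; ring
theorem dg2 : dg (th2 Del) = dg (th1 Del) := by
  ext n
  rw [dg, dg, PowerSeries.coeff_mk, PowerSeries.coeff_mk, ← Finset.Nat.sum_antidiagonal_swap]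
  refine Finset.sum_congr rfl fun p _ => ?_
  simp only [th1, th2, co_mk2, Del, Prod.fst_swap, Prod.snd_swap]
  rw [add_comm p.2]
theorem dg12 : PowerSeries.C (6:ℚ) * dg (th2 (th1 Del)) = PowerSeries.C 3 * (PowerSeries.X ^ 2 * Es) - PowerSeries.X ^ 3 * Es := by
  ext n
  rw [map_sub, PowerSeries.coeff_C_mul, PowerSeries.coeff_C_mul, dg, PowerSeries.coeff_mk]
  have : ∀ p ∈ antidiagonal n, co p.1 p.2 (th2 (th1 Del)) = p.1 * p.2 * ell (n+1) 1 := by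
    intro p hp; rw [th2, co_mk2, th1, co_mk2, Del, co_mk2, HasAntidiagonal.mem_antidiagonal.1 hp]; ring
  rw [Finset.sum_congr rfl this, ← Finset.sum_mul, sum_anti_mul]
  match n with
  | 0 => simp
  | 1 => simp [PowerSeries.coeff_X_pow_mul']
  | 2 => rw [coeff_n2, PowerSeries.coeff_X_pow_mul', if_neg (by norm_num), Es_coeff, ell1_succ 0, ell1_succ 1]; norm_num; ring
  | n+3 =>
    rw [coeff_n3, coeff_n2 _ (n+1), Es_coeff, Es_coeff, ell1_succ n, ell1_succ (n+1), ell1_succ (n+2)]; push_cast; ring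

noncomputable def D2S : Q2 := mk2 fun a b => ∑ r ∈ range (a+1), ∑ s ∈ range (b+1), (r:ℚ) * s * kk 0 (r ::ₘ s ::ₘ 0)
theorem D2S_eq : (1 - zz) * ((1 - ww) * D2S) = th2 pS := by
  have h1 : (1 - ww) * D2S = mk2 fun a b => ∑ r ∈ range (a+1), (r:ℚ) * b * kk 0 (r ::ₘ b ::ₘ 0) := by
    apply ext2; intro a b
    rw [sub_mul, one_mul, co_sub, co_ww_mul, D2S, co_mk2, co_mk2, co_mk2]
    rcases b with _ | b
    · simp
    · simp only [Nat.add_sub_cancel, Nat.succ_ne_zero, if_false]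
      rw [← Finset.sum_sub_distrib]
      refine Finset.sum_congr rfl fun r _ => ?_
      rw [Finset.sum_range_succ _ (b+1)]; ring
  rw [h1]
  apply ext2; intro a b
  rw [sub_mul, one_mul, co_sub, co_zz_mul, th2, co_mk2, co_mk2, co_mk2, pS, co_mk2]
  rcases a with _ | a
  · simp
  · simp only [Nat.add_sub_cancel, Nat.succ_ne_zero, if_false]
    rw [Finset.sum_range_succ _ (a+1)]; ring

theorem dg_zz : dg zz = PowerSeries.X := by
  ext n
  rw [dg, PowerSeries.coeff_mk, PowerSeries.coeff_X]
  simp only [zz, co_c1, PowerSeries.coeff_X]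
  rw [Finset.sum_eq_single (n, 0)]
  · simp
  · rintro ⟨p, q⟩ h h'
    have := HasAntidiagonal.mem_antidiagonal.1 h
    have : q ≠ 0 := by rintro rfl; simp_all
    simp [this]
  · intro h; simp at h
theorem dg_ww : dg ww = PowerSeries.X := by
  ext n
  rw [dg, PowerSeries.coeff_mk, PowerSeries.coeff_X]
  simp only [ww, co_c2, PowerSeries.coeff_X]
  rw [Finset.sum_eq_single (0, n)]
  · simp
  · rintro ⟨p, q⟩ h h'
    have := HasAntidiagonal.mem_antidiagonal.1 h
    have : p ≠ 0 := by rintro rfl; simp_all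
    simp [this]
  · intro h; simp at h
theorem Es_ne : Es ≠ 0 := by
  intro h
  have := Es_coeff 0
  rw [h] at this; simp [ell] at this
theorem X1_ne : (1 - PowerSeries.X : Q1) ≠ 0 := by
  intro h
  have := congrArg (PowerSeries.coeff 1) h
  simp [PowerSeries.coeff_one] at this

theorem k11_series : PowerSeries.C 12 * ((1 - PowerSeries.X) ^ 4 * dg D2S) = PowerSeries.X ^ 2 * (PowerSeries.C 6 - PowerSeries.C 4 * PowerSeries.X + PowerSeries.X ^ 2) := by
  have h := pq_spec.1
  have h2 : Del * th2 (th1 Del) = - (th2 pS * (Del * Del)) + th1 Del * th2 Del := by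
    have h' := congrArg th2 h
    rw [th2_neg, th2_mul, th2_add, zz, th2_c1] at h'
    change _ = -((th2 pS + 0) * Del + (pS + zz) * _) at h'
    linear_combination Del * h' - th2 Del * h
  have h3 := congrArg dg h2
  rw [dg_add, dg_neg, dg_mul, dg_mul, dg_mul, dg_mul, dg2, dgD] at h3
  have h4 := congrArg dg D2S_eq
  rw [sub_mul, one_mul, sub_mul, one_mul, sub_eq_add_neg, sub_eq_add_neg, dg_add, dg_neg, dg_mul, dg_zz, dg_add, dg_neg, dg_mul, dg_ww] at h4
  rw [← h4] at h3
  apply mul_left_cancel₀ (mul_ne_zero Es_ne Es_ne)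
  have e1 := dg1
  have e2 := dg12
  set A := dg (th1 Del)
  set B := dg (th2 (th1 Del))
  have c6 : (PowerSeries.C (6:ℚ) : Q1) = 6 := map_ofNat _ 6
  have c2' : (PowerSeries.C (2:ℚ) : Q1) = 2 := map_ofNat _ 2
  have c3 : (PowerSeries.C (3:ℚ) : Q1) = 3 := map_ofNat _ 3
  have c4 : (PowerSeries.C (4:ℚ) : Q1) = 4 := map_ofNat _ 4
  have c12 : (PowerSeries.C (12:ℚ) : Q1) = 12 := map_ofNat _ 12
  rw [c2'] at e1
  rw [c6, c3] at e2
  rw [c12, c6, c4]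
  linear_combination 12 * h3 - 2 * (1 - PowerSeries.X) * Es * e2 + 3 * (2 * A + (PowerSeries.X ^ 2 * Es - 2 * (PowerSeries.X * Es))) * e1

theorem k11_explicit : PowerSeries.C 12 * ((1 - PowerSeries.X) ^ 4 * PowerSeries.mk (fun n : ℕ => if n = 0 then 0 else ((n:ℚ)^2-1)*(n+2)/24)) = PowerSeries.X ^ 2 * (PowerSeries.C 6 - PowerSeries.C 4 * PowerSeries.X + PowerSeries.X ^ 2) := by
  have e : ∀ n, PowerSeries.coeff n (PowerSeries.mk (fun n : ℕ => if n = 0 then 0 else ((n:ℚ)^2-1)*(n+2)/24)) = if n = 0 then 0 else ((n:ℚ)^2-1)*(n+2)/24 := fun n => by simp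
  set F := PowerSeries.mk (fun n : ℕ => if n = 0 then 0 else ((n:ℚ)^2-1)*(n+2)/24)
  have h1 : (1 - PowerSeries.X) ^ 4 * F = F - PowerSeries.C 4 * (PowerSeries.X ^ 1 * F) + PowerSeries.C 6 * (PowerSeries.X ^ 2 * F) -
      PowerSeries.C 4 * (PowerSeries.X ^ 3 * F) + PowerSeries.X ^ 4 * F := by
    rw [show (PowerSeries.C (6:ℚ) : Q1) = 6 from map_ofNat _ 6, show (PowerSeries.C (4:ℚ) : Q1) = 4 from map_ofNat _ 4]; ring
  have h2 : PowerSeries.X ^ 2 * (PowerSeries.C 6 - PowerSeries.C 4 * PowerSeries.X + PowerSeries.X ^ 2) =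
    PowerSeries.C (6:ℚ) * PowerSeries.X ^ 2 - PowerSeries.C 4 * PowerSeries.X ^ 3 + PowerSeries.X ^ 4 := by ring
  rw [h1, h2]
  ext n
  simp only [map_add, map_sub, PowerSeries.coeff_C_mul, PowerSeries.coeff_X_pow_mul', e, PowerSeries.coeff_X_pow]
  match n with
  | 0 => norm_num
  | 1 => norm_num
  | 2 => norm_num
  | 3 => norm_num
  | 4 => norm_num
  | n+5 =>
    rw [if_neg (by omega), if_pos (by omega), if_neg (by omega), if_pos (by omega), if_neg (by omega), if_pos (by omega), if_neg (by omega), if_pos (by omega), if_neg (by omega), if_neg (by omega), if_neg (by omega), if_neg (by omega)]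
    simp only [show n + 5 - 1 = n + 4 by omega, show n + 5 - 2 = n + 3 by omega, show n + 5 - 3 = n + 2 by omega, show n + 5 - 4 = n + 1 by omega]
    push_cast; ring

theorem k11 (n : ℕ) (hn : 1 ≤ n) : kk 1 (n ::ₘ 0) = ((n:ℚ) - 1) * (n + 2) / 48 := by
  have h : dg D2S = PowerSeries.mk (fun n : ℕ => if n = 0 then 0 else ((n:ℚ)^2-1)*(n+2)/24) := by
    have c12 : (PowerSeries.C (12:ℚ) : Q1) ≠ 0 := by
      intro h
      have := congrArg (PowerSeries.coeff 0) h
      simp at this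
    apply mul_left_cancel₀ (mul_ne_zero c12 (pow_ne_zero 4 X1_ne))
    rw [mul_assoc, mul_assoc, k11_series, k11_explicit]
  have h' := congrArg (PowerSeries.coeff n) h
  rw [dg, PowerSeries.coeff_mk, PowerSeries.coeff_mk, if_neg (by omega)] at h'
  simp only [D2S, co_mk2] at h'
  have h3 := R11 n
  have : ((n+1:ℕ):ℚ) ≠ 0 := by positivity
  apply mul_left_cancel₀ this
  have h4 : cs n (fun r s => kk 0 (r ::ₘ s ::ₘ 0)) = ((n:ℚ)^2-1)*(n+2)/24 := h'
  push_cast at h3 ⊢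
  linear_combination 1/2 * h3 + 1/2 * h4

end PH

namespace PH
open Finset Equiv
set_option linter.unusedSectionVars false

def IsPoly {ι : Type} (d : ℕ) (F : (ι → ℕ) → ℚ) : Prop :=
  ∃ P : MvPolynomial ι ℚ, P.totalDegree ≤ d ∧
    ∀ μ : ι → ℕ, (∀ i, 1 ≤ μ i) → F μ = MvPolynomial.eval (fun i => (μ i : ℚ)) P

section
variable {ι : Type} {d e : ℕ} {F G : (ι → ℕ) → ℚ}

lemma IsPoly.congr (h : IsPoly d F) (hFG : ∀ μ : ι → ℕ, (∀ i, 1 ≤ μ i) → G μ = F μ) :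
    IsPoly d G := by
  obtain ⟨P, h1, h2⟩ := h
  exact ⟨P, h1, fun μ hμ => by rw [hFG μ hμ, h2 μ hμ]⟩

lemma IsPoly.mono (h : IsPoly d F) (hde : d ≤ e) : IsPoly e F := by
  obtain ⟨P, h1, h2⟩ := h
  exact ⟨P, h1.trans hde, h2⟩

lemma isPoly_const (c : ℚ) : IsPoly d (fun _ : ι → ℕ => c) :=
  ⟨MvPolynomial.C c, by simp, fun μ _ => by simp⟩

lemma isPoly_var (i : ι) : IsPoly 1 (fun μ : ι → ℕ => (μ i : ℚ)) :=
  ⟨MvPolynomial.X i, by simp, fun μ _ => by simp⟩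

lemma IsPoly.add (hF : IsPoly d F) (hG : IsPoly d G) : IsPoly d (fun μ => F μ + G μ) := by
  obtain ⟨P, h1, h2⟩ := hF
  obtain ⟨Q, h3, h4⟩ := hG
  exact ⟨P + Q, (MvPolynomial.totalDegree_add _ _).trans (max_le h1 h3),
    fun μ hμ => by beta_reduce; rw [h2 μ hμ, h4 μ hμ, map_add]⟩

lemma IsPoly.mul (hF : IsPoly d F) (hG : IsPoly e G) : IsPoly (d + e) (fun μ => F μ * G μ) := by
  obtain ⟨P, h1, h2⟩ := hF
  obtain ⟨Q, h3, h4⟩ := hG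
  exact ⟨P * Q, (MvPolynomial.totalDegree_mul _ _).trans (add_le_add h1 h3),
    fun μ hμ => by beta_reduce; rw [h2 μ hμ, h4 μ hμ, map_mul]⟩

lemma IsPoly.cmul (c : ℚ) (hF : IsPoly d F) : IsPoly d (fun μ => c * F μ) := by
  have := (isPoly_const (ι := ι) (d := 0) c).mul hF
  rwa [zero_add] at this

lemma IsPoly.pow (hF : IsPoly d F) (k : ℕ) : IsPoly (d * k) (fun μ => F μ ^ k) := by
  induction k with
  | zero => simpa using isPoly_const (ι := ι) (d := 0) 1
  | succ k ih =>
    have := ih.mul hF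
    simpa only [pow_succ, Nat.mul_succ] using this

lemma isPoly_sum {α : Type*} (s : Finset α) (f : α → (ι → ℕ) → ℚ)
    (h : ∀ a ∈ s, IsPoly d (f a)) : IsPoly d (fun μ => ∑ a ∈ s, f a μ) := by
  classical
  induction s using Finset.induction_on with
  | empty => simpa using isPoly_const (ι := ι) (d := d) 0
  | insert a s ha ih =>
    simp only [Finset.sum_insert ha]
    exact (h a (by simp)).add (ih fun b hb => h b (by simp [hb]))

lemma isPoly_prod_pow [Fintype ι] (m : ι → ℕ) :
    IsPoly (∑ i, m i) (fun μ : ι → ℕ => ∏ i, (μ i : ℚ) ^ m i) := by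
  classical
  refine ⟨∏ i, MvPolynomial.X i ^ m i, ?_, fun μ _ => by simp [map_prod]⟩
  refine (MvPolynomial.totalDegree_finsetProd _ _).trans (Finset.sum_le_sum fun i _ => ?_)
  refine (MvPolynomial.totalDegree_pow _ _).trans ?_
  simp

/-- substitution by linear forms -/
lemma IsPoly.subst {κ : Type} {d : ℕ} {F : (κ → ℕ) → ℚ} (h : IsPoly d F) (f : κ → ι) :
    IsPoly d (fun μ : ι → ℕ => F (μ ∘ f)) := by
  obtain ⟨P, h1, h2⟩ := h
  refine ⟨MvPolynomial.rename f P, (MvPolynomial.totalDegree_rename_le _ _).trans h1,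
    fun μ hμ => ?_⟩
  beta_reduce
  rw [h2 (μ ∘ f) (fun i => hμ _), MvPolynomial.eval_rename]
  rfl

/-- general summation operator -/
lemma isPoly_op {κ : Type} [Fintype κ] {α : Type*} (A : (ι → ℕ) → Finset α)
    (w : (ι → ℕ) → α → ℚ) (ρ : (ι → ℕ) → α → κ → ℕ) (d e : ℕ) (H : (κ → ℕ) → ℚ)
    (hH : IsPoly d H) (hρ : ∀ μ, (∀ i, 1 ≤ μ i) → ∀ a ∈ A μ, ∀ i, 1 ≤ ρ μ a i)
    (h : ∀ m : κ → ℕ, IsPoly ((∑ i, m i) + e)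
      (fun μ => ∑ a ∈ A μ, w μ a * ∏ i, (ρ μ a i : ℚ) ^ m i)) :
    IsPoly (d + e) (fun μ => ∑ a ∈ A μ, w μ a * H (ρ μ a)) := by
  obtain ⟨P, h1, h2⟩ := hH
  have key : IsPoly (d + e) (fun μ => ∑ m ∈ P.support, P.coeff m *
      ∑ a ∈ A μ, w μ a * ∏ i, (ρ μ a i : ℚ) ^ m i) := by
    refine isPoly_sum _ _ fun m hm => IsPoly.cmul _ ((h m).mono ?_)
    have := MvPolynomial.le_totalDegree hm
    rw [Finsupp.sum_fintype _ _ (fun _ => rfl)] at this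
    omega
  refine key.congr fun μ hμ => ?_
  simp only [Finset.mul_sum]
  rw [Finset.sum_comm]
  refine Finset.sum_congr rfl fun a ha => ?_
  rw [h2 _ (hρ μ hμ a ha), MvPolynomial.eval_eq', Finset.mul_sum]
  refine Finset.sum_congr rfl fun m _ => by ring

end

def UP (d : ℕ) (f : ℕ → ℚ) : Prop := ∃ p : Polynomial ℚ, p.natDegree ≤ d ∧ ∀ n : ℕ, f n = p.eval (n : ℚ)

lemma UP.mono {d e f} (h : UP d f) (hde : d ≤ e) : UP e f := by
  obtain ⟨p, h1, h2⟩ := h; exact ⟨p, h1.trans hde, h2⟩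
lemma UP.congr {d f g} (h : UP d f) (hfg : ∀ n, g n = f n) : UP d g := by
  obtain ⟨p, h1, h2⟩ := h; exact ⟨p, h1, fun n => by rw [hfg, h2]⟩
lemma UP.add {d f g} (hf : UP d f) (hg : UP d g) : UP d (fun n => f n + g n) := by
  obtain ⟨p, h1, h2⟩ := hf
  obtain ⟨q, h3, h4⟩ := hg
  exact ⟨p + q, (Polynomial.natDegree_add_le _ _).trans (max_le h1 h3), fun n => by simp [h2, h4]⟩
lemma UP.mul {d e f g} (hf : UP d f) (hg : UP e g) : UP (d + e) (fun n => f n * g n) := by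
  obtain ⟨p, h1, h2⟩ := hf
  obtain ⟨q, h3, h4⟩ := hg
  exact ⟨p * q, Polynomial.natDegree_mul_le.trans (add_le_add h1 h3), fun n => by simp [h2, h4]⟩
lemma up_const {d} (c : ℚ) : UP d (fun _ => c) := ⟨Polynomial.C c, by simp, fun n => by simp⟩
lemma up_pow (k : ℕ) : UP k (fun n => (n : ℚ) ^ k) := ⟨Polynomial.X ^ k, by simp, fun n => by simp⟩
lemma UP.cmul {d f} (c : ℚ) (h : UP d f) : UP d (fun n => c * f n) := by
  have := (up_const (d := 0) c).mul h
  rwa [zero_add] at this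
lemma up_sum {α : Type*} {d} (s : Finset α) (f : α → ℕ → ℚ) (h : ∀ a ∈ s, UP d (f a)) :
    UP d (fun n => ∑ a ∈ s, f a n) := by
  classical
  induction s using Finset.induction_on with
  | empty => simpa using up_const (d := d) 0
  | insert a s ha ih =>
    simp only [Finset.sum_insert ha]
    exact (h a (by simp)).add (ih fun b hb => h b (by simp [hb]))

lemma UP.expand {d f} (h : UP d f) :
    ∃ c : ℕ → ℚ, ∀ n, f n = ∑ k ∈ range (d + 1), c k * (n : ℚ) ^ k := by
  obtain ⟨p, h1, h2⟩ := h
  exact ⟨p.coeff, fun n => by rw [h2, Polynomial.eval_eq_sum_range' (by omega : p.natDegree < d + 1)]⟩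

lemma up_sum_pow (k : ℕ) : UP (k + 1) (fun n => ∑ t ∈ range (n + 1), (t : ℚ) ^ k) := by
  have h : UP (k + 1) (fun n => ∑ t ∈ range n, (t : ℚ) ^ k) := by
    simp only [sum_range_pow]
    refine up_sum _ _ fun i hi => ?_
    refine ((up_pow (k + 1 - i)).cmul (bernoulli i * ((k + 1).choose i) / (k + 1))).congr (fun n => by ring) |>.mono (by omega)
  refine (h.add ((up_pow k).mono (by omega))).congr fun n => by rw [Finset.sum_range_succ]

lemma UP.sum {d f} (h : UP d f) : UP (d + 1) (fun n => ∑ t ∈ range (n + 1), f t) := by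
  obtain ⟨c, hc⟩ := h.expand
  have : UP (d + 1) (fun n => ∑ k ∈ range (d + 1), c k * ∑ t ∈ range (n + 1), (t : ℚ) ^ k) :=
    up_sum _ _ fun k hk => ((up_sum_pow k).cmul _).mono (by simp at hk; omega)
  refine this.congr fun n => ?_
  simp only [hc, Finset.mul_sum]
  rw [Finset.sum_comm]

lemma up_conv_pow (j k : ℕ) : UP (j + k + 1)
    (fun n => ∑ ab ∈ antidiagonal n, (ab.1 : ℚ) ^ j * (ab.2 : ℚ) ^ k) := by
  have : UP (j + k + 1) (fun n => ∑ i ∈ range (k + 1), ((k.choose i : ℚ) * (-1) ^ (k - i)) *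
      ((n : ℚ) ^ i * ∑ t ∈ range (n + 1), (t : ℚ) ^ (j + (k - i)))) :=
    up_sum _ _ fun i hi => by
      simp at hi
      exact (((up_pow i).mul (up_sum_pow _)).cmul _).mono (by omega)
  refine this.congr fun n => ?_
  rw [Finset.Nat.sum_antidiagonal_eq_sum_range_succ_mk]
  simp only [Finset.mul_sum]
  rw [Finset.sum_comm]
  refine Finset.sum_congr rfl fun t ht => ?_
  have ht' : t ≤ n := by simp at ht; omega
  simp only [Nat.cast_sub ht']
  rw [sub_eq_add_neg, add_pow, Finset.mul_sum]
  refine Finset.sum_congr rfl fun i _ => ?_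
  rw [neg_pow (t : ℚ), pow_add]; ring

lemma UP.conv {d e f g} (hf : UP d f) (hg : UP e g) : UP (d + e + 1)
    (fun n => ∑ ab ∈ antidiagonal n, f ab.1 * g ab.2) := by
  obtain ⟨c, hc⟩ := hf.expand
  obtain ⟨c', hc'⟩ := hg.expand
  have : UP (d + e + 1) (fun n => ∑ j ∈ range (d + 1), ∑ k ∈ range (e + 1), (c j * c' k) *
      ∑ ab ∈ antidiagonal n, (ab.1 : ℚ) ^ j * (ab.2 : ℚ) ^ k) :=
    up_sum _ _ fun j hj => up_sum _ _ fun k hk => by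
      simp at hj hk
      exact ((up_conv_pow j k).cmul _).mono (by omega)
  refine this.congr fun n => ?_
  simp only [hc, hc', Finset.mul_sum, Finset.sum_mul]
  symm
  rw [Finset.sum_congr rfl (fun j _ => Finset.sum_comm), Finset.sum_comm]
  refine Finset.sum_congr rfl fun ab _ => ?_
  rw [Finset.sum_comm]
  exact Finset.sum_congr rfl fun i _ => Finset.sum_congr rfl fun j _ => by ring

lemma UP.isPoly {ι : Type} {d f} (h : UP d f) {G : (ι → ℕ) → ℕ} (hG : IsPoly 1 (fun μ => (G μ : ℚ))) :
    IsPoly d (fun μ => f (G μ)) := by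
  obtain ⟨c, hc⟩ := h.expand
  simp only [hc]
  refine isPoly_sum _ _ fun k hk => ((hG.pow k).cmul _).mono (by simp at hk; omega)

lemma up_Icc (k : ℕ) : UP (k + 1) (fun n => ∑ t ∈ Icc 1 n, (t : ℚ) ^ k) := by
  refine ((up_sum_pow k).add (up_const (- (0:ℚ) ^ k))).congr fun n => ?_
  rw [Finset.sum_range_succ', Finset.range_eq_Ico, Finset.sum_Ico_add' (fun t : ℕ => (t : ℚ) ^ k)]
  simp
  rfl

end PH

namespace PH
open Finset Equiv
set_option linter.unusedSectionVars false

noncomputable def kp (g : ℕ) (M : Multiset ℕ) : ℚ := prM M * kk g M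
noncomputable def ksp (g : ℕ) (M : Multiset ℕ) : ℚ := prM M * ks g M

lemma ksp_zero {g M} (h : g = 0 ∧ M.card ≤ 2) : ksp g M = 0 := by simp [ksp, ks, h]
lemma ksp_eq {g M} (h : ¬ (g = 0 ∧ M.card ≤ 2)) : ksp g M = kp g M := by simp only [ksp, ks, kp, h, if_false]

lemma prM_conv (F G : Multiset ℕ → ℚ) (A : Multiset ℕ) : prM A * conv F G A =
    conv (fun B => prM B * F B) (fun B => prM B * G B) A := by
  unfold conv
  rw [← Multiset.sum_map_mul_left]
  congr 1
  refine Multiset.map_congr rfl fun p hp => ?_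
  rw [Multiset.mem_antidiagonal] at hp
  rw [← hp, prM_add]; ring

lemma prM_cut (g r s : ℕ) (A : Multiset ℕ) : prM A * ((r:ℚ) * s * cut ks g r s A) = cut ksp g r s A := by
  have h1 : ∀ (F G : Multiset ℕ → ℚ) (a b : ℚ), a * b * conv F G A = conv (fun B => a * F B) (fun B => b * G B) A := by
    intro F G a b
    unfold conv
    rw [← Multiset.sum_map_mul_left]
    congr 1
    refine Multiset.map_congr rfl fun p hp => by ring
  unfold cut
  rw [mul_add, mul_add, Finset.mul_sum, Finset.mul_sum]
  congr 1
  · cases g with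
    | zero => simp [gs]
    | succ g => simp only [gs, ksp, prM_cons]; ring
  · refine Finset.sum_congr rfl fun gg _ => ?_
    rw [h1, prM_conv]
    refine conv_congr fun B C _ => ?_
    simp only [ksp, prM_cons]; ring

lemma sum_Icc_eq (a : ℕ) (f : ℕ → ℚ) (h : f 0 = 0) : ∑ r ∈ range (a+1), f r = ∑ r ∈ Icc 1 a, f r := by
  rw [Finset.sum_range_succ', h, add_zero, Finset.range_eq_Ico, Finset.sum_Ico_add' f]
  rfl

lemma prM_dM (G : ℕ → Multiset ℕ → ℚ) (M : Multiset ℕ) : prM M * dM G M = dM (fun n A => prM (n ::ₘ A) * G n A) M := by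
  rw [← dM_mul]
  exact dM_congr fun x A h => by rw [h]

theorem Rk (g : ℕ) (M : Multiset ℕ) (hM : ∀ x ∈ M, 1 ≤ x) (h : ¬(g=0 ∧ M.card ≤ 3)) (h' : ¬(g=1 ∧ M.card ≤ 1)) :
    2*((((2*g+M.sum+M.card:ℕ):ℚ)-2)*kp g M) =
    dM (fun n A => (n:ℚ) * ∑ ab ∈ antidiagonal n, ∑ r ∈ Icc 1 ab.1, ∑ s ∈ Icc 1 ab.2, cut ksp g r s A) M +
    dM (fun n A => dM (fun n' B => (n:ℚ) * n' * ∑ m ∈ range (n+n'+1), ∑ s ∈ Icc 1 m, kp g (s ::ₘ B)) A) M := by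
  have := Rfin g M hM h h'
  have e : 2*((((2*g+M.sum+M.card:ℕ):ℚ)-2)*kp g M) = prM M * (2*((((2*g+M.sum+M.card:ℕ):ℚ)-2)*kk g M)) := by
    unfold kp; ring
  rw [e, this, mul_add, prM_dM, prM_dM]
  congr 1
  · refine dM_congr fun n A _ => ?_
    rw [prM_cons, mul_assoc]
    congr 1
    unfold cs
    rw [Finset.mul_sum]
    refine Finset.sum_congr rfl fun ab _ => ?_
    rw [sum_Icc_eq _ _ (by simp), Finset.mul_sum]
    refine Finset.sum_congr rfl fun r _ => ?_
    rw [sum_Icc_eq _ _ (by simp), Finset.mul_sum]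
    exact Finset.sum_congr rfl fun s _ => prM_cut _ _ _ _
  · refine dM_congr fun n A _ => ?_
    rw [prM_cons, mul_assoc, prM_dM, ← dM_mul]
    refine dM_congr fun n' B _ => ?_
    rw [prM_cons, Finset.mul_sum, Finset.mul_sum, Finset.mul_sum]
    refine Finset.sum_congr rfl fun m _ => ?_
    unfold dk
    rw [sum_Icc_eq _ _ (by simp), Finset.mul_sum, Finset.mul_sum, Finset.mul_sum]
    refine Finset.sum_congr rfl fun s _ => ?_
    rw [kp, prM_cons]; ring

section
variable {ι : Type} {d e : ℕ}

lemma isPoly_dM (T : Multiset ι) (G : (ι → ℕ) → ℕ → Multiset ℕ → ℚ)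
    (h : ∀ i T', i ::ₘ T' = T → IsPoly d (fun μ => G μ (μ i) (T'.map μ))) :
    IsPoly d (fun μ => dM (G μ) (T.map μ)) := by
  induction T using Multiset.induction_on generalizing G with
  | empty => simpa [dM] using isPoly_const (ι := ι) (d := d) 0
  | cons i T ih =>
    simp only [Multiset.map_cons, dM_cons]
    refine (h i T rfl).add (ih (fun μ x A => G μ x (μ i ::ₘ A)) fun j T' hj => ?_)
    have := h j (i ::ₘ T') (by rw [Multiset.cons_swap, hj])
    simpa only [Multiset.map_cons] using this

lemma isPoly_conv (T : Multiset ι) (F G : (ι → ℕ) → Multiset ℕ → ℚ)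
    (h : ∀ T1 T2, T1 + T2 = T → IsPoly d (fun μ => F μ (T1.map μ) * G μ (T2.map μ))) :
    IsPoly d (fun μ => conv (F μ) (G μ) (T.map μ)) := by
  induction T using Multiset.induction_on generalizing F G with
  | empty =>
    have := h 0 0 (by simp)
    simpa only [Multiset.map_zero, conv_zero] using this
  | cons i T ih =>
    simp only [Multiset.map_cons, conv_cons]
    refine (ih F (fun μ B => G μ (μ i ::ₘ B)) fun T1 T2 hj => ?_).add
      (ih (fun μ B => F μ (μ i ::ₘ B)) G fun T1 T2 hj => ?_)
    · have := h T1 (i ::ₘ T2) (by rw [← hj, Multiset.add_cons])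
      simpa only [Multiset.map_cons] using this
    · have := h (i ::ₘ T1) T2 (by rw [← hj, Multiset.cons_add])
      simpa only [Multiset.map_cons] using this

def Pol (g n : ℕ) : Prop := IsPoly (ι := Fin n) (6*g+3*n-6) (fun μ => kp g (univ.val.map μ))

lemma Pol.gen {g n} (h : Pol g n) (T : Multiset ι) (hT : T.card = n) :
    IsPoly (6*g+3*n-6) (fun μ => kp g (T.map μ)) := by
  induction T using Quotient.inductionOn with
  | h l =>
    have hl : l.length = n := by simpa using hT
    subst hl
    refine (IsPoly.subst h l.get).congr fun μ _ => ?_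
    congr 1
    rw [Fin.univ_val_map, ← List.map_ofFn, List.ofFn_get]
    rfl

lemma isPoly_cut (g : ℕ) (T : Multiset ι) (p q : ι)
    (IH : ∀ g' n', 2*g'+n' < 2*g+(T.card+1) → 2 < 2*g'+n' → 1 ≤ n' → Pol g' n') :
    IsPoly (6*g+3*T.card-6) (fun μ => cut ksp g (μ p) (μ q) (T.map μ)) := by
  unfold cut
  refine IsPoly.add ?_ (isPoly_sum _ _ fun gg hgg => isPoly_conv T (fun μ B => ksp gg.1 (μ p ::ₘ B))
    (fun μ B => ksp gg.2 (μ q ::ₘ B)) fun T1 T2 hT => ?_)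
  · cases g with
    | zero => exact isPoly_const 0
    | succ g =>
      simp only [gs, ← Multiset.map_cons]
      by_cases h : g = 0 ∧ T.card = 0
      · refine (isPoly_const 0).congr fun μ _ => ksp_zero ?_
        simp [h.1, h.2]
      · refine ((IH g (T.card+2) (by omega) (by omega) (by omega)).gen (p ::ₘ q ::ₘ T) (by simp)).congr
          (fun μ _ => ksp_eq ?_) |>.mono (by omega)
        simp only [Multiset.card_map, Multiset.card_cons]; omega
  · rw [HasAntidiagonal.mem_antidiagonal] at hgg
    have hc : T1.card + T2.card = T.card := by rw [← hT, Multiset.card_add]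
    by_cases h1 : gg.1 = 0 ∧ T1.card ≤ 1
    · refine (isPoly_const 0).congr fun μ _ => ?_
      rw [ksp_zero (by simp; omega), zero_mul]
    by_cases h2 : gg.2 = 0 ∧ T2.card ≤ 1
    · refine (isPoly_const 0).congr fun μ _ => ?_
      rw [ksp_zero (g := gg.2) (by simp; omega), mul_zero]
    simp only [← Multiset.map_cons]
    refine (((IH gg.1 (T1.card+1) (by omega) (by omega) (by omega)).gen (p ::ₘ T1) (by simp)).mul
      ((IH gg.2 (T2.card+1) (by omega) (by omega) (by omega)).gen (q ::ₘ T2) (by simp))).congr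
          (fun μ _ => ?_) |>.mono (by omega)
    rw [ksp_eq (by simp; omega), ksp_eq (by simp; omega)]

lemma isPoly_t1 [Fintype ι] (i : ι) (H : (Option (Option ι) → ℕ) → ℚ) (hH : IsPoly d H) :
    IsPoly (d + 3) (fun μ : ι → ℕ => ∑ ab ∈ antidiagonal (μ i), ∑ r ∈ Icc 1 ab.1, ∑ s ∈ Icc 1 ab.2,
      H (fun o => o.elim r (fun o' => o'.elim s μ))) := by
  classical
  have := isPoly_op (ι := ι) (κ := Option (Option ι))
    (A := fun μ => (antidiagonal (μ i)).sigma (fun ab => Icc 1 ab.1 ×ˢ Icc 1 ab.2))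
    (w := fun _ _ => 1) (ρ := fun μ a o => o.elim a.2.1 (fun o' => o'.elim a.2.2 μ)) d 3 H hH
    (by
      intro μ hμ a ha o
      simp only [mem_sigma, mem_product, mem_Icc] at ha
      rcases o with _ | _ | o
      · exact ha.2.1.1
      · exact ha.2.2.1
      · exact hμ o)
    (by
      intro m
      have h1 := ((up_Icc (m none)).conv (up_Icc (m (some none)))).isPoly (isPoly_var i)
      have h2 := isPoly_prod_pow (fun j => m (some (some j)))
      refine ((h1.mul h2).mono ?_).congr fun μ _ => ?_
      · simp only [Fintype.sum_option]; omega
      · simp only [Finset.sum_sigma, Finset.sum_product, Fintype.prod_option, Option.elim, one_mul]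
        rw [Finset.sum_mul]
        refine Finset.sum_congr rfl fun ab _ => ?_
        rw [Finset.sum_mul_sum, Finset.sum_mul]
        refine Finset.sum_congr rfl fun r _ => ?_
        rw [Finset.sum_mul]
        refine Finset.sum_congr rfl fun s _ => by ring)
  refine this.congr fun μ _ => ?_
  simp only [Finset.sum_sigma, Finset.sum_product, one_mul]

lemma isPoly_t2 [Fintype ι] (i j : ι) (H : (Option ι → ℕ) → ℚ) (hH : IsPoly d H) :
    IsPoly (d + 2) (fun μ : ι → ℕ => ∑ m ∈ range (μ i + μ j + 1), ∑ s ∈ Icc 1 m,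
      H (fun o => o.elim s μ)) := by
  classical
  have := isPoly_op (ι := ι) (κ := Option ι)
    (A := fun μ => (range (μ i + μ j + 1)).sigma (fun m => Icc 1 m))
    (w := fun _ _ => 1) (ρ := fun μ a o => o.elim a.2 μ) d 2 H hH
    (by
      intro μ hμ a ha o
      simp only [mem_sigma, mem_Icc] at ha
      rcases o with _ | o
      · exact ha.2.1
      · exact hμ o)
    (by
      intro m
      have h1 := (up_Icc (m none)).sum.isPoly (G := fun μ => μ i + μ j)
        (((isPoly_var i).add (isPoly_var j)).congr fun μ _ => by push_cast; ring)
      have h2 := isPoly_prod_pow (fun j => m (some j))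
      refine ((h1.mul h2).mono ?_).congr fun μ _ => ?_
      · simp only [Fintype.sum_option]; omega
      · simp only [Finset.sum_sigma, Fintype.prod_option, Option.elim, one_mul]
        rw [Finset.sum_mul]
        refine Finset.sum_congr rfl fun ab _ => ?_
        rw [Finset.sum_mul])
  refine this.congr fun μ _ => ?_
  simp only [Finset.sum_sigma, one_mul]

theorem isPoly_R (g n : ℕ) (hn : 1 ≤ n) (h : ¬(g=0 ∧ n ≤ 3)) (h' : ¬(g=1 ∧ n ≤ 1))
    (IH : ∀ g' n', 2*g'+n' < 2*g+n → 2 < 2*g'+n' → 1 ≤ n' → Pol g' n') :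
    IsPoly (ι := Fin n) (6*g+3*n-5) (fun μ => (((2*g+(∑ i, μ i)+n:ℕ):ℚ)-2) * kp g (univ.val.map μ)) := by
  have key : IsPoly (ι := Fin n) (6*g+3*n-5) (fun μ =>
    dM (fun n A => (n:ℚ) * ∑ ab ∈ antidiagonal n, ∑ r ∈ Icc 1 ab.1, ∑ s ∈ Icc 1 ab.2, cut ksp g r s A) (univ.val.map μ) +
    dM (fun n A => dM (fun n' B => (n:ℚ) * n' * ∑ m ∈ range (n+n'+1), ∑ s ∈ Icc 1 m, kp g (s ::ₘ B)) A) (univ.val.map μ)) := by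
    refine (isPoly_dM _ _ fun i T hT => ?_).add (isPoly_dM _ (fun _ n A => dM (fun n' B => (n:ℚ) * n' * ∑ m ∈ range (n+n'+1), ∑ s ∈ Icc 1 m, kp g (s ::ₘ B)) A) fun i T hT => ?_)
    · have hc : T.card + 1 = n := by
        have := congrArg Multiset.card hT
        simpa using this
      have h1 := isPoly_cut (ι := Option (Option (Fin n))) g (T.map fun i => some (some i)) none (some none)
        (by simpa [hc] using IH)
      have h2 := (isPoly_var i).mul (isPoly_t1 i _ h1)
      refine (h2.mono ?_).congr fun μ _ => ?_
      · simp; omega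
      · simp [Multiset.map_map, Function.comp_def]
    · refine isPoly_dM T (fun μ n' B => (μ i:ℚ) * n' * ∑ m ∈ range (μ i+n'+1), ∑ s ∈ Icc 1 m, kp g (s ::ₘ B)) fun j T' hT' => ?_
      have hc : T'.card + 2 = n := by
        have := congrArg Multiset.card hT
        rw [← hT'] at this
        simpa using this
      have h1 := (IH g (n-1) (by omega) (by omega) (by omega)).gen (ι := Option (Fin n))
        (none ::ₘ T'.map some) (by simp; omega)
      have h2 := ((isPoly_var i).mul (isPoly_var j)).mul (isPoly_t2 i j _ h1)
      refine (h2.mono ?_).congr fun μ _ => ?_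
      · omega
      · simp [Multiset.map_map, Function.comp_def]
  refine (key.cmul (1/2)).congr fun μ hμ => ?_
  rw [← Rk g _ (by simpa using hμ) (by simpa using h) (by simpa using h')]
  have : (univ.val.map μ).sum = ∑ i, μ i := rfl
  rw [this]
  simp only [Multiset.card_map, Finset.card_val, Finset.card_univ, Fintype.card_fin]
  ring

lemma pol_03 : Pol 0 3 := by
  refine (isPoly_prod_pow (ι := Fin 3) (fun _ => 1)).congr (fun μ hμ => ?_) |>.mono (by simp)
  have : (univ.val.map μ) = μ 0 ::ₘ μ 1 ::ₘ μ 2 ::ₘ 0 := by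
    rw [Fin.univ_val_map]; rfl
  rw [this, kp, k03 _ _ _ (hμ 0) (hμ 1) (hμ 2), Fin.prod_univ_three]
  simp [prM]; ring

lemma pol_11 : Pol 1 1 := by
  have h0 := isPoly_var (0 : Fin 1)
  have h := ((h0.mul ((h0.add (isPoly_const (-1))).mul (h0.add (isPoly_const 2)))).cmul (1/48))
  refine (h.mono (by norm_num)).congr (fun μ hμ => ?_)
  have : (univ.val.map μ) = μ 0 ::ₘ 0 := by
    rw [Fin.univ_val_map]; rfl
  rw [this, kp, k11 _ (hμ 0)]
  simp [prM]; ring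
end
end PH

namespace PH
open Finset Equiv
set_option linter.unusedSectionVars false

variable {X : Type} [Fintype X] [DecidableEq X]

open Classical in
noncomputable def KN (m : ℕ) (T : Perm X) : ℕ :=
  (univ.filter fun σ : Fin m → Sw X => pr (List.ofFn σ) = T ∧ Conn (List.ofFn σ) ∧ ∀ x, 2 ≤ deg (List.ofFn σ) x).card

theorem Kraw_KN (m : ℕ) (T : Perm X) : Kraw m T = KN m T := by
  classical
  unfold Kraw KN
  rw [S_ofFn, Finset.card_filter]
  push_cast
  exact Finset.sum_congr rfl fun σ _ => by simp only [ind]; congr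

theorem Ty_conj {T T' : Perm X} (h : IsConj T T') : Ty T' = Ty T := by
  refine multiset_eq_of (Ty_pos _) (Ty_pos _) (by rw [Ty_sum, Ty_sum]) ?_
  rw [← cycleType_eq, ← cycleType_eq]
  exact (Equiv.Perm.isConj_iff_cycleType_eq.1 h).symm

theorem card_conj_dvd (T : Perm X) : Nat.card {T' : Perm X // IsConj T T'} ∣ (Fintype.card X).factorial := by
  classical
  have h := MulAction.card_orbit_mul_card_stabilizer_eq_card_group (ConjAct (Perm X)) T
  have e : Nat.card {T' : Perm X // IsConj T T'} = Fintype.card (MulAction.orbit (ConjAct (Perm X)) T) := by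
    rw [← Nat.card_eq_fintype_card]
    refine Nat.card_congr (Equiv.subtypeEquivRight fun T' => ?_)
    rw [ConjAct.mem_orbit_conjAct, isConj_comm]
  rw [e, ← Fintype.card_perm]
  exact Dvd.intro _ (h.trans rfl)

theorem ofFn_rot {α : Type} (q : ℕ) (σ : Fin (q+1) → α) :
    List.ofFn (σ ∘ finRotate (q+1)) = List.ofFn (fun i : Fin q => σ i.succ) ++ [σ 0] := by
  rw [List.ofFn_succ', List.concat_eq_append]
  congr 2
  · ext i
    simp
  · simp

theorem modEq_card0 {α : Type} (i : Fintype α) (p : ℕ) (h : IsEmpty α) : @Fintype.card α i ≡ 0 [MOD p] := by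
  rw [Fintype.card_eq_zero]

theorem p_dvd (p : ℕ) (hp : p.Prime) (T : Perm X) (h3 : 3 ≤ Fintype.card X) (hc : Fintype.card X < p)
    (hT : ∀ T', IsConj T T' → KN p T' = KN p T) : p ∣ KN p T := by
  classical
  have := Fact.mk hp
  obtain ⟨q, rfl⟩ : ∃ q, p = q + 1 := ⟨p - 1, by have := hp.pos; omega⟩
  let Pd : (Fin (q+1) → Sw X) → Prop := fun σ => IsConj T (pr (List.ofFn σ)) ∧ Conn (List.ofFn σ) ∧ ∀ x, 2 ≤ deg (List.ofFn σ) x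
  have hrot : ∀ σ, Pd σ → Pd (σ ∘ finRotate (q+1)) := by
    intro σ ⟨h1, h2, h3⟩
    have hP : (List.ofFn (σ ∘ finRotate (q+1))).Perm (List.ofFn σ) := by
      rw [ofFn_rot, List.ofFn_succ (f := σ)]
      exact List.perm_append_singleton _ _
    refine ⟨?_, (conn_perm fun τ => hP.mem_iff).2 h2, fun x => ?_⟩
    · refine h1.trans ?_
      rw [ofFn_rot, List.ofFn_succ (f := σ)]
      simp only [pr, List.map_cons, List.prod_cons, List.map_append, List.prod_append, List.map_nil, List.prod_nil, mul_one]
      rw [isConj_iff]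
      exact ⟨(σ 0).1⁻¹, by group⟩
    · have := h3 x
      unfold deg at this ⊢
      rwa [hP.countP_eq]
  let f : Function.End {σ // Pd σ} := fun σ => ⟨σ.1 ∘ finRotate (q+1), hrot _ σ.2⟩
  have hpow : ∀ k (σ : {σ // Pd σ}), ((f ^ k) σ).1 = σ.1 ∘ ((finRotate (q+1))^k : Perm _) := by
    intro k
    induction k with
    | zero => intro σ; rfl
    | succ k ih =>
      intro σ
      rw [pow_succ', pow_succ]
      change ((f ^ k) σ).1 ∘ _ = _
      rw [ih]
      funext i
      simp only [Function.comp, ← Perm.mul_apply, ← pow_succ]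
  have hf : f ^ (q+1)^1 = 1 := by
    funext σ
    apply Subtype.ext
    rw [hpow, pow_one]
    have hq : 1 ≤ q := by have := hp.two_le; omega
    obtain ⟨q', rfl⟩ : ∃ q', q = q' + 1 := ⟨q - 1, by omega⟩
    have : (finRotate (q'+1+1))^(q'+1+1) = 1 := by
      have h := (isCycle_finRotate (n := q')).orderOf
      rw [support_finRotate, Finset.card_univ, Fintype.card_fin] at h
      have h' := pow_orderOf_eq_one (finRotate (q'+2))
      rw [h] at h'
      exact h'
    rw [this]; rfl
  have hmod := Equiv.Perm.card_fixedPoints_modEq hf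
  have hfix : IsEmpty f.fixedPoints := by
    refine ⟨fun ⟨⟨σ, hσ⟩, hs⟩ => ?_⟩
    have hs' : σ ∘ finRotate (q+1) = σ := congrArg Subtype.val hs
    have hconst : ∀ i, σ i = σ 0 := by
      intro i
      induction i using Fin.induction with
      | zero => rfl
      | succ i ih =>
        have := congrFun hs' i.castSucc
        simp only [Function.comp, finRotate_apply, Fin.coeSucc_eq_succ] at this
        rw [this, ih]
    obtain ⟨⟨x⟩, hC⟩ := hσ.2.1
    have := hC {x, (σ 0).1 x} (by simp) (by simp) (by
      intro τ hτ y hy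
      obtain ⟨i, rfl⟩ := (List.mem_ofFn' _ _).1 hτ
      rw [hconst i]
      have hsq : (σ 0).1 ((σ 0).1 x) = x := by
        obtain ⟨a, b, _, hab⟩ := (σ 0).2
        rw [hab]; simp
      simp only [mem_insert, mem_singleton] at hy ⊢
      rcases hy with rfl | rfl
      · right; rfl
      · left; exact hsq)
    have h2 : (univ : Finset X).card ≤ 2 := this ▸ Finset.card_le_two
    rw [Finset.card_univ] at h2
    omega
  have hd : (q+1) ∣ Fintype.card {σ // Pd σ} := (Nat.modEq_zero_iff_dvd).1 (hmod.trans (modEq_card0 _ _ hfix))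
  have hcard : Fintype.card {σ // Pd σ} = Nat.card {T' : Perm X // IsConj T T'} * KN (q+1) T := by
    rw [Fintype.card_subtype, Finset.card_eq_sum_card_fiberwise (f := fun σ => pr (List.ofFn σ))
      (t := univ.filter fun T' => IsConj T T') (by
        intro σ hσ
        simp only [coe_filter, mem_univ, true_and, Set.mem_ofPred_eq] at hσ ⊢
        exact hσ.1)]
    rw [Nat.card_eq_fintype_card, Fintype.card_subtype, ← smul_eq_mul, ← Finset.sum_const]
    refine Finset.sum_congr rfl fun T' hT' => ?_
    simp only [mem_filter, mem_univ, true_and] at hT'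
    rw [← hT T' hT']
    unfold KN
    rw [Finset.filter_filter]
    congr 1
    ext σ
    simp only [mem_filter, mem_univ, true_and, Pd]
    constructor
    · rintro ⟨⟨_, h⟩, rfl⟩; exact ⟨rfl, h⟩
    · rintro ⟨rfl, h⟩; exact ⟨⟨hT', h⟩, rfl⟩
  rw [hcard] at hd
  refine (hp.dvd_mul.1 hd).resolve_left fun h => ?_
  have := (hp.dvd_factorial).1 (h.trans (card_conj_dvd T))
  omega

theorem KN_eq (T : Perm X) (m g : ℕ) (hm : m + 2 = 2 * g + (Ty T).sum + (Ty T).card)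
    (hg : 2 ≤ 2 * g + (Ty T).card) (hm0 : m ≠ 0) :
    (KN m T : ℚ) = m.factorial * kp g (Ty T) := by
  rw [← Kraw_KN, Kraw_eq T m g hm hg hm0, kp, kk, bt]; ring

theorem kp_dvd (g p : ℕ) (hp : p.Prime) (M : Multiset ℕ) (hM : ∀ x ∈ M, 1 ≤ x)
    (hm : p + 2 = 2 * g + M.sum + M.card) (hg : 2 < 2 * g + M.card) (h3 : 3 ≤ M.sum) :
    ∃ k : ℕ, p ∣ k ∧ (k : ℚ) = p.factorial * kp g M := by
  obtain ⟨T, hT⟩ := exists_Ty M hM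
  have key : ∀ T', IsConj T T' → (KN p T' : ℚ) = p.factorial * kp g M := by
    intro T' h
    have := Ty_conj h
    rw [KN_eq T' p g (by rw [this, hT, hm]) (by rw [this, hT]; omega) hp.ne_zero, this, hT]
  refine ⟨KN p T, p_dvd p hp T (by simpa using h3) (by simp; omega) (fun T' h => ?_), key T (IsConj.refl _)⟩
  have : (KN p T' : ℚ) = KN p T := by rw [key T' h, key T (IsConj.refl _)]
  exact_mod_cast this

theorem kp_nonneg (g : ℕ) (M : Multiset ℕ) (hM : ∀ x ∈ M, 1 ≤ x) (hg : 2 < 2 * g + M.card) : 0 ≤ kp g M := by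
  obtain ⟨T, hT⟩ := exists_Ty M hM
  have := KN_eq T (2 * g + M.sum + M.card - 2) g (by rw [hT]; omega) (by rw [hT]; omega) (by
    have : M.card ≤ M.sum := by
      have := Multiset.card_nsmul_le_sum (s := M) (a := 1) hM
      simpa using this
    omega)
  rw [hT] at this
  have h2 : (0:ℚ) < (2 * g + M.sum + M.card - 2).factorial := by positivity
  by_contra h
  push Not at h
  have h3 := mul_neg_of_pos_of_neg h2 h
  rw [← this] at h3
  exact absurd h3 (not_lt.2 (Nat.cast_nonneg _))

end PH

namespace PH
open Finset Equiv
set_option linter.unusedSectionVars false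

/-- if values at `p - c` are `p * k / p!` -like, then `-c` is a root. -/
theorem root_of_primes (r : Polynomial ℚ) (c : ℕ)
    (h : ∀ p : ℕ, p.Prime → c + 3 ≤ p → ∃ k : ℕ, p ∣ k ∧ (k : ℚ) = (p-1).factorial * r.eval ((p:ℚ) - c)) :
    r.eval (-(c:ℚ)) = 0 := by
  obtain ⟨b, hb, hq⟩ := IsLocalization.integerNormalization_spec (nonZeroDivisors ℤ) r
  set q := IsLocalization.integerNormalization (nonZeroDivisors ℤ) r with hqdef
  have hb0 : b ≠ 0 := nonZeroDivisors.ne_zero hb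
  have hev : ∀ y : ℤ, ((q.eval y : ℤ) : ℚ) = b * r.eval (y:ℚ) := by
    intro y
    have := congrArg (Polynomial.eval (y:ℚ)) hq
    rw [Polynomial.eval_smul] at this
    rw [zsmul_eq_mul] at this
    rw [← this]
    simp
  have hdvd : ∀ p : ℕ, p.Prime → c + 3 ≤ p → (p:ℤ) ∣ q.eval (-(c:ℤ)) := by
    intro p hp hcp
    obtain ⟨k, hk, hk'⟩ := h p hp hcp
    have e1 : ((p-1).factorial : ℤ) * q.eval ((p:ℤ) - c) = b * k := by
      have := hev ((p:ℤ) - c)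
      have h3 : (((p-1).factorial : ℤ) * q.eval ((p:ℤ) - c) : ℚ) = b * k := by
        rw [this, hk']; push_cast; ring
      exact_mod_cast h3
    have hpp : Prime (p:ℤ) := Nat.prime_iff_prime_int.1 hp
    have d1 : (p:ℤ) ∣ ((p-1).factorial : ℤ) * q.eval ((p:ℤ) - c) := by
      rw [e1]; exact Dvd.dvd.mul_left (by exact_mod_cast hk) _
    have d2 : (p:ℤ) ∣ q.eval ((p:ℤ) - c) := by
      refine (hpp.dvd_or_dvd d1).resolve_left fun h => ?_
      have h' : p ∣ (p-1).factorial := by exact_mod_cast h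
      have := hp.dvd_factorial.1 h'
      have := hp.pos
      omega
    have d3 := Polynomial.sub_dvd_eval_sub ((p:ℤ) - c) (-(c:ℤ)) q
    have e4 : (p:ℤ) - c - -(c:ℤ) = p := by ring
    rw [e4] at d3
    exact (dvd_sub_right d2).1 d3
  have hz : q.eval (-(c:ℤ)) = 0 := by
    by_contra hne
    obtain ⟨p, hp, hpp⟩ := Nat.exists_infinite_primes (c + 3 + (q.eval (-(c:ℤ))).natAbs + 1)
    have := Int.natAbs_dvd_natAbs.2 (hdvd p hpp (by omega))
    have := Nat.le_of_dvd (Int.natAbs_pos.2 hne) this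
    simp at this
    omega
  have := hev (-(c:ℤ))
  rw [hz] at this
  push_cast at this
  have hb' : (b:ℚ) ≠ 0 := by exact_mod_cast hb0
  exact (mul_eq_zero.1 this.symm).resolve_left hb'

open MvPolynomial in
theorem Pol_of_R (g n : ℕ) (hgn : 2 < 2*g+(n+1))
    (hR : IsPoly (ι := Fin (n+1)) (6*g+3*(n+1)-5) (fun μ => (((2*g+(∑ i, μ i)+(n+1):ℕ):ℚ)-2) * kp g (univ.val.map μ))) :
    Pol g (n+1) := by
  obtain ⟨P, hP1, hP2⟩ := hR
  set N : ℕ := 2*g+(n+1)-2 with hN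
  have hNq : ((N:ℕ):ℚ) = 2*g+n-1 := by
    have : N + 1 = 2*g + n := by omega
    have : ((N:ℚ) + 1) = 2*g+n := by exact_mod_cast this
    linarith
  let a : MvPolynomial (Fin n) ℚ := - (∑ i, MvPolynomial.X i + MvPolynomial.C (N:ℚ))
  have hroot : Polynomial.eval a (finSuccEquiv ℚ n P) = 0 := by
    refine MvPolynomial.funext_set (fun _ => Set.range (fun k : ℕ => ((k:ℚ)+1))) (fun _ => ?_) ?_
    · refine Set.infinite_range_of_injective fun x y h => ?_
      simpa using h
    intro x hx
    rw [map_zero, MvPolynomial.eval_polynomial_eval_finSuccEquiv]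
    have : ∀ i, ∃ k : ℕ, (k:ℚ) + 1 = x i := fun i => hx i trivial
    choose k hk using this
    set c : ℕ := N + ∑ i, (k i + 1) with hc
    have hx' : ∀ i, x i = ((k i + 1 : ℕ):ℚ) := fun i => by rw [← hk]; push_cast; rfl
    have ha : MvPolynomial.eval x a = -(c:ℚ) := by
      simp [a, hc, hx']; ring
    rw [ha]
    let r : Polynomial ℚ := MvPolynomial.aeval (Fin.cases Polynomial.X (fun i => Polynomial.C (x i)) : Fin (n+1) → Polynomial ℚ) P
    have hr : ∀ y : ℚ, r.eval y = MvPolynomial.eval (Fin.cases y x : Fin (n+1) → ℚ) P := by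
      intro y
      have h1 : r.eval y = (Polynomial.aeval y) r := by simp [Polynomial.aeval_def, Polynomial.eval₂_eq_eval_map]
      rw [h1]
      change (Polynomial.aeval y) ((MvPolynomial.aeval _) P) = _
      rw [← AlgHom.comp_apply, MvPolynomial.comp_aeval, MvPolynomial.aeval_def, MvPolynomial.eval₂_eq_eval_map]
      simp only [Algebra.algebraMap_self, MvPolynomial.map_id]
      congr 2
      funext i
      refine Fin.cases ?_ (fun i => ?_) i <;> simp
    rw [← hr]
    refine root_of_primes r c fun p hp hcp => ?_
    let μ : Fin (n+1) → ℕ := Fin.cons (p - c) (fun i => k i + 1)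
    have hμ : ∀ i, 1 ≤ μ i := by
      intro i
      refine Fin.cases ?_ (fun i => ?_) i
      · simp [μ]; omega
      · simp [μ]
    have hs : ∑ i, μ i = p - N := by
      rw [Fin.sum_univ_succ]; simp only [μ, Fin.cons_zero, Fin.cons_succ]; omega
    have hs' : (univ.val.map μ).sum = p - N := hs
    obtain ⟨kk', hd, hk'⟩ := kp_dvd g p hp (univ.val.map μ)
      (by intro x hx; obtain ⟨i, _, rfl⟩ := Multiset.mem_map.1 hx; exact hμ i)
      (by rw [hs']; simp; omega) (by simp; omega) (by rw [hs']; omega)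
    refine ⟨kk', hd, ?_⟩
    rw [hk', hr]
    have e := hP2 μ hμ
    beta_reduce at e
    have e2 : (fun i => (μ i : ℚ)) = (Fin.cases ((p:ℚ) - c) x : Fin (n+1) → ℚ) := by
      funext i
      refine Fin.cases ?_ (fun i => ?_) i
      · simp only [μ, Fin.cons_zero, Fin.cases_zero]
        rw [Nat.cast_sub (by omega)]
      · simp [μ, hx']
    rw [e2] at e
    rw [← e, hs]
    have e3 : (((2*g+(p-N)+(n+1):ℕ):ℚ)-2) = p := by
      have : 2*g+(p-N)+(n+1) = p + 2 := by omega
      rw [this]; push_cast; ring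
    rw [e3, ← Nat.mul_factorial_pred hp.ne_zero]
    push_cast; ring
  rw [← Polynomial.IsRoot.def, ← Polynomial.dvd_iff_isRoot] at hroot
  obtain ⟨Q', hQ'⟩ := hroot
  obtain ⟨Q, rfl⟩ := (finSuccEquiv ℚ n).surjective Q'
  let L : MvPolynomial (Fin (n+1)) ℚ := ∑ i, MvPolynomial.X i + MvPolynomial.C (N:ℚ)
  have hL : finSuccEquiv ℚ n L = Polynomial.X - Polynomial.C a := by
    simp only [L, a, map_add, map_sum, Fin.sum_univ_succ, finSuccEquiv_X_zero, finSuccEquiv_X_succ, map_neg]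
    have : finSuccEquiv ℚ n (MvPolynomial.C (N:ℚ)) = Polynomial.C (MvPolynomial.C (N:ℚ)) := by
      simp
    rw [this]; ring
  have hPL : P = L * Q := by
    apply (finSuccEquiv ℚ n).injective
    rw [hQ', map_mul, hL]
  have hevL : ∀ μ : Fin (n+1) → ℕ, MvPolynomial.eval (fun i => (μ i:ℚ)) L = (((2*g+(∑ i, μ i)+(n+1):ℕ):ℚ)-2) := by
    intro μ
    simp only [L, map_add, map_sum, MvPolynomial.eval_X, MvPolynomial.eval_C]
    rw [hNq]; push_cast; ring
  have hLd : 1 ≤ L.totalDegree := by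
    by_contra h
    have h0 : L.totalDegree = 0 := by omega
    rw [MvPolynomial.totalDegree_eq_zero_iff_eq_C] at h0
    have h1 := hevL (fun _ => 0)
    have h2 := hevL (fun _ => 1)
    rw [h0, MvPolynomial.eval_C] at h1 h2
    rw [h1] at h2
    simp at h2
    have : (n:ℚ) ≥ 0 := Nat.cast_nonneg _
    linarith
  refine ⟨Q, ?_, fun μ hμ => ?_⟩
  · by_cases hQ : Q = 0
    · simp [hQ]
    · have hL0 : L ≠ 0 := by rintro h; rw [h] at hLd; simp at hLd
      rw [hPL, MvPolynomial.totalDegree_mul_of_isDomain hL0 hQ] at hP1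
      omega
  · have := hP2 μ hμ
    rw [hPL, map_mul, hevL] at this
    refine mul_left_cancel₀ ?_ this
    have hsum : n + 1 ≤ ∑ i, μ i := by
      have := Finset.card_nsmul_le_sum univ μ 1 (fun i _ => hμ i)
      simpa using this
    have : (2:ℚ) < ((2*g+(∑ i, μ i)+(n+1):ℕ):ℚ) := by exact_mod_cast (by omega)
    linarith

theorem pol_all (s : ℕ) : ∀ g n, 2*g+n = s → 2 < 2*g+n → 1 ≤ n → Pol g n := by
  induction s using Nat.strong_induction_on with
  | _ s IH =>
    intro g n hs hgn hn
    by_cases h : g = 0 ∧ n ≤ 3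
    · obtain ⟨rfl, h⟩ := h
      obtain rfl : n = 3 := by omega
      exact pol_03
    by_cases h' : g = 1 ∧ n ≤ 1
    · obtain ⟨rfl, h'⟩ := h'
      obtain rfl : n = 1 := by omega
      exact pol_11
    obtain ⟨n, rfl⟩ : ∃ n', n = n' + 1 := ⟨n - 1, by omega⟩
    refine Pol_of_R g n hgn (isPoly_R g (n+1) hn h h' fun g' n' h1 h2 h3 => ?_)
    exact IH (2*g'+n') (by omega) g' n' rfl h2 h3

end PH

namespace PH
open Finset Equiv
set_option linter.unusedSectionVars false

lemma dM_nonneg {G : ℕ → Multiset ℕ → ℚ} {M : Multiset ℕ} (h : ∀ x A, x ::ₘ A = M → 0 ≤ G x A) : 0 ≤ dM G M := by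
  unfold dM
  refine Multiset.sum_nonneg fun y hy => ?_
  obtain ⟨x, hx, rfl⟩ := Multiset.mem_map.1 hy
  exact h x _ (Multiset.cons_erase hx)

lemma conv_nonneg {F G : Multiset ℕ → ℚ} {M : Multiset ℕ} (h : ∀ B C, B + C = M → 0 ≤ F B * G C) : 0 ≤ conv F G M := by
  unfold conv
  refine Multiset.sum_nonneg fun y hy => ?_
  obtain ⟨p, hp, rfl⟩ := Multiset.mem_map.1 hy
  exact h _ _ (Multiset.mem_antidiagonal.1 hp)

lemma ksp_nonneg (g : ℕ) (M : Multiset ℕ) (hM : ∀ x ∈ M, 1 ≤ x) (hc : 1 ≤ M.card) : 0 ≤ ksp g M := by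
  by_cases h : g = 0 ∧ M.card ≤ 2
  · rw [ksp_zero h]
  · rw [ksp_eq h]; exact kp_nonneg g M hM (by omega)

lemma conv_ksp_nonneg (g r s : ℕ) (A : Multiset ℕ) (hr : 1 ≤ r) (hs : 1 ≤ s) (hA : ∀ x ∈ A, 1 ≤ x) :
    0 ≤ ∑ gg ∈ antidiagonal g, conv (fun B => ksp gg.1 (r ::ₘ B)) (fun B => ksp gg.2 (s ::ₘ B)) A := by
  refine Finset.sum_nonneg fun gg _ => conv_nonneg fun B C h => mul_nonneg (ksp_nonneg _ _ ?_ (by simp)) (ksp_nonneg _ _ ?_ (by simp))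
  · intro x hx
    rcases Multiset.mem_cons.1 hx with rfl | hx
    · exact hr
    · exact hA x (by rw [← h]; exact Multiset.mem_add.2 (Or.inl hx))
  · intro x hx
    rcases Multiset.mem_cons.1 hx with rfl | hx
    · exact hs
    · exact hA x (by rw [← h]; exact Multiset.mem_add.2 (Or.inr hx))

lemma cut_nonneg (g r s : ℕ) (A : Multiset ℕ) (hr : 1 ≤ r) (hs : 1 ≤ s) (hA : ∀ x ∈ A, 1 ≤ x) : 0 ≤ cut ksp g r s A := by
  refine add_nonneg ?_ (conv_ksp_nonneg g r s A hr hs hA)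
  cases g with
  | zero => exact le_rfl
  | succ g =>
    refine ksp_nonneg _ _ ?_ (by simp)
    intro x hx
    simp only [Multiset.mem_cons] at hx
    rcases hx with rfl | rfl | hx
    · exact hr
    · exact hs
    · exact hA x hx

lemma t1_nonneg (g n : ℕ) (A : Multiset ℕ) (hA : ∀ x ∈ A, 1 ≤ x) :
    0 ≤ (n:ℚ) * ∑ ab ∈ antidiagonal n, ∑ r ∈ Icc 1 ab.1, ∑ s ∈ Icc 1 ab.2, cut ksp g r s A := by
  refine mul_nonneg (Nat.cast_nonneg _) (Finset.sum_nonneg fun ab _ => Finset.sum_nonneg fun r hr => Finset.sum_nonneg fun s hs => ?_)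
  exact cut_nonneg g r s A (mem_Icc.1 hr).1 (mem_Icc.1 hs).1 hA

lemma t2_nonneg (g n n' : ℕ) (B : Multiset ℕ) (hB : ∀ x ∈ B, 1 ≤ x) (hg : 2 < 2*g + (B.card + 1)) :
    0 ≤ (n:ℚ) * n' * ∑ m ∈ range (n+n'+1), ∑ s ∈ Icc 1 m, kp g (s ::ₘ B) := by
  refine mul_nonneg (by positivity) (Finset.sum_nonneg fun m _ => Finset.sum_nonneg fun s hs => ?_)
  refine kp_nonneg _ _ ?_ (by simpa using hg)
  intro x hx
  rcases Multiset.mem_cons.1 hx with rfl | hx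
  · exact (mem_Icc.1 hs).1
  · exact hB x hx

def LB (g n : ℕ) : Prop := ∀ A : ℕ, ∃ ε : ℚ, 0 < ε ∧ ∃ t0 : ℕ, ∀ t, t0 ≤ t → ∀ M : Multiset ℕ, M.card = n →
  (∀ x ∈ M, t ≤ x ∧ x ≤ A * t) → ε * (t:ℚ)^(6*g+3*n-6) ≤ kp g M

lemma lb_03 : LB 0 3 := by
  intro A
  refine ⟨1, one_pos, 1, fun t ht M hM hx => ?_⟩
  obtain ⟨a, b, c, rfl⟩ := Multiset.card_eq_three.1 hM
  have ha := (hx a (by simp)).1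
  have hb := (hx b (by simp)).1
  have hc := (hx c (by simp)).1
  have : ({a, b, c} : Multiset ℕ) = a ::ₘ b ::ₘ c ::ₘ 0 := rfl
  rw [this, kp, k03 _ _ _ (by omega) (by omega) (by omega)]
  simp [prM]
  have h : t * t * t ≤ a * b * c := Nat.mul_le_mul (Nat.mul_le_mul ha hb) hc
  have h' : (t:ℚ) * t * t ≤ a * b * c := by exact_mod_cast h
  nlinarith

lemma lb_11 : LB 1 1 := by
  intro A
  refine ⟨1/96, by norm_num, 2, fun t ht M hM hx => ?_⟩
  obtain ⟨a, rfl⟩ := Multiset.card_eq_one.1 hM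
  have ha := (hx a (by simp)).1
  have : ({a} : Multiset ℕ) = a ::ₘ 0 := rfl
  rw [this, kp, k11 _ (by omega)]
  simp [prM]
  have h1 : (t:ℚ) ≤ a := by exact_mod_cast ha
  have h2 : (2:ℚ) ≤ t := by exact_mod_cast ht
  have h3 : (t:ℚ)^3 ≤ (a:ℚ)^3 := pow_le_pow_left₀ (by linarith) h1 3
  norm_num
  have h4 : (0:ℚ) ≤ a * ((a-2) * a + (2 * a - 2)*2) := by
    have : (0:ℚ) ≤ a - 2 := by linarith
    have : (0:ℚ) ≤ 2 * a - 2 := by linarith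
    positivity
  nlinarith

lemma lb_join (g n : ℕ) (hn : 2 ≤ n) (h : ¬(g=0 ∧ n ≤ 3)) (IH : LB g (n-1)) : LB g n := by
  intro A
  obtain ⟨ε, hε, t0, H⟩ := IH (A + 2)
  set K : ℚ := 4 * (2 * g + n + n * A) with hK
  have hKpos : 0 < K := by
    have : (0:ℚ) < n := by exact_mod_cast (by omega)
    positivity
  refine ⟨ε / K, by positivity, t0 + 1, fun t ht M hM hx => ?_⟩
  have hx1 : ∀ x ∈ M, 1 ≤ x := fun x hx' => by have := (hx x hx').1; omega
  have hR := Rk g M hx1 (by rw [hM]; exact h) (by omega)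
  obtain ⟨x, A', rfl⟩ : ∃ x A', M = x ::ₘ A' := by
    obtain ⟨x, hx⟩ := Multiset.card_pos_iff_exists_mem.1 (by omega : 0 < M.card)
    exact ⟨x, _, (Multiset.cons_erase hx).symm⟩
  obtain ⟨y, B, rfl⟩ : ∃ y B, A' = y ::ₘ B := by
    simp at hM
    obtain ⟨x, hx⟩ := Multiset.card_pos_iff_exists_mem.1 (by omega : 0 < A'.card)
    exact ⟨x, _, (Multiset.cons_erase hx).symm⟩
  have hBc : B.card + 2 = n := by simpa using hM
  have hB : ∀ z ∈ B, t ≤ z ∧ z ≤ A * t := fun z hz => hx z (by simp [hz])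
  have hX := hx x (by simp)
  have hY := hx y (by simp)
  have n1 := dM_nonneg (G := fun n A => (n:ℚ) * ∑ ab ∈ antidiagonal n, ∑ r ∈ Icc 1 ab.1, ∑ s ∈ Icc 1 ab.2, cut ksp g r s A)
    (M := x ::ₘ y ::ₘ B) (fun z A hz => t1_nonneg g z A fun w hw => hx1 w (by rw [← hz]; simp [hw]))
  have n2 : ∀ z A, z ::ₘ A = x ::ₘ y ::ₘ B → ∀ z' B', z' ::ₘ B' = A → 
      0 ≤ (z:ℚ) * z' * ∑ m ∈ range (z+z'+1), ∑ s ∈ Icc 1 m, kp g (s ::ₘ B') := by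
    intro z A hz z' B' hz'
    refine t2_nonneg g z z' B' (fun w hw => hx1 w (by rw [← hz, ← hz']; simp [hw])) ?_
    have := congrArg Multiset.card hz
    rw [← hz'] at this
    simp at this
    omega
  have n3 : (x:ℚ) * y * ∑ m ∈ range (x+y+1), ∑ s ∈ Icc 1 m, kp g (s ::ₘ B) ≤ 
      dM (fun n A => dM (fun n' B => (n:ℚ) * n' * ∑ m ∈ range (n+n'+1), ∑ s ∈ Icc 1 m, kp g (s ::ₘ B)) A) (x ::ₘ y ::ₘ B) := by
    rw [dM_cons]
    rw [dM_cons]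
    have e1 : 0 ≤ dM (fun z A => (x:ℚ) * z * ∑ m ∈ range (x+z+1), ∑ s ∈ Icc 1 m, kp g (s ::ₘ y ::ₘ A)) B := by
      refine dM_nonneg fun z A hz => n2 x _ rfl z (y ::ₘ A) ?_
      rw [← hz, Multiset.cons_swap]
    have e2 : 0 ≤ dM (fun z A => dM (fun n' B => (z:ℚ) * n' * ∑ m ∈ range (z+n'+1), ∑ s ∈ Icc 1 m, kp g (s ::ₘ B)) (x ::ₘ A)) (y ::ₘ B) := by
      refine dM_nonneg fun z A hz => dM_nonneg fun z' B' hz' => n2 z (x ::ₘ A) ?_ z' B' hz'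
      rw [← hz, Multiset.cons_swap]
    linarith
  set D := 6*g+3*(n-1)-6 with hD
  have hD' : 6*g+3*n-6 = D + 3 := by omega
  have hpos : ∀ s, 1 ≤ s → 0 ≤ kp g (s ::ₘ B) := by
    intro s hs
    refine kp_nonneg _ _ ?_ (by simp; omega)
    intro w hw
    rcases Multiset.mem_cons.1 hw with rfl | hw
    · exact hs
    · exact hx1 w (by simp [hw])
  have n4 : ∀ j, j ≤ t → ((j:ℚ)+1) * (ε * (t:ℚ)^D) ≤ ∑ s ∈ Icc 1 (t+j), kp g (s ::ₘ B) := by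
    intro j hj
    have e1 : ∑ s ∈ Icc t (t+j), kp g (s ::ₘ B) ≤ ∑ s ∈ Icc 1 (t+j), kp g (s ::ₘ B) := by
      refine Finset.sum_le_sum_of_subset_of_nonneg (Finset.Icc_subset_Icc (by omega) le_rfl) fun s hs _ => hpos s (mem_Icc.1 hs).1
    have e2 := Finset.card_nsmul_le_sum (Icc t (t+j)) (fun s => kp g (s ::ₘ B)) (ε * (t:ℚ)^D) (fun s hs => by
      rw [mem_Icc] at hs
      refine H t (by omega) _ (by simp; omega) ?_
      intro w hw
      rcases Multiset.mem_cons.1 hw with rfl | hw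
      · exact ⟨hs.1, by nlinarith⟩
      · exact ⟨(hB w hw).1, (hB w hw).2.trans (by nlinarith)⟩)
    rw [Nat.card_Icc, nsmul_eq_mul] at e2
    have : t + j + 1 - t = j + 1 := by omega
    rw [this] at e2
    push_cast at e2
    linarith
  have n5 : (t:ℚ)^2/2 * (ε * (t:ℚ)^D) ≤ ∑ m ∈ range (x+y+1), ∑ s ∈ Icc 1 m, kp g (s ::ₘ B) := by
    have e1 : ∑ m ∈ Ico t (2*t+1), ∑ s ∈ Icc 1 m, kp g (s ::ₘ B) ≤ ∑ m ∈ range (x+y+1), ∑ s ∈ Icc 1 m, kp g (s ::ₘ B) := by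
      refine Finset.sum_le_sum_of_subset_of_nonneg ?_ fun m _ _ => Finset.sum_nonneg fun s hs => hpos s (mem_Icc.1 hs).1
      intro m hm
      simp only [mem_Ico, mem_range] at hm ⊢
      omega
    rw [Finset.sum_Ico_eq_sum_range] at e1
    have : 2*t+1-t = t+1 := by omega
    rw [this] at e1
    refine le_trans ?_ e1
    have e3 : ∑ j ∈ range (t+1), ((j:ℚ)+1) * (ε * (t:ℚ)^D) ≤ ∑ j ∈ range (t+1), ∑ s ∈ Icc 1 (t+j), kp g (s ::ₘ B) :=
      Finset.sum_le_sum fun j hj => n4 j (by simp at hj; omega)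
    refine le_trans ?_ e3
    rw [← Finset.sum_mul]
    refine mul_le_mul_of_nonneg_right ?_ (by positivity)
    have e4 : ∀ k : ℕ, (k:ℚ)^2/2 ≤ ∑ j ∈ range (k+1), ((j:ℚ)+1) := by
      intro k
      induction k with
      | zero => simp
      | succ k ih =>
        rw [Finset.sum_range_succ]; push_cast
        have : (0:ℚ) ≤ k := Nat.cast_nonneg _
        nlinarith
    exact e4 t
  have n6 : (t:ℚ) * t * ((t:ℚ)^2/2 * (ε * (t:ℚ)^D)) ≤ (x:ℚ) * y * ∑ m ∈ range (x+y+1), ∑ s ∈ Icc 1 m, kp g (s ::ₘ B) := by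
    refine mul_le_mul ?_ n5 (by positivity) (by positivity)
    have : t * t ≤ x * y := Nat.mul_le_mul hX.1 hY.1
    exact_mod_cast this
  have hsum : (x ::ₘ y ::ₘ B).sum ≤ n * (A * t) := by
    have := Multiset.sum_le_card_nsmul (x ::ₘ y ::ₘ B) (A * t) (fun z hz => (hx z hz).2)
    rw [hM] at this
    simpa using this
  have hcoef : 2 * (((2*g+(x ::ₘ y ::ₘ B).sum+(x ::ₘ y ::ₘ B).card:ℕ):ℚ)-2) ≤ K / 2 * t := by
    have e : 2*g+(x ::ₘ y ::ₘ B).sum+(x ::ₘ y ::ₘ B).card ≤ (2*g+n+n*A) * t := by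
      rw [hM]
      have : 1 ≤ t := by omega
      nlinarith
    have e' : ((2*g+(x ::ₘ y ::ₘ B).sum+(x ::ₘ y ::ₘ B).card:ℕ):ℚ) ≤ (2*g+n+n*A) * t := by exact_mod_cast e
    rw [hK]; nlinarith
  have hk0 : 0 ≤ kp g (x ::ₘ y ::ₘ B) := kp_nonneg _ _ hx1 (by rw [hM]; omega)
  have htp : (0:ℚ) < t := by exact_mod_cast (by omega)
  have fin : (t:ℚ) * t * ((t:ℚ)^2/2 * (ε * (t:ℚ)^D)) ≤ K / 2 * t * kp g (x ::ₘ y ::ₘ B) := by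
    have := mul_le_mul_of_nonneg_right hcoef hk0
    linarith
  rw [hD', div_mul_eq_mul_div, div_le_iff₀ hKpos, pow_add]
  have e5 : (t:ℚ) * t * ((t:ℚ)^2/2 * (ε * (t:ℚ)^D)) = (t/2) * (ε * ((t:ℚ)^D * (t:ℚ)^3)) := by ring
  have e6 : K / 2 * t * kp g (x ::ₘ y ::ₘ B) = (t/2) * (kp g (x ::ₘ y ::ₘ B) * K) := by ring
  rw [e5, e6] at fin
  exact le_of_mul_le_mul_left fin (by positivity)

lemma lb_cut (g : ℕ) (hg : 1 ≤ g) (IH : LB g 2) : LB (g+1) 1 := by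
  intro A
  obtain ⟨ε, hε, t0, H⟩ := IH 2
  set D := 6*g+3*2-6 with hD
  have hD' : 6*(g+1)+3*1-6 = D + 3 := by omega
  set K : ℚ := 4 * (g+1) * 12^(D+3) with hK
  have hKpos : 0 < K := by positivity
  refine ⟨ε / K, by positivity, 6*t0 + 6, fun t ht M hM hx => ?_⟩
  obtain ⟨x, rfl⟩ := Multiset.card_eq_one.1 hM
  have hX := (hx x (by simp)).1
  have hR := Rk (g+1) {x} (by simp; omega) (by simp) (by simp; omega)
  have e0 : ({x} : Multiset ℕ) = x ::ₘ 0 := rfl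
  rw [e0, dM_cons, dM_cons] at hR
  simp only [dM_zero, add_zero] at hR
  set u := t / 6 with hu
  have hut0 : t0 + 1 ≤ u := by omega
  have hpos : ∀ r s, 1 ≤ r → 1 ≤ s → 0 ≤ cut ksp (g+1) r s 0 := fun r s hr hs => cut_nonneg _ _ _ _ hr hs (by simp)
  have hcut : ∀ r s, u ≤ r → r ≤ 2*u → u ≤ s → s ≤ 2*u → ε * (u:ℚ)^D ≤ cut ksp (g+1) r s 0 := by
    intro r s h1 h2 h3 h4
    have e := conv_ksp_nonneg (g+1) r s 0 (by omega) (by omega) (by simp)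
    have e1 := H u (by omega) (r ::ₘ s ::ₘ 0) (by simp) (by simp; omega)
    unfold cut
    have e2 : gs (fun g => ksp g (r ::ₘ s ::ₘ 0)) (g+1) = kp g (r ::ₘ s ::ₘ 0) := ksp_eq (by simp; omega)
    rw [e2]; linarith
  have hmain : (u:ℚ)^3 * (ε * (u:ℚ)^D) ≤ ∑ ab ∈ antidiagonal x, ∑ r ∈ Icc 1 ab.1, ∑ s ∈ Icc 1 ab.2, cut ksp (g+1) r s 0 := by
    rw [Finset.Nat.sum_antidiagonal_eq_sum_range_succ_mk]
    have e1 : ∑ a ∈ Icc (2*u) (3*u), ∑ r ∈ Icc u (2*u), ∑ s ∈ Icc u (2*u), cut ksp (g+1) r s 0 ≤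
        ∑ a ∈ Icc (2*u) (3*u), ∑ r ∈ Icc 1 a, ∑ s ∈ Icc 1 (x-a), cut ksp (g+1) r s 0 := by
      refine Finset.sum_le_sum fun a ha => ?_
      rw [mem_Icc] at ha
      refine le_trans (Finset.sum_le_sum fun r hr => ?_) (Finset.sum_le_sum_of_subset_of_nonneg 
        (s := Icc u (2*u)) (Finset.Icc_subset_Icc (by omega) (by omega)) fun r hr _ => 
          Finset.sum_nonneg fun s hs => hpos r s (mem_Icc.1 hr).1 (mem_Icc.1 hs).1)
      rw [mem_Icc] at hr
      exact Finset.sum_le_sum_of_subset_of_nonneg (Finset.Icc_subset_Icc (by omega) (by omega)) fun s hs _ =>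
        hpos r s (by omega) (mem_Icc.1 hs).1
    have e2 : ∑ a ∈ Icc (2*u) (3*u), ∑ r ∈ Icc 1 a, ∑ s ∈ Icc 1 (x-a), cut ksp (g+1) r s 0 ≤
        ∑ a ∈ range (x+1), ∑ r ∈ Icc 1 a, ∑ s ∈ Icc 1 (x-a), cut ksp (g+1) r s 0 := by
      refine Finset.sum_le_sum_of_subset_of_nonneg ?_ fun a _ _ => Finset.sum_nonneg fun r hr => 
          Finset.sum_nonneg fun s hs => hpos r s (mem_Icc.1 hr).1 (mem_Icc.1 hs).1
      intro a ha
      simp only [mem_Icc, mem_range] at ha ⊢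
      omega
    refine le_trans ?_ (e1.trans e2)
    have e3 : ∑ a ∈ Icc (2*u) (3*u), ∑ r ∈ Icc u (2*u), ∑ s ∈ Icc u (2*u), ε * (u:ℚ)^D ≤ 
      ∑ a ∈ Icc (2*u) (3*u), ∑ r ∈ Icc u (2*u), ∑ s ∈ Icc u (2*u), cut ksp (g+1) r s 0 := by
      refine Finset.sum_le_sum fun a _ => Finset.sum_le_sum fun r hr => Finset.sum_le_sum fun s hs => ?_
      rw [mem_Icc] at hr hs
      exact hcut r s hr.1 hr.2 hs.1 hs.2
    refine le_trans ?_ e3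
    simp only [Finset.sum_const, Nat.card_Icc, nsmul_eq_mul]
    have c1 : 3*u+1-2*u = u+1 := by omega
    have c2 : 2*u+1-u = u+1 := by omega
    rw [c1, c2, ← mul_assoc, ← mul_assoc, ← mul_assoc, ← mul_assoc]
    push_cast
    have : (u:ℚ)^3 ≤ ((u:ℚ)+1)*(u+1)*(u+1) := by
      have : (0:ℚ) ≤ u := Nat.cast_nonneg _
      nlinarith [sq_nonneg (u:ℚ)]
    gcongr
  have htp : (0:ℚ) < x := by exact_mod_cast (by omega)
  have hk0 : 0 ≤ kp (g+1) (x ::ₘ 0) := kp_nonneg _ _ (by simp; omega) (by simp)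
  have hcoef : 2 * (((2*(g+1)+(x ::ₘ (0:Multiset ℕ)).sum+(x ::ₘ (0:Multiset ℕ)).card:ℕ):ℚ)-2) ≤ 4 * (g+1) * x := by
    simp only [Multiset.sum_cons, Multiset.sum_zero, Multiset.card_cons, Multiset.card_zero]
    push_cast
    have : (1:ℚ) ≤ x := by exact_mod_cast (by omega)
    have : (0:ℚ) ≤ g := Nat.cast_nonneg _
    nlinarith
  have f1 := mul_le_mul_of_nonneg_right hcoef hk0
  have f2 := mul_le_mul_of_nonneg_left hmain htp.le
  have f3 : x * ((u:ℚ)^3 * (ε * (u:ℚ)^D)) ≤ x * (4 * (g+1) * kp (g+1) (x ::ₘ 0)) := by linarith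
  have f4 := le_of_mul_le_mul_left f3 htp
  rw [e0, hD', div_mul_eq_mul_div, div_le_iff₀ hKpos]
  have hu12 : (t:ℚ) ≤ 12 * u := by exact_mod_cast (by omega)
  have f5 : (t:ℚ)^(D+3) ≤ 12^(D+3) * (u:ℚ)^(D+3) := by
    rw [← mul_pow]; exact pow_le_pow_left₀ (Nat.cast_nonneg _) hu12 _
  calc ε * (t:ℚ)^(D+3) ≤ ε * (12^(D+3) * (u:ℚ)^(D+3)) := mul_le_mul_of_nonneg_left f5 hε.le
    _ = 12^(D+3) * ((u:ℚ)^3 * (ε * (u:ℚ)^D)) := by ring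
    _ ≤ 12^(D+3) * (4 * (g+1) * kp (g+1) (x ::ₘ 0)) := mul_le_mul_of_nonneg_left f4 (by positivity)
    _ = _ := by rw [hK]; ring

theorem lb_all (s : ℕ) : ∀ g n, 2*g+n = s → 2 < 2*g+n → 1 ≤ n → LB g n := by
  induction s using Nat.strong_induction_on with
  | _ s IH =>
    intro g n hs hgn hn
    by_cases h : g = 0 ∧ n ≤ 3
    · obtain ⟨rfl, h⟩ := h
      obtain rfl : n = 3 := by omega
      exact lb_03
    by_cases h' : g = 1 ∧ n ≤ 1
    · obtain ⟨rfl, h'⟩ := h'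
      obtain rfl : n = 1 := by omega
      exact lb_11
    by_cases h2 : 2 ≤ n
    · exact lb_join g n h2 h (IH _ (by omega) g (n-1) rfl (by omega) (by omega))
    · obtain rfl : n = 1 := by omega
      obtain ⟨g, rfl⟩ : ∃ g', g = g' + 1 := ⟨g - 1, by omega⟩
      exact lb_cut g (by omega) (IH _ (by omega) g 2 rfl (by omega) (by omega))

theorem deg_exact (g n : ℕ) (hgn : 2 < 2*g+n) (hn : 1 ≤ n) :
    ∃ P : MvPolynomial (Fin n) ℚ, P.totalDegree = 6*g+3*n-6 ∧
    ∀ μ : Fin n → ℕ, (∀ i, 1 ≤ μ i) → kp g (univ.val.map μ) = MvPolynomial.eval (fun i => (μ i : ℚ)) P := by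
  obtain ⟨P, h1, h2⟩ := pol_all _ g n rfl hgn hn
  beta_reduce at h2
  refine ⟨P, le_antisymm h1 ?_, h2⟩
  by_contra hlt
  push Not at hlt
  obtain ⟨ε, hε, t0, H⟩ := lb_all _ g n rfl hgn hn 1
  obtain ⟨D, hD⟩ : ∃ D, 6*g+3*n-6 = D + 1 := ⟨6*g+3*n-7, by omega⟩
  set K : ℚ := ∑ m ∈ P.support, |P.coeff m| with hK
  obtain ⟨t, ht⟩ := exists_nat_gt (K / ε)
  set T := max t (t0 + 1) with hT
  have hT1 : 1 ≤ T := by omega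
  have hTt : (t:ℚ) ≤ T := by exact_mod_cast (by omega)
  have hTq : (1:ℚ) ≤ T := by exact_mod_cast hT1
  have e1 := H T (by omega) (univ.val.map fun _ : Fin n => T) (by simp)
    (by intro x hx; obtain ⟨i, _, rfl⟩ := Multiset.mem_map.1 hx; omega)
  rw [h2 _ (fun _ => hT1), hD] at e1
  have e2 : MvPolynomial.eval (fun _ : Fin n => (T:ℚ)) P ≤ K * (T:ℚ)^D := by
    rw [MvPolynomial.eval_eq', hK, Finset.sum_mul]
    refine Finset.sum_le_sum fun m hm => ?_
    rw [Finset.prod_pow_eq_pow_sum]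
    have hmd := MvPolynomial.le_totalDegree hm
    rw [Finsupp.sum_fintype _ _ (fun _ => rfl)] at hmd
    have : (T:ℚ)^(∑ i, m i) ≤ (T:ℚ)^D := pow_le_pow_right₀ hTq (by omega)
    exact mul_le_mul (le_abs_self _) this (by positivity) (abs_nonneg _)
  have e3 : ε * T * (T:ℚ)^D ≤ K * (T:ℚ)^D := by
    calc ε * T * (T:ℚ)^D = ε * (T:ℚ)^(D+1) := by ring
      _ ≤ _ := e1.trans e2
  have e4 := le_of_mul_le_mul_right e3 (by positivity)
  rw [div_lt_iff₀ hε] at ht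
  nlinarith

end PH

namespace PH
open Finset Equiv
set_option linter.unusedSectionVars false

section
variable {X : Type} [Fintype X] [DecidableEq X]

theorem deg_ofFn {m : ℕ} (σ : Fin m → Sw X) (x : X) :
    deg (List.ofFn σ) x = Nat.card {i : Fin m // (σ i).1 x ≠ x} := by
  classical
  unfold deg
  rw [Nat.card_eq_fintype_card, Fintype.card_subtype]
  have h := Multiset.countP_map σ (univ : Finset (Fin m)).val (fun τ : Sw X => τ.1 x ≠ x)
  rw [Fin.univ_val_map, Multiset.coe_countP] at h
  rw [h]; rfl

theorem conn_ofFn [Nonempty X] {m : ℕ} (σ : Fin m → Sw X) : Conn (List.ofFn σ) ↔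
    ∀ x y : X, ∃ g ∈ Subgroup.closure (Set.range fun i => (σ i).1), g x = y := by
  classical
  have hmem : ∀ τ, τ ∈ List.ofFn σ ↔ ∃ i, σ i = τ := fun τ => by simp [List.mem_ofFn]
  constructor
  · rintro ⟨_, h⟩ x y
    have := h (univ.filter fun y => ∃ g ∈ Subgroup.closure (Set.range fun i => (σ i).1), g x = y) (by simp)
      ⟨x, by simpa using ⟨1, Subgroup.one_mem _, rfl⟩⟩ (by
        intro τ hτ z hz
        obtain ⟨i, rfl⟩ := (hmem τ).1 hτ
        simp only [mem_filter, mem_univ, true_and] at hz ⊢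
        obtain ⟨g, hg, rfl⟩ := hz
        exact ⟨(σ i).1 * g, Subgroup.mul_mem _ (Subgroup.subset_closure ⟨i, rfl⟩) hg, rfl⟩)
    have hy : y ∈ (univ : Finset X) := mem_univ y
    rw [← this] at hy
    simpa using hy
  · intro h
    refine ⟨inferInstance, fun B _ ⟨x, hx⟩ hB => ?_⟩
    have key : ∀ g ∈ Subgroup.closure (Set.range fun i => (σ i).1), ∀ z, g z ∈ B ↔ z ∈ B := by
      intro g hg
      induction hg using Subgroup.closure_induction with
      | mem g hg =>
        obtain ⟨i, rfl⟩ := hg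
        intro z
        have hi : ∀ w ∈ B, (σ i).1 w ∈ B := hB _ ((hmem _).2 ⟨i, rfl⟩)
        refine ⟨fun h => ?_, hi z⟩
        have := hi _ h
        have hsq : (σ i).1 ((σ i).1 z) = z := by
          obtain ⟨a, b, _, hab⟩ := (σ i).2
          rw [hab]; simp
        rwa [hsq] at this
      | one => intro z; rfl
      | mul a b _ _ ha hb => intro z; rw [Perm.mul_apply, ha, hb]
      | inv a _ ha => intro z; rw [← ha (a⁻¹ z)]; simp
    ext y
    refine ⟨fun _ => mem_univ _, fun _ => ?_⟩
    obtain ⟨g, hg, rfl⟩ := h x y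
    exact (key g hg x).2 hx
end

theorem card_pruned {d m : ℕ} (hd : 1 ≤ d) (T : Perm (Fin d)) :
    Nat.card {σ : Fin m → Perm (Fin d) // IsPrunedFactorisation T σ} = KN m T := by
  classical
  have : Nonempty (Fin d) := ⟨⟨0, hd⟩⟩
  unfold KN
  rw [← Fintype.card_subtype, ← Nat.card_eq_fintype_card]
  have key : ∀ σ : Fin m → Sw (Fin d), IsPrunedFactorisation T (fun i => (σ i).1) ↔
      (pr (List.ofFn σ) = T ∧ Conn (List.ofFn σ) ∧ ∀ x, 2 ≤ deg (List.ofFn σ) x) := by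
    intro σ
    unfold IsPrunedFactorisation
    rw [conn_ofFn]
    simp only [deg_ofFn]
    have : pr (List.ofFn σ) = (List.ofFn fun i => (σ i).1).prod := by
      unfold pr; rw [List.map_ofFn]; rfl
    rw [this]
    exact ⟨fun h => h.2, fun h => ⟨fun i => (σ i).2, h⟩⟩
  refine Nat.card_congr
    { toFun := fun σ => ⟨fun i => ⟨σ.1 i, σ.2.1 i⟩, (key _).1 σ.2⟩
      invFun := fun σ => ⟨fun i => (σ.1 i).1, (key _).2 σ.2⟩
      left_inv := fun σ => rfl
      right_inv := fun σ => rfl }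

end PH

theorem prunedHurwitz_polynomiality (K : ℕ → Multiset ℕ → ℚ)
    (hK : IsNormalisedPrunedHurwitz K)
    (g n : ℕ) (hn : 1 ≤ n) (hgn : 2 < 2 * g + n) :
    ∃ P : MvPolynomial (Fin n) ℚ,
      P.totalDegree = 6 * g + 3 * n - 6 ∧
      ∀ μ : Fin n → ℕ, (∀ i, 1 ≤ μ i) →
        K g (Multiset.map μ Finset.univ.val) =
          MvPolynomial.eval (fun i => (μ i : ℚ)) P := by
  obtain ⟨P, hP1, hP2⟩ := PH.deg_exact g n hgn hn
  refine ⟨P, hP1, fun μ hμ => ?_⟩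
  rw [← hP2 μ hμ]
  set M : Multiset ℕ := Multiset.map μ Finset.univ.val with hM
  have hM1 : ∀ x ∈ M, 1 ≤ x := by
    intro x hx
    obtain ⟨i, _, rfl⟩ := Multiset.mem_map.1 hx
    exact hμ i
  have hc : M.card = n := by simp [hM]
  have hs : M.card ≤ M.sum := by
    have := Multiset.card_nsmul_le_sum (s := M) (a := 1) hM1
    simpa using this
  obtain ⟨T, hT⟩ := PH.exists_Ty M hM1
  rw [hK g M hM1 T (by rw [PH.cycleType_eq, hT]), PH.card_pruned (by omega),
    PH.KN_eq T _ g (by rw [hT]; omega) (by rw [hT]; omega) (by omega), hT]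
  have : ((Nat.factorial (2 * g + Multiset.card M + M.sum - 2) : ℕ) : ℚ) ≠ 0 := by positivity
  field_simp
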